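/- Let $K$ be an algebraically closed field and let $\Gamma$ be a finite tree with a cyclic ordering of the edges at each vertex. Let $Q_\Gamma$ be the quiver whose vertices are the edges of $\Gamma$ and which has, for every vertex $v$ of $\Gamma$ and every edge $i$ at $v$, an arrow from $i$ to the edge that follows $i$ in the cyclic order at $v$ (a loop if $v$ is a leaf). Thus $Q_\Gamma$ is a union of oriented cycles, one for each vertex of $\Gamma$, and each vertex of $Q_\Gamma$ lies on exactly two of them. Let $A = KQ_\Gamma/I$ be the basic Brauer tree algebra of $\Gamma$ with multiplicity one: $I$ is generated by the products of two composable arrows from different cycles and, for each vertex $x$ of $Q_\Gamma$, by the difference of the two full cycles that start at $x$. The product $ab$ means $a$ followed by $b$; modules are finitely generated left modules, and $e_i$ is the idempotent at the vertex $i$. An $A$-cycle is a maximal ordered set of nonrepeating arrows in which the product in $A$ of any two neighboring arrows is nonzero. Then there is a one-to-one correspondence between * isomorphism classes (as two-term complexes) of minimal projective presentations $P_0 \to P_1$ of indecomposable non-projective $A$-modules $M$ that are not isomorphic to $P/\mathrm{soc}(P)$ for any indecomposable projective module $P$, and * connected paths $\Theta$ on $Q_\Gamma$ (arrows may be traversed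 in either direction, and a path is identified with its reverse) without self-intersections, i.e. visiting no vertex twice, which change their orientation every time they change $A$-cycle and which consist of more than one vertex. Under this correspondence the presentation belonging to $\Theta$ is isomorphic to the complex $$\bigoplus_{i \text{ a source of } \Theta} Ae_i \longrightarrow \bigoplus_{j \text{ a sink of } \Theta} Ae_j$$ with degree-$0$ term on the left and degree-$1$ term on the right, whose component $Ae_i \to Ae_j$ is right multiplication by the directed subpath of $\Theta$ from $i$ to $j$ if there is one, and zero otherwise. -/

import Mathlib

universe u v

/-! ### Modules -/

section Modules

variable (A : Type u) [Ring A]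

/-- A module is indecomposable if it is nonzero and is not the direct sum of two nonzero
submodules. -/
def IsIndecomposableModule (M : Type v) [AddCommGroup M] [Module A M] : Prop :=
  Nontrivial M ∧ ∀ N N' : Submodule A M, IsCompl N N' → N = ⊥ ∨ N' = ⊥

/-- The socle: the sum of all simple submodules. -/
def moduleSocle (M : Type v) [AddCommGroup M] [Module A M] : Submodule A M :=
  sSup {S : Submodule A M | IsSimpleModule A S}

variable {A}

/-- A superfluous (small) submodule. -/
def IsSuperfluous {M : Type v} [AddCommGroup M] [Module A M] (N : Submodule A M) : Prop :=
  ∀ L : Submodule A M, L ⊔ N = ⊤ → L = ⊤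

/-- `P₀ --d--> P₁ --π--> M → 0` is a minimal projective presentation of `M` by finitely generated
projective modules: it is exact, `π` is a projective cover of `M`, and `d` is a projective cover
of `ker π`. -/
structure IsMinimalProjectivePresentation {P₀ P₁ M : Type v}
    [AddCommGroup P₀] [Module A P₀] [AddCommGroup P₁] [Module A P₁] [AddCommGroup M] [Module A M]
    (d : P₀ →ₗ[A] P₁) (π : P₁ →ₗ[A] M) : Prop where
  finite₀ : Module.Finite A P₀
  finite₁ : Module.Finite A P₁
  projective₀ : Module.Projective A P₀
  projective₁ : Module.Projective A P₁
  surjective : Function.Surjective π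
  exact : Function.Exact d π
  minimal₁ : IsSuperfluous (LinearMap.ker π)
  minimal₀ : IsSuperfluous (LinearMap.ker d)

variable (A)

/-- The minimal projective presentations `P₀ → P₁` of the finitely generated indecomposable
non-projective `A`-modules `M` that are not isomorphic to `P / soc P` for any (finitely generated)
indecomposable projective module `P`. -/
structure Presentation where
  P₀ : ModuleCat.{u} A
  P₁ : ModuleCat.{u} A
  M : ModuleCat.{u} A
  d : P₀ →ₗ[A] P₁
  π : P₁ →ₗ[A] M
  minimal : IsMinimalProjectivePresentation d π
  indecomposable : IsIndecomposableModule A M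
  not_projective : ¬ Module.Projective A M
  not_mod_socle : ∀ (P : Type u) [AddCommGroup P] [Module A P],
    Module.Finite A P → Module.Projective A P → IsIndecomposableModule A P →
      IsEmpty (M ≃ₗ[A] P ⧸ moduleSocle A P)

variable {A}

/-- Isomorphism of two-term complexes `d : P₀ → P₁` and `d' : Q₀ → Q₁`. -/
def ComplexIso {P₀ P₁ Q₀ Q₁ : Type u}
    [AddCommGroup P₀] [Module A P₀] [AddCommGroup P₁] [Module A P₁]
    [AddCommGroup Q₀] [Module A Q₀] [AddCommGroup Q₁] [Module A Q₁]
    (d : P₀ →ₗ[A] P₁) (d' : Q₀ →ₗ[A] Q₁) : Prop :=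
  ∃ (φ₀ : P₀ ≃ₗ[A] Q₀) (φ₁ : P₁ ≃ₗ[A] Q₁), ∀ x, φ₁ (d x) = d' (φ₀ x)

variable (A)

/-- Presentations are identified when the complexes `P₀ → P₁` are isomorphic. -/
instance Presentation.setoid : Setoid (Presentation A) where
  r T T' := ComplexIso T.d T'.d
  iseqv :=
    { refl := fun _ => ⟨LinearEquiv.refl _ _, LinearEquiv.refl _ _, fun _ => rfl⟩
      symm := by
        rintro T T' ⟨φ₀, φ₁, h⟩
        refine ⟨φ₀.symm, φ₁.symm, fun x => ?_⟩
        rw [LinearEquiv.symm_apply_eq, h, LinearEquiv.apply_symm_apply]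
      trans := by
        rintro T T' T'' ⟨φ₀, φ₁, h⟩ ⟨ψ₀, ψ₁, h'⟩
        refine ⟨φ₀.trans ψ₀, φ₁.trans ψ₁, fun x => ?_⟩
        simp only [LinearEquiv.trans_apply, h, h'] }

/-- Isomorphism classes of presentations. -/
def PresentationClass : Type (u + 1) := Quotient (Presentation.setoid A)

end Modules

/-! ### Path algebras -/

section PathAlgebra

variable (K : Type u) [Field K] {Q₀ Q₁ : Type v} [Fintype Q₀] (s t : Q₁ → Q₀)

/-- The defining relations of the path algebra of the finite quiver with vertices `Q₀`, arrows `Q₁`,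
source map `s` and target map `t`, as a quotient of the free algebra on vertices and arrows.
A product `a * b` of arrows means `a` followed by `b`. -/
inductive PathAlgebra.Rel : FreeAlgebra K (Q₀ ⊕ Q₁) → FreeAlgebra K (Q₀ ⊕ Q₁) → Prop
  | idem (i : Q₀) :
      Rel (FreeAlgebra.ι K (.inl i) * FreeAlgebra.ι K (.inl i)) (FreeAlgebra.ι K (.inl i))
  | orth (i j : Q₀) (h : i ≠ j) :
      Rel (FreeAlgebra.ι K (.inl i) * FreeAlgebra.ι K (.inl j)) 0
  | one : Rel (∑ i : Q₀, FreeAlgebra.ι K (.inl i)) 1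
  | source (a : Q₁) :
      Rel (FreeAlgebra.ι K (.inl (s a)) * FreeAlgebra.ι K (.inr a)) (FreeAlgebra.ι K (.inr a))
  | target (a : Q₁) :
      Rel (FreeAlgebra.ι K (.inr a) * FreeAlgebra.ι K (.inl (t a))) (FreeAlgebra.ι K (.inr a))

/-- The path algebra `KQ`. -/
def PathAlgebra : Type (max u v) := RingQuot (PathAlgebra.Rel K s t)

noncomputable instance : Ring (PathAlgebra K s t) :=
  inferInstanceAs (Ring (RingQuot (PathAlgebra.Rel K s t)))

noncomputable instance : Algebra K (PathAlgebra K s t) :=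
  inferInstanceAs (Algebra K (RingQuot (PathAlgebra.Rel K s t)))

/-- The quotient map from the free algebra to the path algebra. -/
noncomputable def PathAlgebra.mk : FreeAlgebra K (Q₀ ⊕ Q₁) →ₐ[K] PathAlgebra K s t :=
  RingQuot.mkAlgHom K (PathAlgebra.Rel K s t)

/-- The trivial path at a vertex. -/
noncomputable def PathAlgebra.vertex (i : Q₀) : PathAlgebra K s t :=
  PathAlgebra.mk K s t (FreeAlgebra.ι K (.inl i))

/-- The path of length one given by an arrow. -/
noncomputable def PathAlgebra.arrow (a : Q₁) : PathAlgebra K s t :=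
  PathAlgebra.mk K s t (FreeAlgebra.ι K (.inr a))

end PathAlgebra

/-! ### Brauer trees and their quivers -/

/-- A Brauer tree (all multiplicities one) on the vertex set `V`: a tree together with a cyclic
ordering of the edges at each vertex. A dart is an edge together with one of its end points
`fst`; `next` sends an edge at `fst` to the following edge at the same vertex, and it permutes the
edges at each vertex in a single cycle. -/
structure BrauerTree (V : Type v) where
  graph : SimpleGraph V
  isTree : graph.IsTree
  next : Equiv.Perm graph.Dart
  next_fst : ∀ a, (next a).fst = a.fst
  sameCycle : ∀ a b, a.fst = b.fst → next.SameCycle a b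

namespace BrauerTree

variable {V : Type v} (Γ : BrauerTree V)

/-- The vertices of the Brauer quiver are the edges of the tree. -/
abbrev Edge : Type v := Γ.graph.edgeSet

/-- The arrows of the Brauer quiver: the dart `a` gives the arrow from the edge of `a` to the edge
that follows it around the vertex `a.fst` (a loop if that vertex is a leaf). -/
abbrev Arrow : Type v := Γ.graph.Dart

/-- The source of an arrow. -/
def src (a : Γ.Arrow) : Γ.Edge := ⟨a.edge, a.edge_mem⟩

/-- The target of an arrow. -/
def tgt (a : Γ.Arrow) : Γ.Edge := Γ.src (Γ.next a)

variable [Finite V]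

noncomputable instance : Fintype Γ.Edge := Fintype.ofFinite _

variable (K : Type u) [Field K]

/-- In the path algebra, the product of the `k` successive arrows around `a.fst` that starts
with `a`. -/
noncomputable def run (a : Γ.Arrow) (k : ℕ) : PathAlgebra K Γ.src Γ.tgt :=
  ((List.range k).map fun m => PathAlgebra.arrow K Γ.src Γ.tgt (Γ.next^[m] a)).prod

/-- The generators of the ideal of relations. The first family consists of the products of two
composable arrows belonging to different cycles of the Brauer quiver. The second one says that
at each vertex of the quiver the two full cycles that start there agree; they start with `a` and
with `a.symm`, the two darts of the same edge. -/
inductive Rel : PathAlgebra K Γ.src Γ.tgt → PathAlgebra K Γ.src Γ.tgt → Prop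
  | mixed (a b : Γ.Arrow) (h : Γ.tgt a = Γ.src b) (hne : b ≠ Γ.next a) :
      Rel (PathAlgebra.arrow K Γ.src Γ.tgt a * PathAlgebra.arrow K Γ.src Γ.tgt b) 0
  | cycles (a : Γ.Arrow) :
      Rel (Γ.run K a (Function.minimalPeriod Γ.next a))
        (Γ.run K a.symm (Function.minimalPeriod Γ.next a.symm))

/-- The basic Brauer tree algebra with multiplicity one. -/
def Alg : Type (max u v) := RingQuot (Γ.Rel K)

noncomputable instance : Ring (Γ.Alg K) := inferInstanceAs (Ring (RingQuot (Γ.Rel K)))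

noncomputable instance : Algebra K (Γ.Alg K) :=
  inferInstanceAs (Algebra K (RingQuot (Γ.Rel K)))

/-- The quotient map from the path algebra to the Brauer tree algebra. -/
noncomputable def quot : PathAlgebra K Γ.src Γ.tgt →ₐ[K] Γ.Alg K :=
  RingQuot.mkAlgHom K (Γ.Rel K)

/-- The idempotent `e_i`. -/
noncomputable def e (i : Γ.Edge) : Γ.Alg K :=
  Γ.quot K (PathAlgebra.vertex K Γ.src Γ.tgt i)

/-- The class of an arrow in the algebra. -/
noncomputable def arr (a : Γ.Arrow) : Γ.Alg K :=
  Γ.quot K (PathAlgebra.arrow K Γ.src Γ.tgt a)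

/-- The indecomposable projective left module `A e_i`. -/
noncomputable def proj (i : Γ.Edge) : Submodule (Γ.Alg K) (Γ.Alg K) :=
  Submodule.span (Γ.Alg K) {Γ.e K i}

/-! ### A-cycles and paths on the quiver -/

/-- An ordered set of nonrepeating arrows in which the product of any two neighbors is nonzero. -/
def IsNonzeroChain (l : List Γ.Arrow) : Prop :=
  l.Nodup ∧ l.IsChain fun a b => Γ.arr K a * Γ.arr K b ≠ 0

/-- An `A`-cycle: a maximal ordered set of nonrepeating arrows in which the product of any two
neighbors is nonzero. (The cyclic rotations of an `A`-cycle appear as different lists.) -/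
def IsACycle (l : List Γ.Arrow) : Prop :=
  Γ.IsNonzeroChain K l ∧ ∀ l', Γ.IsNonzeroChain K l' → l.Sublist l' → l' = l

/-- Two arrows lie on a common `A`-cycle. -/
def OnSameACycle (a b : Γ.Arrow) : Prop :=
  ∃ l, Γ.IsACycle K l ∧ a ∈ l ∧ b ∈ l

variable {Γ} in
/-- A step `(a, true)` follows the arrow `a`, a step `(a, false)` goes along `a` against its
orientation; this is the vertex at which the step begins. -/
def stepStart (s : Γ.Arrow × Bool) : Γ.Edge := if s.2 then Γ.src s.1 else Γ.tgt s.1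

variable {Γ} in
/-- The vertex at which a step ends. -/
def stepEnd (s : Γ.Arrow × Bool) : Γ.Edge := if s.2 then Γ.tgt s.1 else Γ.src s.1

variable {Γ} in
/-- The vertices visited by a walk, in order. -/
def walkVertices (w : List (Γ.Arrow × Bool)) : List Γ.Edge :=
  (w.head?.map stepStart).toList ++ w.map stepEnd

/-- A walk on the quiver (ignoring the orientation of arrows) with at least one step, with no
repeated vertex, which changes its orientation every time it changes `A`-cycle. -/
structure IsAdmissibleWalk (w : List (Γ.Arrow × Bool)) : Prop where
  ne_nil : w ≠ []
  connected : w.IsChain fun s s' => stepEnd s = stepStart s'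
  simple : (walkVertices w).Nodup
  turns : w.IsChain fun s s' => ¬ Γ.OnSameACycle K s.1 s'.1 → s.2 ≠ s'.2

/-- The connected paths on the quiver of `A` without self-intersections which change their
orientation every time they change `A`-cycle and which have more than one vertex. Such a path is
recorded as the set of its arrows, so that a walk and the reversed walk give the same path. -/
structure AdmissiblePath where
  arrows : Set Γ.Arrow
  isPath : ∃ w, Γ.IsAdmissibleWalk K w ∧ arrows = {a | ∃ b, (a, b) ∈ w}

variable {Γ K}

namespace AdmissiblePath

variable (Θ : Γ.AdmissiblePath K)

/-- The sources of the path: an arrow of the path starts there and none ends there. -/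
def IsSource (i : Γ.Edge) : Prop :=
  (∃ a ∈ Θ.arrows, Γ.src a = i) ∧ ∀ a ∈ Θ.arrows, Γ.tgt a ≠ i

/-- The sinks of the path: an arrow of the path ends there and none starts there. -/
def IsSink (j : Γ.Edge) : Prop :=
  (∃ a ∈ Θ.arrows, Γ.tgt a = j) ∧ ∀ a ∈ Θ.arrows, Γ.src a ≠ j

/-- `p` is a directed subpath of `Θ` from `i` to `j`. -/
def IsDirectedSubpath : Γ.Edge → List Γ.Arrow → Γ.Edge → Prop
  | i, [], j => i = j
  | i, a :: p, j => a ∈ Θ.arrows ∧ Γ.src a = i ∧ IsDirectedSubpath (Γ.tgt a) p j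

end AdmissiblePath

variable (Γ K) in
/-- The element of `A` given by a path that starts at `i`. -/
noncomputable def pathElement (i : Γ.Edge) (p : List Γ.Arrow) : Γ.Alg K :=
  Γ.e K i * (p.map (Γ.arr K)).prod

theorem e_mul_arr (a : Γ.Arrow) : Γ.e K (Γ.src a) * Γ.arr K a = Γ.arr K a := by
  unfold e arr PathAlgebra.vertex PathAlgebra.arrow
  rw [← map_mul, ← map_mul]
  exact congrArg _ (RingQuot.mkAlgHom_rel K (PathAlgebra.Rel.source a))

theorem arr_mul_e (a : Γ.Arrow) : Γ.arr K a * Γ.e K (Γ.tgt a) = Γ.arr K a := by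
  unfold e arr PathAlgebra.vertex PathAlgebra.arrow
  rw [← map_mul, ← map_mul]
  exact congrArg _ (RingQuot.mkAlgHom_rel K (PathAlgebra.Rel.target a))

namespace AdmissiblePath

variable (Θ : Γ.AdmissiblePath K)

theorem pathElement_mem {i j : Γ.Edge} {p : List Γ.Arrow} (h : Θ.IsDirectedSubpath i p j) :
    Γ.pathElement K i p ∈ Γ.proj K j := by
  induction p generalizing i with
  | nil =>
    obtain rfl : i = j := h
    simp [pathElement, proj]
  | cons a p ih =>
    obtain ⟨-, rfl, h⟩ := h
    have h1 := (Γ.proj K j).smul_mem (Γ.arr K a) (ih h)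
    have h2 : Γ.pathElement K (Γ.src a) (a :: p)
        = Γ.arr K a • Γ.pathElement K (Γ.tgt a) p := by
      simp only [pathElement, List.map_cons, List.prod_cons, smul_eq_mul]
      rw [← mul_assoc, ← mul_assoc, e_mul_arr, arr_mul_e]
    rwa [h2]

/-- The sum of the elements of `A` given by the directed subpaths of `Θ` from `i` to `j`
(there is at most one such subpath). -/
noncomputable def coefficient (i j : Γ.Edge) : Γ.Alg K :=
  ∑ᶠ (p : List Γ.Arrow) (_ : Θ.IsDirectedSubpath i p j), Γ.pathElement K i p

theorem coefficient_mem (i j : Γ.Edge) : Θ.coefficient i j ∈ Γ.proj K j :=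
  finsum_mem_induction (s := {p | Θ.IsDirectedSubpath i p j}) (fun x => x ∈ Γ.proj K j)
    (Submodule.zero_mem _) (fun _ _ => Submodule.add_mem _)
    (fun _ hp => Θ.pathElement_mem hp)

/-- Right multiplication by the directed subpath of `Θ` from `i` to `j`, as a map
`A e_i → A e_j`. -/
noncomputable def component (i j : Γ.Edge) : Γ.proj K i →ₗ[Γ.Alg K] Γ.proj K j :=
  LinearMap.codRestrict (Γ.proj K j)
    ((LinearMap.toSpanSingleton (Γ.Alg K) (Γ.Alg K) (Θ.coefficient i j)).comp
      (Γ.proj K i).subtype)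
    (fun x => (Γ.proj K j).smul_mem (x : Γ.Alg K) (Θ.coefficient_mem i j))

/-- The degree-`0` term of the complex of `Θ`: the direct sum of the `A e_i` over the sources. -/
abbrev Term₀ : Type (max u v) := (i : {i : Γ.Edge // Θ.IsSource i}) → Γ.proj K i.1

/-- The degree-`1` term of the complex of `Θ`: the direct sum of the `A e_j` over the sinks. -/
abbrev Term₁ : Type (max u v) := (j : {j : Γ.Edge // Θ.IsSink j}) → Γ.proj K j.1

noncomputable instance : Fintype {i : Γ.Edge // Θ.IsSource i} := Fintype.ofFinite _

/-- The differential of the complex of `Θ`, induced by multiplication by the directed subpaths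
of `Θ` from the sources to the sinks. -/
noncomputable def differential : Θ.Term₀ →ₗ[Γ.Alg K] Θ.Term₁ :=
  LinearMap.pi fun j => ∑ i : {i : Γ.Edge // Θ.IsSource i},
    (Θ.component i.1 j.1).comp (LinearMap.proj i)

end AdmissiblePath

end BrauerTree

set_option linter.unusedSectionVars false

universe w

/-! ### Darts around a vertex -/

namespace BrauerTree

variable {V : Type v} {Γ : BrauerTree V}

theorem src_eq_src_iff {a b : Γ.Arrow} : Γ.src a = Γ.src b ↔ a = b ∨ a = b.symm := by
  rw [← SimpleGraph.dart_edge_eq_iff]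
  exact Subtype.ext_iff

theorem src_symm (a : Γ.Arrow) : Γ.src a.symm = Γ.src a := src_eq_src_iff.2 (Or.inr rfl)

theorem exists_src_eq (i : Γ.Edge) : ∃ a : Γ.Arrow, Γ.src a = i := by
  obtain ⟨i, hi⟩ := i
  induction i with
  | _ x y => exact ⟨⟨(x, y), hi⟩, rfl⟩

theorem eq_of_fst_eq_of_src_eq {a b : Γ.Arrow} (h : a.fst = b.fst) (h' : Γ.src a = Γ.src b) :
    a = b := by
  rcases src_eq_src_iff.1 h' with h' | rfl
  · exact h'
  · exact absurd h b.snd_ne_fst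

theorem mem_src_iff {a : Γ.Arrow} {x : V} : x ∈ (Γ.src a : Sym2 V) ↔ x = a.fst ∨ x = a.snd := by
  change x ∈ s(a.fst, a.snd) ↔ _
  simp

theorem fst_mem_src (a : Γ.Arrow) : a.fst ∈ (Γ.src a : Sym2 V) := mem_src_iff.2 (Or.inl rfl)

theorem snd_mem_src (a : Γ.Arrow) : a.snd ∈ (Γ.src a : Sym2 V) := mem_src_iff.2 (Or.inr rfl)

/-- An edge at a vertex is the edge of a dart starting there. -/
theorem exists_dart_of_mem {i : Γ.Edge} {x : V} (h : x ∈ (i : Sym2 V)) :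
    ∃ a : Γ.Arrow, a.fst = x ∧ Γ.src a = i := by
  obtain ⟨a, rfl⟩ := exists_src_eq i
  rcases mem_src_iff.1 h with rfl | rfl
  · exact ⟨a, rfl, rfl⟩
  · exact ⟨a.symm, rfl, src_symm a⟩

theorem iterate_next_fst (a : Γ.Arrow) (k : ℕ) : (Γ.next^[k] a).fst = a.fst := by
  induction k with
  | zero => rfl
  | succ k ih => rw [Function.iterate_succ_apply', Γ.next_fst, ih]

theorem next_symm_fst (a : Γ.Arrow) : (Γ.next.symm a).fst = a.fst := by
  rw [← Γ.next_fst, Equiv.apply_symm_apply]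

theorem next_symm_apply_eq {a b : Γ.Arrow} : Γ.next.symm b = a ↔ Γ.next a = b := by
  rw [Equiv.symm_apply_eq, eq_comm]

/-- The number of edges at the starting point of a dart. -/
noncomputable def per (a : Γ.Arrow) : ℕ := Function.minimalPeriod Γ.next a

theorem iterate_per (a : Γ.Arrow) : Γ.next^[per a] a = a := Function.iterate_minimalPeriod

variable [Finite V]

instance : Finite Γ.Arrow := Finite.of_injective _ SimpleGraph.Dart.toProd_injective

theorem mem_periodicPts (a : Γ.Arrow) : a ∈ Function.periodicPts Γ.next :=
  Γ.next.injective.mem_periodicPts a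

theorem per_pos (a : Γ.Arrow) : 0 < per a :=
  Function.minimalPeriod_pos_of_mem_periodicPts (mem_periodicPts a)

theorem per_iterate (a : Γ.Arrow) (k : ℕ) : per (Γ.next^[k] a) = per a :=
  Function.minimalPeriod_apply_iterate (mem_periodicPts a) k

theorem per_next (a : Γ.Arrow) : per (Γ.next a) = per a := per_iterate a 1

theorem iterate_eq_self_iff {a : Γ.Arrow} {k : ℕ} : Γ.next^[k] a = a ↔ per a ∣ k :=
  Function.isPeriodicPt_iff_minimalPeriod_dvd

theorem iterate_ne_self {a : Γ.Arrow} {k : ℕ} (h : 0 < k) (h' : k < per a) :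
    Γ.next^[k] a ≠ a :=
  fun h0 => absurd (Nat.le_of_dvd h (iterate_eq_self_iff.1 h0)) (by omega)

theorem eq_per_of_iterate_eq_self {a : Γ.Arrow} {k : ℕ} (h : 0 < k) (h' : k ≤ per a)
    (h0 : Γ.next^[k] a = a) : k = per a := by
  by_contra hne
  exact iterate_ne_self h (by omega) h0

theorem iterate_injOn {a : Γ.Arrow} {k l : ℕ} (hk : 0 < k) (hk' : k ≤ per a) (hl : 0 < l)
    (hl' : l ≤ per a) (h : Γ.next^[k] a = Γ.next^[l] a) : k = l := by
  obtain ⟨k, rfl⟩ := Nat.exists_eq_succ_of_ne_zero hk.ne'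
  obtain ⟨l, rfl⟩ := Nat.exists_eq_succ_of_ne_zero hl.ne'
  rw [Function.iterate_succ_apply', Function.iterate_succ_apply'] at h
  have := (Function.iterate_eq_iterate_iff_of_lt_minimalPeriod hk' hl').1 (Γ.next.injective h)
  omega

theorem per_eq_of_fst_eq {a b : Γ.Arrow} (h : a.fst = b.fst) : per a = per b := by
  obtain ⟨k, hk⟩ := (Γ.sameCycle a b h).exists_nat_pow_eq
  rw [← Equiv.Perm.iterate_eq_pow] at hk
  rw [← hk, per_iterate]

theorem exists_iterate_eq {a b : Γ.Arrow} (h : a.fst = b.fst) :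
    ∃ k, 0 < k ∧ k ≤ per a ∧ Γ.next^[k] a = b := by
  obtain ⟨k, hk⟩ := (Γ.sameCycle a b h).exists_nat_pow_eq
  rw [← Equiv.Perm.iterate_eq_pow] at hk
  have hp := per_pos a
  rw [← Function.iterate_mod_minimalPeriod_eq] at hk
  change Γ.next^[k % per a] a = b at hk
  by_cases h0 : k % per a = 0
  · refine ⟨per a, hp, le_rfl, ?_⟩
    rw [h0] at hk
    rw [iterate_per]
    exact hk
  · exact ⟨k % per a, Nat.pos_of_ne_zero h0, (Nat.mod_lt _ hp).le, hk⟩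

open Classical in
/-- The number of steps, at least one, from a dart to another one around the same vertex. -/
noncomputable def steps (a b : Γ.Arrow) : ℕ :=
  if h : a.fst = b.fst then (exists_iterate_eq h).choose else 0

section
variable {a b : Γ.Arrow}

theorem steps_pos (h : a.fst = b.fst) : 0 < steps a b := by
  rw [steps, dif_pos h]
  exact (exists_iterate_eq h).choose_spec.1

theorem steps_le (h : a.fst = b.fst) : steps a b ≤ per a := by
  rw [steps, dif_pos h]
  exact (exists_iterate_eq h).choose_spec.2.1

theorem iterate_steps (h : a.fst = b.fst) : Γ.next^[steps a b] a = b := by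
  rw [steps, dif_pos h]
  exact (exists_iterate_eq h).choose_spec.2.2

theorem steps_eq {k : ℕ} (hk : 0 < k) (hk' : k ≤ per a) (h : Γ.next^[k] a = b) :
    steps a b = k := by
  have hab : a.fst = b.fst := by rw [← h, iterate_next_fst]
  exact iterate_injOn (steps_pos hab) (steps_le hab) hk hk' ((iterate_steps hab).trans h.symm)

theorem steps_lt (h : a.fst = b.fst) (hne : a ≠ b) : steps a b < per a := by
  refine lt_of_le_of_ne (steps_le h) fun h' => hne ?_
  rw [← iterate_steps h, h', iterate_per]

theorem steps_next (a : Γ.Arrow) : steps a (Γ.next a) = 1 :=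
  steps_eq one_pos (per_pos a) rfl

/-- The first step can be split off. -/
theorem steps_eq_succ (h : a.fst = b.fst) (hne : Γ.next a ≠ b) :
    steps a b = steps (Γ.next a) b + 1 := by
  have hnext : (Γ.next a).fst = b.fst := by rw [Γ.next_fst, h]
  refine steps_eq (Nat.succ_pos _) ?_ ?_
  · have := steps_lt hnext hne
    rw [per_next] at this
    exact this
  · rw [Function.iterate_succ_apply, iterate_steps hnext]

/-- Darts strictly after the first one, up to the last one, differ from the first one. -/
theorem iterate_ne_of_le_steps {t : ℕ} (h : a.fst = b.fst) (hne : a ≠ b) (ht : 0 < t)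
    (ht' : t ≤ steps a b) : Γ.next^[t] a ≠ a :=
  iterate_ne_self ht (lt_of_le_of_lt ht' (steps_lt h hne))

theorem iterate_ne_of_lt_steps {t : ℕ} (h : a.fst = b.fst) (hne : a ≠ b)
    (ht' : t < steps a b) : Γ.next^[t] a ≠ b := by
  intro h0
  rcases Nat.eq_zero_or_pos t with rfl | ht
  · exact hne h0
  · have := steps_eq ht (ht'.le.trans (steps_le h)) h0
    omega

end

end BrauerTree

/-! ### Multiplication in the Brauer tree algebra -/

namespace BrauerTree

variable {V : Type v} [Finite V] {Γ : BrauerTree V} {K : Type u} [Field K]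

theorem e_mul_self (i : Γ.Edge) : Γ.e K i * Γ.e K i = Γ.e K i := by
  unfold e PathAlgebra.vertex
  rw [← map_mul, ← map_mul]
  exact congrArg _ (RingQuot.mkAlgHom_rel K (PathAlgebra.Rel.idem i))

theorem e_mul_e_of_ne {i j : Γ.Edge} (h : i ≠ j) : Γ.e K i * Γ.e K j = 0 := by
  unfold e PathAlgebra.vertex
  rw [← map_mul, ← map_mul, ← map_zero (Γ.quot K), ← map_zero (PathAlgebra.mk K Γ.src Γ.tgt)]
  exact congrArg _ (RingQuot.mkAlgHom_rel K (PathAlgebra.Rel.orth i j h))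

theorem sum_e : ∑ i : Γ.Edge, Γ.e K i = 1 := by
  unfold e PathAlgebra.vertex
  rw [← map_sum, ← map_sum, ← map_one (Γ.quot K), ← map_one (PathAlgebra.mk K Γ.src Γ.tgt)]
  exact congrArg _ (RingQuot.mkAlgHom_rel K PathAlgebra.Rel.one)

theorem e_mul_arr_of_ne {a : Γ.Arrow} {i : Γ.Edge} (h : i ≠ Γ.src a) :
    Γ.e K i * Γ.arr K a = 0 := by
  rw [← e_mul_arr, ← mul_assoc, e_mul_e_of_ne h, zero_mul]

theorem arr_mul_e_of_ne {a : Γ.Arrow} {i : Γ.Edge} (h : Γ.tgt a ≠ i) :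
    Γ.arr K a * Γ.e K i = 0 := by
  rw [← arr_mul_e, mul_assoc, e_mul_e_of_ne h, mul_zero]

theorem arr_mul_arr_of_ne {a b : Γ.Arrow} (h : b ≠ Γ.next a) : Γ.arr K a * Γ.arr K b = 0 := by
  by_cases h' : Γ.tgt a = Γ.src b
  · unfold arr
    rw [← map_mul, ← map_zero (Γ.quot K)]
    exact RingQuot.mkAlgHom_rel K (Rel.mixed a b h' h)
  · rw [← e_mul_arr b, ← mul_assoc, arr_mul_e_of_ne h', zero_mul]

/-- The algebra is generated by the idempotents and the arrows. -/
theorem alg_induction {C : Γ.Alg K → Prop} (scalar : ∀ r : K, C (algebraMap K _ r))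
    (idem : ∀ i, C (Γ.e K i)) (arrow : ∀ a, C (Γ.arr K a))
    (add : ∀ x y, C x → C y → C (x + y)) (mul : ∀ x y, C x → C y → C (x * y)) (x : Γ.Alg K) :
    C x := by
  have hsurj : Function.Surjective ((Γ.quot K).comp (PathAlgebra.mk K Γ.src Γ.tgt)) := by
    intro x
    obtain ⟨y, hy⟩ := RingQuot.mkAlgHom_surjective K (Γ.Rel K) x
    obtain ⟨z, hz⟩ := RingQuot.mkAlgHom_surjective K (PathAlgebra.Rel K Γ.src Γ.tgt) y
    exact ⟨z, (congrArg (Γ.quot K) hz).trans hy⟩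
  obtain ⟨z, rfl⟩ := hsurj x
  induction z using FreeAlgebra.induction with
  | grade0 r => rw [AlgHom.commutes]; exact scalar r
  | grade1 x =>
    rcases x with i | a
    · exact idem i
    · exact arrow a
  | mul x y hx hy => rw [map_mul]; exact mul _ _ hx hy
  | add x y hx hy => rw [map_add]; exact add _ _ hx hy

variable (K) in
/-- The path of `l` successive arrows around `a.fst` that starts with `a`. -/
noncomputable def arc (a : Γ.Arrow) (l : ℕ) : Γ.Alg K :=
  Γ.e K (Γ.src a) * ((List.range l).map fun m => Γ.arr K (Γ.next^[m] a)).prod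

theorem arc_zero (a : Γ.Arrow) : arc K a 0 = Γ.e K (Γ.src a) := by simp [arc]

theorem e_mul_arc (a : Γ.Arrow) (l : ℕ) : Γ.e K (Γ.src a) * arc K a l = arc K a l := by
  rw [arc, ← mul_assoc, e_mul_self]

theorem e_mul_arc_of_ne {a : Γ.Arrow} {i : Γ.Edge} (h : i ≠ Γ.src a) (l : ℕ) :
    Γ.e K i * arc K a l = 0 := by
  rw [arc, ← mul_assoc, e_mul_e_of_ne h, zero_mul]

theorem arr_mul_arc_next (a : Γ.Arrow) (l : ℕ) :
    Γ.arr K a * arc K (Γ.next a) l = arc K a (l + 1) := by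
  rw [arc, arc, List.range_succ_eq_map, List.map_cons, List.prod_cons, List.map_map,
    ← mul_assoc, ← mul_assoc]
  simp only [Function.iterate_zero, id]
  rw [e_mul_arr]
  exact congrArg (· * _) (arr_mul_e a)

theorem arc_one (a : Γ.Arrow) : arc K a 1 = Γ.arr K a := by
  rw [← arr_mul_arc_next, arc_zero]
  exact arr_mul_e a

theorem arr_mul_arc_of_ne {a b : Γ.Arrow} (h : b ≠ Γ.next a) {l : ℕ} (hl : 0 < l) :
    Γ.arr K a * arc K b l = 0 := by
  obtain ⟨l, rfl⟩ := Nat.exists_eq_succ_of_ne_zero hl.ne'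
  rw [← arr_mul_arc_next, ← mul_assoc, arr_mul_arr_of_ne h, zero_mul]

theorem arc_add (a : Γ.Arrow) (k l : ℕ) :
    arc K a (k + l) = arc K a k * arc K (Γ.next^[k] a) l := by
  induction k generalizing a with
  | zero => rw [zero_add, arc_zero, Function.iterate_zero, id, e_mul_arc]
  | succ k ih =>
    rw [add_right_comm, ← arr_mul_arc_next, ih, ← arr_mul_arc_next, mul_assoc,
      Function.iterate_succ_apply]

theorem arc_mul_arc {a b : Γ.Arrow} {k : ℕ} (l : ℕ) (h : Γ.next^[k] a = b) :
    arc K a k * arc K b l = arc K a (k + l) := by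
  rw [arc_add, h]

theorem arc_succ (a : Γ.Arrow) (k : ℕ) :
    arc K a (k + 1) = arc K a k * Γ.arr K (Γ.next^[k] a) := by
  rw [arc_add, arc_one]

theorem arc_mul_e (a : Γ.Arrow) (l : ℕ) :
    arc K a l * Γ.e K (Γ.src (Γ.next^[l] a)) = arc K a l := by
  rw [← arc_zero, ← arc_add, add_zero]

theorem arc_mul_e_of_ne {a : Γ.Arrow} {l : ℕ} {i : Γ.Edge} (h : Γ.src (Γ.next^[l] a) ≠ i) :
    arc K a l * Γ.e K i = 0 := by
  rw [← arc_mul_e, mul_assoc, e_mul_e_of_ne h, mul_zero]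

theorem arc_mul_arc_of_ne {a b : Γ.Arrow} {k l : ℕ} (hk : 0 < k) (hl : 0 < l)
    (h : Γ.next^[k] a ≠ b) : arc K a k * arc K b l = 0 := by
  obtain ⟨k, rfl⟩ := Nat.exists_eq_succ_of_ne_zero hk.ne'
  rw [Nat.succ_eq_add_one, arc_succ, mul_assoc, arr_mul_arc_of_ne _ hl, mul_zero]
  rw [← Function.iterate_succ_apply' (f := Γ.next)]
  exact h.symm

theorem arc_eq_quot_run (a : Γ.Arrow) {l : ℕ} (hl : 0 < l) :
    arc K a l = Γ.quot K (Γ.run K a l) := by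
  obtain ⟨l, rfl⟩ := Nat.exists_eq_succ_of_ne_zero hl.ne'
  rw [arc, run, map_list_prod, List.map_map, List.range_succ_eq_map, List.map_cons,
    List.prod_cons, ← mul_assoc, List.map_cons, List.prod_cons]
  exact congrArg (· * _) (e_mul_arr a)

/-- The two full cycles at a vertex of the quiver agree. -/
theorem arc_per_symm (a : Γ.Arrow) : arc K a.symm (per a.symm) = arc K a (per a) := by
  rw [arc_eq_quot_run _ (per_pos _), arc_eq_quot_run _ (per_pos _)]
  exact (RingQuot.mkAlgHom_rel K (Rel.cycles a)).symm

theorem arc_per_mul_arr (a b : Γ.Arrow) : arc K a (per a) * Γ.arr K b = 0 := by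
  by_cases h : a = b
  · subst h
    rw [← arc_per_symm, ← arc_one]
    exact arc_mul_arc_of_ne (per_pos _) one_pos (by rw [iterate_per]; exact a.symm_ne)
  · rw [← arc_one]
    exact arc_mul_arc_of_ne (per_pos _) one_pos (by rwa [iterate_per])

theorem arr_mul_arc_per (a b : Γ.Arrow) : Γ.arr K b * arc K a (per a) = 0 := by
  by_cases h : a = Γ.next b
  · rw [← arc_per_symm]
    refine arr_mul_arc_of_ne (fun h' => a.symm_ne (h'.trans h.symm)) (per_pos _)
  · exact arr_mul_arc_of_ne h (per_pos _)

theorem arc_eq_zero {a : Γ.Arrow} {l : ℕ} (h : per a < l) : arc K a l = 0 := by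
  obtain ⟨m, rfl⟩ := Nat.exists_eq_add_of_lt h
  rw [add_assoc, add_comm m 1, ← add_assoc, arc_add, arc_add, arc_one, arc_per_mul_arr, zero_mul]

theorem arc_per_of_src_eq {a b : Γ.Arrow} (h : Γ.src a = Γ.src b) :
    arc K a (per a) = arc K b (per b) := by
  rcases src_eq_src_iff.1 h with rfl | rfl
  · rfl
  · exact arc_per_symm b

theorem arc_per_mul_e (a : Γ.Arrow) :
    arc K a (per a) * Γ.e K (Γ.src a) = arc K a (per a) := by
  conv_rhs => rw [← arc_mul_e, iterate_per]

/-- The arcs span the algebra. -/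
theorem span_arc_eq_top :
    Submodule.span K {x : Γ.Alg K | ∃ a l, x = arc K a l} = ⊤ := by
  set S := Submodule.span K {x : Γ.Alg K | ∃ a l, x = arc K a l} with hS
  have he : ∀ i, Γ.e K i ∈ S := by
    intro i
    obtain ⟨a, rfl⟩ := exists_src_eq i
    exact Submodule.subset_span ⟨a, 0, (arc_zero a).symm⟩
  have key : ∀ x : Γ.Alg K, ∀ s ∈ S, x * s ∈ S := by
    intro x
    induction x using alg_induction with
    | scalar r =>
      intro s hs
      rw [← Algebra.smul_def]
      exact S.smul_mem r hs
    | idem i =>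
      intro s hs
      induction hs using Submodule.span_induction with
      | mem x hx =>
        obtain ⟨a, l, rfl⟩ := hx
        by_cases h : i = Γ.src a
        · subst h
          rw [e_mul_arc]
          exact Submodule.subset_span ⟨a, l, rfl⟩
        · rw [e_mul_arc_of_ne h]
          exact S.zero_mem
      | zero => rw [mul_zero]; exact S.zero_mem
      | add x y _ _ hx hy => rw [mul_add]; exact S.add_mem hx hy
      | smul r x _ hx => rw [mul_smul_comm]; exact S.smul_mem r hx
    | arrow b =>
      intro s hs
      induction hs using Submodule.span_induction with
      | mem x hx =>
        obtain ⟨a, l, rfl⟩ := hx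
        by_cases h : a = Γ.next b
        · subst h
          rw [arr_mul_arc_next]
          exact Submodule.subset_span ⟨b, l + 1, rfl⟩
        · rcases Nat.eq_zero_or_pos l with rfl | hl
          · rw [arc_zero]
            by_cases h' : Γ.tgt b = Γ.src a
            · rw [← h', arr_mul_e, ← arc_one]
              exact Submodule.subset_span ⟨b, 1, rfl⟩
            · rw [arr_mul_e_of_ne h']
              exact S.zero_mem
          · rw [arr_mul_arc_of_ne h hl]
            exact S.zero_mem
      | zero => rw [mul_zero]; exact S.zero_mem
      | add x y _ _ hx hy => rw [mul_add]; exact S.add_mem hx hy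
      | smul r x _ hx => rw [mul_smul_comm]; exact S.smul_mem r hx
    | add x y hx hy => intro s hs; rw [add_mul]; exact S.add_mem (hx s hs) (hy s hs)
    | mul x y hx hy => intro s hs; rw [mul_assoc]; exact hx _ (hy s hs)
  rw [eq_top_iff]
  intro x _
  rw [← mul_one x, ← sum_e]
  exact key x _ (S.sum_mem fun i _ => he i)

/-- Linear induction over the arcs. -/
theorem arc_induction {C : Γ.Alg K → Prop} (arcs : ∀ a l, C (arc K a l)) (zero : C 0)
    (add : ∀ x y, C x → C y → C (x + y)) (smul : ∀ (r : K) x, C x → C (r • x))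
    (x : Γ.Alg K) : C x := by
  have hx : x ∈ Submodule.span K {x : Γ.Alg K | ∃ a l, x = arc K a l} := by
    rw [span_arc_eq_top]; trivial
  induction hx using Submodule.span_induction with
  | mem x hx => obtain ⟨a, l, rfl⟩ := hx; exact arcs a l
  | zero => exact zero
  | add x y _ _ hx hy => exact add _ _ hx hy
  | smul r x _ hx => exact smul _ _ hx

theorem e_mul_mul_e_eq_zero {i j : Γ.Edge} (h : ∀ x : V, x ∈ (i : Sym2 V) → x ∉ (j : Sym2 V))
    (y : Γ.Alg K) : Γ.e K i * y * Γ.e K j = 0 := by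
  induction y using arc_induction with
  | arcs a l =>
    by_cases hi : i = Γ.src a
    · rw [mul_assoc, arc_mul_e_of_ne, mul_zero]
      rintro rfl
      refine h a.fst ?_ ?_
      · rw [hi]; exact fst_mem_src a
      · rw [← iterate_next_fst a l]; exact fst_mem_src _
    · rw [e_mul_arc_of_ne hi, zero_mul]
  | zero => simp
  | add x y hx hy => rw [mul_add, add_mul, hx, hy, add_zero]
  | smul r x hx => rw [mul_smul_comm, smul_mul_assoc, hx, smul_zero]

theorem exists_e_mul_mul_e_self (a : Γ.Arrow) (y : Γ.Alg K) :
    ∃ r s : K, Γ.e K (Γ.src a) * y * Γ.e K (Γ.src a)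
      = r • Γ.e K (Γ.src a) + s • arc K a (per a) := by
  induction y using arc_induction with
  | arcs b l =>
    by_cases hi : Γ.src a = Γ.src b
    · by_cases hl : per b < l
      · exact ⟨0, 0, by rw [arc_eq_zero hl]; simp⟩
      rcases Nat.eq_zero_or_pos l with rfl | hl0
      · exact ⟨1, 0, by rw [arc_zero, ← hi, e_mul_self, e_mul_self]; simp⟩
      by_cases hb : Γ.src (Γ.next^[l] b) = Γ.src a
      · have h1 : Γ.next^[l] b = b :=
          eq_of_fst_eq_of_src_eq (iterate_next_fst b l) (hb.trans hi)
        have h2 := eq_per_of_iterate_eq_self hl0 (by omega) h1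
        refine ⟨0, 1, ?_⟩
        rw [hi, e_mul_arc, h2, arc_per_mul_e, arc_per_of_src_eq hi]
        simp
      · exact ⟨0, 0, by rw [mul_assoc, arc_mul_e_of_ne hb]; simp⟩
    · exact ⟨0, 0, by rw [e_mul_arc_of_ne hi]; simp⟩
  | zero => exact ⟨0, 0, by simp⟩
  | add x y hx hy =>
    obtain ⟨r, s, h⟩ := hx
    obtain ⟨r', s', h'⟩ := hy
    exact ⟨r + r', s + s', by rw [mul_add, add_mul, h, h']; module⟩
  | smul c x hx =>
    obtain ⟨r, s, h⟩ := hx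
    exact ⟨c * r, c * s, by rw [mul_smul_comm, smul_mul_assoc, h]; module⟩

theorem exists_e_mul_mul_e {a b : Γ.Arrow} (h : a.fst = b.fst) (hne : a ≠ b) (y : Γ.Alg K) :
    ∃ r : K, Γ.e K (Γ.src a) * y * Γ.e K (Γ.src b) = r • arc K a (steps a b) := by
  have hsrc : Γ.src a ≠ Γ.src b := fun h' => hne (eq_of_fst_eq_of_src_eq h h')
  induction y using arc_induction with
  | arcs c l =>
    by_cases hi : Γ.src a = Γ.src c
    · by_cases hl : per c < l
      · exact ⟨0, by rw [arc_eq_zero hl]; simp⟩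
      rcases Nat.eq_zero_or_pos l with rfl | hl0
      · exact ⟨0, by rw [arc_zero, ← hi, e_mul_self, e_mul_e_of_ne hsrc]; simp⟩
      by_cases hb : Γ.src (Γ.next^[l] c) = Γ.src b
      · rcases src_eq_src_iff.1 hi with rfl | rfl
        · have h1 := eq_of_fst_eq_of_src_eq ((iterate_next_fst a l).trans h) hb
          have h2 := steps_eq hl0 (by omega) h1
          refine ⟨1, ?_⟩
          rw [e_mul_arc, ← hb, arc_mul_e, h2, one_smul]
        · exfalso
          rcases src_eq_src_iff.1 hb with h1 | h1
          · have h2 : c.fst = b.fst := by rw [← h1, iterate_next_fst]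
            have h3 : c.snd = b.fst := h
            exact c.fst_ne_snd (h2.trans h3.symm)
          · have h2 : c.fst = b.snd := by
              rw [← iterate_next_fst c l, h1]; rfl
            have h3 : c.snd = b.fst := h
            apply hne
            apply SimpleGraph.Dart.ext
            exact Prod.ext h3 h2
      · exact ⟨0, by rw [mul_assoc, arc_mul_e_of_ne hb]; simp⟩
    · exact ⟨0, by rw [e_mul_arc_of_ne hi]; simp⟩
  | zero => exact ⟨0, by simp⟩
  | add x y hx hy =>
    obtain ⟨r, h⟩ := hx
    obtain ⟨r', h'⟩ := hy
    exact ⟨r + r', by rw [mul_add, add_mul, h, h']; module⟩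
  | smul c x hx =>
    obtain ⟨r, h⟩ := hx
    exact ⟨c * r, by rw [mul_smul_comm, smul_mul_assoc, h]; module⟩

theorem exists_arc_per_mul (a : Γ.Arrow) (y : Γ.Alg K) :
    ∃ r : K, arc K a (per a) * y = r • arc K a (per a) := by
  induction y using arc_induction with
  | arcs b l =>
    rcases Nat.eq_zero_or_pos l with rfl | hl0
    · by_cases h : Γ.src a = Γ.src b
      · exact ⟨1, by rw [arc_zero, ← h, arc_per_mul_e, one_smul]⟩
      · exact ⟨0, by rw [arc_zero, arc_mul_e_of_ne (by rwa [iterate_per]), zero_smul]⟩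
    · obtain ⟨l, rfl⟩ := Nat.exists_eq_succ_of_ne_zero hl0.ne'
      exact ⟨0, by rw [← arr_mul_arc_next, ← mul_assoc, arc_per_mul_arr, zero_mul, zero_smul]⟩
  | zero => exact ⟨0, by simp⟩
  | add x y hx hy =>
    obtain ⟨r, h⟩ := hx
    obtain ⟨r', h'⟩ := hy
    exact ⟨r + r', by rw [mul_add, h, h', add_smul]⟩
  | smul c x hx =>
    obtain ⟨r, h⟩ := hx
    exact ⟨c * r, by rw [mul_smul_comm, h, mul_smul]⟩

end BrauerTree

/-! ### A representation on which a full cycle acts nontrivially -/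

namespace BrauerTree

variable {V : Type v} [Finite V] {Γ : BrauerTree V} {K : Type u} [Field K]

namespace Model

open Classical in
/-- The basis vector hit by the arrow `a` in the projective module at the vertex `i`. The basis
consists of `inl true` (the top), `inl false` (the socle) and darts. -/
noncomputable def vec (i : Γ.Edge) (a : Γ.Arrow) : Bool ⊕ Γ.Arrow :=
  if Γ.src a = i then .inl false else .inr a

/-- The vertex supporting a basis vector. -/
def supp (i : Γ.Edge) : Bool ⊕ Γ.Arrow → Γ.Edge
  | .inl _ => i
  | .inr z => Γ.src z

/-- The arrow `a` does not kill the basis vector `z`. -/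
def Live (i : Γ.Edge) : Bool ⊕ Γ.Arrow → Γ.Arrow → Prop
  | .inl true, a => Γ.tgt a = i
  | .inl false, _ => False
  | .inr z, a => Γ.next a = z ∧ Γ.src z ≠ i ∧ z.fst ∈ (i : Sym2 V)

theorem supp_vec (i : Γ.Edge) (a : Γ.Arrow) : supp i (vec i a) = Γ.src a := by
  unfold vec
  split_ifs with h
  · exact h.symm
  · rfl

theorem Live.supp_eq {i : Γ.Edge} {z : Bool ⊕ Γ.Arrow} {a : Γ.Arrow} (h : Live i z a) :
    supp i z = Γ.tgt a := by
  rcases z with (_ | _) | z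
  · exact h.elim
  · exact h.symm
  · exact congrArg Γ.src h.1.symm

theorem Live.fst_mem {i : Γ.Edge} {z : Bool ⊕ Γ.Arrow} {a : Γ.Arrow} (h : Live i z a) :
    a.fst ∈ (i : Sym2 V) := by
  rcases z with (_ | _) | z
  · exact h.elim
  · have h : Γ.tgt a = i := h
    rw [← h, ← Γ.next_fst]
    exact fst_mem_src _
  · rw [← Γ.next_fst, h.1]
    exact h.2.2

variable (K)

open Classical in
/-- The action of an idempotent. -/
noncomputable def idem (i k : Γ.Edge) : Module.End K ((Bool ⊕ Γ.Arrow) →₀ K) :=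
  Finsupp.linearCombination K fun z => if supp i z = k then Finsupp.single z 1 else 0

open Classical in
/-- The action of an arrow. -/
noncomputable def arrow (i : Γ.Edge) (a : Γ.Arrow) : Module.End K ((Bool ⊕ Γ.Arrow) →₀ K) :=
  Finsupp.linearCombination K fun z => if Live i z a then Finsupp.single (vec i a) 1 else 0

variable {K}

open Classical in
theorem idem_single (i k : Γ.Edge) (z : Bool ⊕ Γ.Arrow) :
    idem K i k (Finsupp.single z 1) = if supp i z = k then Finsupp.single z 1 else 0 := by
  rw [idem, Finsupp.linearCombination_single, one_smul]

open Classical in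
theorem arrow_single (i : Γ.Edge) (a : Γ.Arrow) (z : Bool ⊕ Γ.Arrow) :
    arrow K i a (Finsupp.single z 1) = if Live i z a then Finsupp.single (vec i a) 1 else 0 := by
  rw [arrow, Finsupp.linearCombination_single, one_smul]

theorem ext_single {f g : Module.End K ((Bool ⊕ Γ.Arrow) →₀ K)}
    (h : ∀ z, f (Finsupp.single z 1) = g (Finsupp.single z 1)) : f = g :=
  Finsupp.lhom_ext' fun z => LinearMap.ext_ring (h z)

theorem arrow_single_vec (i : Γ.Edge) (a b : Γ.Arrow)
    (h : ¬(b = Γ.next a ∧ Γ.src b ≠ i ∧ b.fst ∈ (i : Sym2 V))) :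
    arrow K i a (Finsupp.single (vec i b) 1) = 0 := by
  rw [arrow_single, if_neg]
  intro h'
  unfold vec at h'
  split_ifs at h' with h1
  · exact h'
  · exact h ⟨h'.1.symm, h'.2⟩

variable (K) in
/-- The action of the path algebra. -/
noncomputable def pathAction (i : Γ.Edge) :
    PathAlgebra K Γ.src Γ.tgt →ₐ[K] Module.End K ((Bool ⊕ Γ.Arrow) →₀ K) :=
  RingQuot.liftAlgHom K ⟨FreeAlgebra.lift K (Sum.elim (idem K i) (arrow K i)), by
    intro x y h
    induction h with
    | idem k =>
      simp only [map_mul, FreeAlgebra.lift_ι_apply, Sum.elim_inl]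
      refine ext_single fun z => ?_
      rw [Module.End.mul_apply, idem_single]
      split_ifs with h
      · rw [idem_single, if_pos h]
      · rw [map_zero]
    | orth k l hkl =>
      simp only [map_mul, FreeAlgebra.lift_ι_apply, Sum.elim_inl, map_zero]
      refine ext_single fun z => ?_
      rw [Module.End.mul_apply, idem_single]
      split_ifs with h
      · rw [idem_single, if_neg (fun h' => hkl (h'.symm.trans h)), LinearMap.zero_apply]
      · rw [map_zero, LinearMap.zero_apply]
    | one =>
      simp only [map_sum, FreeAlgebra.lift_ι_apply, Sum.elim_inl, map_one]
      refine ext_single fun z => ?_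
      rw [LinearMap.sum_apply, Finset.sum_eq_single (supp i z)]
      · rw [idem_single, if_pos rfl, Module.End.one_apply]
      · intro k _ hk
        rw [idem_single, if_neg hk.symm]
      · intro h
        exact absurd (Finset.mem_univ _) h
    | source a =>
      simp only [map_mul, FreeAlgebra.lift_ι_apply, Sum.elim_inl, Sum.elim_inr]
      refine ext_single fun z => ?_
      rw [Module.End.mul_apply, arrow_single]
      split_ifs with h
      · rw [idem_single, if_pos (supp_vec i a)]
      · rw [map_zero]
    | target a =>
      simp only [map_mul, FreeAlgebra.lift_ι_apply, Sum.elim_inl, Sum.elim_inr]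
      refine ext_single fun z => ?_
      rw [Module.End.mul_apply, idem_single]
      split_ifs with h
      · rfl
      · rw [map_zero, arrow_single, if_neg (fun h' => h h'.supp_eq)]⟩

theorem pathAction_arrow (i : Γ.Edge) (a : Γ.Arrow) :
    pathAction K i (PathAlgebra.arrow K Γ.src Γ.tgt a) = arrow K i a := by
  unfold pathAction PathAlgebra.arrow PathAlgebra.mk
  erw [RingQuot.liftAlgHom_mkAlgHom_apply]
  simp

theorem pathAction_run_succ (i : Γ.Edge) (a : Γ.Arrow) (k : ℕ) :
    pathAction K i (Γ.run K a (k + 1))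
      = arrow K i a * pathAction K i (Γ.run K (Γ.next a) k) := by
  rw [run, List.range_succ_eq_map, List.map_cons, List.prod_cons, map_mul, List.map_map]
  exact congrArg (· * _) (pathAction_arrow i a)

open Classical in
theorem pathAction_run_single (i : Γ.Edge) (a : Γ.Arrow) (k : ℕ) (z : Bool ⊕ Γ.Arrow) :
    pathAction K i (Γ.run K a (k + 1)) (Finsupp.single z 1)
      = if Live i z (Γ.next^[k] a) ∧ ∀ t, 0 < t → t ≤ k → Γ.src (Γ.next^[t] a) ≠ i
        then Finsupp.single (vec i a) 1 else 0 := by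
  induction k generalizing a with
  | zero =>
    rw [pathAction_run_succ, Module.End.mul_apply]
    simp only [run, List.range_zero, List.map_nil, List.prod_nil, map_one, Module.End.one_apply]
    rw [arrow_single, Function.iterate_zero, id]
    refine if_congr ⟨fun h => ⟨h, fun t h1 h2 => by omega⟩, fun h => h.1⟩ rfl rfl
  | succ k ih =>
    rw [pathAction_run_succ, Module.End.mul_apply, ih, ← Function.iterate_succ_apply]
    split_ifs with h1 h2 h2
    · rw [arrow_single, if_pos]
      have h3 : Γ.src (Γ.next a) ≠ i := h2.2 1 one_pos (by omega)
      rw [vec, if_neg h3]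
      refine ⟨rfl, h3, ?_⟩
      rw [Γ.next_fst, ← iterate_next_fst a (k + 1)]
      exact h1.1.fst_mem
    · apply arrow_single_vec
      rintro ⟨-, h3, -⟩
      refine h2 ⟨h1.1, fun t ht ht' => ?_⟩
      obtain ⟨t, rfl⟩ := Nat.exists_eq_succ_of_ne_zero ht.ne'
      rw [Nat.succ_eq_add_one, Function.iterate_succ_apply]
      rcases Nat.eq_zero_or_pos t with rfl | h0
      · exact h3
      · exact h1.2 t h0 (by omega)
    · exfalso
      refine h1 ⟨h2.1, fun t ht ht' => ?_⟩
      rw [← Function.iterate_succ_apply]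
      exact h2.2 (t + 1) (by omega) (by omega)
    · rw [map_zero]

open Classical in
theorem pathAction_run_per (i : Γ.Edge) (a : Γ.Arrow) (z : Bool ⊕ Γ.Arrow) :
    pathAction K i (Γ.run K a (per a)) (Finsupp.single z 1)
      = if z = .inl true ∧ Γ.src a = i then Finsupp.single (.inl false) 1 else 0 := by
  obtain ⟨k, hk⟩ := Nat.exists_eq_succ_of_ne_zero (per_pos a).ne'
  have hlast : Γ.next (Γ.next^[k] a) = a := by
    rw [← Function.iterate_succ_apply' (f := Γ.next), ← hk, iterate_per]
  have htgt : Γ.tgt (Γ.next^[k] a) = Γ.src a := congrArg Γ.src hlast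
  rw [hk, pathAction_run_single]
  split_ifs with h1 h2 h2
  · rw [vec, if_pos h2.2]
  · exfalso
    rcases z with (_ | _) | z
    · exact h1.1
    · exact h2 ⟨rfl, htgt.symm.trans h1.1⟩
    · obtain ⟨⟨h3, h4, h5⟩, h6⟩ := h1
      rw [hlast] at h3
      subst h3
      obtain ⟨x, hx, rfl⟩ := exists_dart_of_mem h5
      obtain ⟨t, ht, ht', rfl⟩ := exists_iterate_eq hx.symm
      refine h6 t ht ?_ rfl
      by_contra h7
      obtain rfl : t = per a := by omega
      exact h4 (by rw [iterate_per])
  · exfalso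
    obtain ⟨rfl, rfl⟩ := h2
    refine h1 ⟨htgt, fun t ht ht' h3 => ?_⟩
    exact iterate_ne_self ht (by omega) (eq_of_fst_eq_of_src_eq (iterate_next_fst a t) h3)
  · rfl

variable (K) in
/-- The action of the Brauer tree algebra. -/
noncomputable def action (i : Γ.Edge) :
    Γ.Alg K →ₐ[K] Module.End K ((Bool ⊕ Γ.Arrow) →₀ K) :=
  RingQuot.liftAlgHom K ⟨pathAction K i, by
    intro x y h
    induction h with
    | mixed a b _ hne =>
      rw [map_mul, pathAction_arrow, pathAction_arrow, map_zero]
      refine ext_single fun z => ?_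
      rw [Module.End.mul_apply, arrow_single, LinearMap.zero_apply]
      split_ifs with h
      · exact arrow_single_vec i a b fun h' => hne h'.1
      · rw [map_zero]
    | cycles a =>
      refine ext_single fun z => ?_
      change pathAction K i (Γ.run K a (per a)) _ = pathAction K i (Γ.run K a.symm (per a.symm)) _
      rw [pathAction_run_per, pathAction_run_per, src_symm]⟩

theorem action_quot (i : Γ.Edge) (x : PathAlgebra K Γ.src Γ.tgt) :
    action K i (Γ.quot K x) = pathAction K i x := by
  unfold action quot
  erw [RingQuot.liftAlgHom_mkAlgHom_apply]

end Model

theorem arc_per_ne_zero (a : Γ.Arrow) : arc K a (per a) ≠ 0 := by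
  intro h
  have h1 := Model.pathAction_run_per (K := K) (Γ.src a) a (.inl true)
  rw [← Model.action_quot, ← arc_eq_quot_run _ (per_pos a), h, map_zero, if_pos ⟨rfl, rfl⟩] at h1
  exact one_ne_zero (α := K) (by simpa using (DFunLike.congr_fun h1 (.inl false)).symm)

theorem arc_ne_zero {a : Γ.Arrow} {l : ℕ} (h : l ≤ per a) : arc K a l ≠ 0 := by
  intro h0
  apply arc_per_ne_zero (K := K) a
  obtain ⟨m, hm⟩ := Nat.exists_eq_add_of_le h
  rw [hm, arc_add, h0, zero_mul]

/-! ### A-cycles -/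

theorem arr_mul_arr_ne_zero_iff {a b : Γ.Arrow} :
    Γ.arr K a * Γ.arr K b ≠ 0 ↔ b = Γ.next a ∧ Γ.next a ≠ a := by
  constructor
  · intro h
    have hb : b = Γ.next a := by
      by_contra hb
      exact h (arr_mul_arr_of_ne hb)
    refine ⟨hb, fun h' => h ?_⟩
    rw [hb, ← arc_one (Γ.next a), arr_mul_arc_next]
    apply arc_eq_zero
    have := Nat.le_of_dvd one_pos (iterate_eq_self_iff.1 (show Γ.next^[1] a = a from h'))
    omega
  · rintro ⟨rfl, h⟩
    rw [← arc_one (Γ.next a), arr_mul_arc_next]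
    apply arc_ne_zero
    by_contra h'
    have h1 : per a = 1 := by have := per_pos a; omega
    exact h (by have := iterate_per a; rwa [h1] at this)

theorem IsNonzeroChain.fst_eq {l : List Γ.Arrow} (h : Γ.IsNonzeroChain K l) {a b : Γ.Arrow}
    (ha : a ∈ l) (hb : b ∈ l) : a.fst = b.fst := by
  have h1 : l.IsChain fun a b : Γ.Arrow => a.fst = b.fst := by
    refine h.2.imp fun a b hab => ?_
    rw [(arr_mul_arr_ne_zero_iff.1 hab).1, Γ.next_fst]
  have : IsTrans Γ.Arrow fun a b : Γ.Arrow => a.fst = b.fst := ⟨fun _ _ _ => Eq.trans⟩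
  have h2 : l.Pairwise fun a b : Γ.Arrow => a.fst = b.fst := List.isChain_iff_pairwise.1 h1
  have : Std.Symm fun a b : Γ.Arrow => a.fst = b.fst := ⟨fun _ _ => Eq.symm⟩
  exact List.Pairwise.forall_of_forall (R := fun a b : Γ.Arrow => a.fst = b.fst)
    (fun _ _ => rfl) h2 ha hb

theorem onSameACycle_iff {a b : Γ.Arrow} : Γ.OnSameACycle K a b ↔ a.fst = b.fst := by
  constructor
  · rintro ⟨l, hl, ha, hb⟩
    exact hl.1.fst_eq ha hb
  · intro h
    let l := (List.range (per a)).map fun m => Γ.next^[m] a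
    have hmem : ∀ c : Γ.Arrow, a.fst = c.fst → c ∈ l := by
      intro c hc
      obtain ⟨k, -, hk, rfl⟩ := exists_iterate_eq hc
      rcases hk.lt_or_eq with hk | rfl
      · exact List.mem_map.2 ⟨k, List.mem_range.2 hk, rfl⟩
      · exact List.mem_map.2 ⟨0, List.mem_range.2 (per_pos a), (iterate_per a).symm⟩
    have hnodup : l.Nodup := by
      refine (List.nodup_map_iff_inj_on List.nodup_range).2 fun x hx y hy hxy => ?_
      rw [List.mem_range] at hx hy
      exact (Function.iterate_eq_iterate_iff_of_lt_minimalPeriod hx hy).1 hxy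
    have hchain : l.IsChain fun a b => Γ.arr K a * Γ.arr K b ≠ 0 := by
      refine (List.isChain_map _).2 ?_
      refine List.isChain_iff_getElem.2 fun k hk => ?_
      rw [List.length_range] at hk
      rw [List.getElem_range, List.getElem_range, arr_mul_arr_ne_zero_iff,
        Function.iterate_succ_apply']
      refine ⟨rfl, ?_⟩
      have := iterate_ne_self (a := Γ.next^[k] a) one_pos (by rw [per_iterate]; omega)
      exact this
    refine ⟨l, ⟨⟨hnodup, hchain⟩, fun l' hl' hs => ?_⟩, hmem a rfl, hmem b h⟩
    have hsub : l' ⊆ l := fun c hc =>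
      hmem c (hl'.fst_eq (hs.subset (hmem a rfl)) hc)
    exact (hs.eq_of_length_le (hl'.1.subperm hsub).length_le).symm

end BrauerTree

/-! ### Non-backtracking sequences of darts -/

namespace BrauerTree

variable {V : Type v} {Γ : BrauerTree V}

/-- The dart `d'` continues the dart `d` without going back. -/
def Turn (d d' : Γ.Arrow) : Prop := d.snd = d'.fst ∧ d' ≠ d.symm

/-- The vertex `x` of the tree is reached by a non-backtracking sequence that starts with `d`. -/
def Beyond (d : Γ.Arrow) (x : V) : Prop :=
  ∃ d', Relation.ReflTransGen Turn d d' ∧ d'.snd = x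

theorem Turn.src_ne {d d' : Γ.Arrow} (h : Turn d d') : Γ.src d ≠ Γ.src d' := by
  intro h'
  rcases src_eq_src_iff.1 h' with rfl | rfl
  · exact d.snd_ne_fst h.1
  · exact h.2 (SimpleGraph.Dart.symm_symm d').symm

theorem beyond_snd (d : Γ.Arrow) : Beyond d d.snd := ⟨d, .refl, rfl⟩

theorem Beyond.of_turn {d d' : Γ.Arrow} (h : Turn d d') {x : V} (hx : Beyond d' x) :
    Beyond d x := by
  obtain ⟨c, hc, rfl⟩ := hx
  exact ⟨c, .head h hc, rfl⟩

theorem exists_walk_of_turn {d c : Γ.Arrow} (h : Relation.ReflTransGen Turn d c) :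
    ∃ p : Γ.graph.Walk d.fst c.snd, p.edges.IsChain (· ≠ ·) ∧ p.edges.head? = some d.edge := by
  induction h using Relation.ReflTransGen.head_induction_on with
  | refl =>
    refine ⟨.cons c.adj .nil, ?_, ?_⟩
    · simp
    · simp; rfl
  | @head d d' h1 _ ih =>
    obtain ⟨p, hp, hp'⟩ := ih
    have hadj : Γ.graph.Adj d.fst d'.fst := h1.1 ▸ d.adj
    have hedge : s(d.fst, d'.fst) = d.edge := by rw [← h1.1]; rfl
    refine ⟨.cons hadj p, ?_, ?_⟩
    · rw [SimpleGraph.Walk.edges_cons, List.isChain_cons]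
      refine ⟨fun y hy => ?_, hp⟩
      rw [hp', Option.mem_some_iff] at hy
      rw [hedge, ← hy]
      exact fun h => h1.src_ne (Subtype.ext h)
    · rw [SimpleGraph.Walk.edges_cons, List.head?_cons, hedge]

theorem not_beyond_fst (d : Γ.Arrow) : ¬ Beyond d d.fst := by
  rintro ⟨c, hc, h⟩
  obtain ⟨p, hp, hp'⟩ := exists_walk_of_turn hc
  have := (Γ.isTree.isAcyclic.isPath_iff_isChain p).2 hp
  revert p
  rw [h]
  intro p hp hp' h'
  rw [SimpleGraph.Walk.isPath_iff_nil, ← SimpleGraph.Walk.eq_nil_iff_nil] at h'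
  rw [h'] at hp'
  simp at hp'

theorem wellFounded_turn [Finite V] : WellFounded fun d' d : Γ.Arrow => Turn d d' := by
  let r : Γ.Arrow → Γ.Arrow → Prop := fun d' d => Relation.TransGen Turn d d'
  have : IsTrans Γ.Arrow r := ⟨fun _ _ _ h h' => h'.trans h⟩
  have : Std.Irrefl r := ⟨fun d h => by
    obtain ⟨c, hc, hc'⟩ := Relation.TransGen.tail'_iff.1 h
    exact not_beyond_fst d ⟨c, hc, hc'.1⟩⟩
  exact Subrelation.wf (r := r) (fun h => .single h) (Finite.wellFounded_of_trans_of_irrefl r)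

/-- An edge at the end of a dart is the edge of this dart or lies beyond it. -/
theorem eq_or_beyond {d z : Γ.Arrow} (h : z.fst = d.snd) :
    Γ.src z = Γ.src d ∨ ∀ x ∈ (Γ.src z : Sym2 V), Beyond d x := by
  by_cases hz : z = d.symm
  · exact Or.inl (by rw [hz, src_symm])
  · refine Or.inr fun x hx => ?_
    rcases mem_src_iff.1 hx with rfl | rfl
    · rw [h]; exact beyond_snd d
    · exact ⟨z, .single ⟨h.symm, hz⟩, rfl⟩

section Chain

variable {L : List Γ.Arrow}

theorem reflTransGen_of_isChain (hL : L.IsChain Turn) {k l : ℕ} {d d' : Γ.Arrow}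
    (hd : L[k]? = some d) (hd' : L[l]? = some d') (h : k ≤ l) :
    Relation.ReflTransGen Turn d d' := by
  rcases h.eq_or_lt with rfl | h
  · rw [hd, Option.some_inj] at hd'
    rw [hd']
  · have h1 : L.IsChain (Relation.ReflTransGen Turn) := hL.imp fun _ _ h => .single h
    have h2 : L.Pairwise (Relation.ReflTransGen Turn) := List.isChain_iff_pairwise.1 h1
    obtain ⟨hk, rfl⟩ := List.getElem?_eq_some_iff.1 hd
    obtain ⟨hl, rfl⟩ := List.getElem?_eq_some_iff.1 hd'
    exact List.pairwise_iff_getElem.1 h2 _ _ hk hl h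

theorem turn_of_isChain (hL : L.IsChain Turn) {k : ℕ} {d d' : Γ.Arrow}
    (hd : L[k]? = some d) (hd' : L[k + 1]? = some d') : Turn d d' := by
  obtain ⟨hk, rfl⟩ := List.getElem?_eq_some_iff.1 hd
  obtain ⟨hl, rfl⟩ := List.getElem?_eq_some_iff.1 hd'
  exact List.isChain_iff_getElem.1 hL k hl

/-- In a non-backtracking sequence in a tree only neighbors have a common vertex. -/
theorem eq_succ_of_mem (hL : L.IsChain Turn) {k l : ℕ} {d d' : Γ.Arrow}
    (hd : L[k]? = some d) (hd' : L[l]? = some d') (h : k < l) {x : V}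
    (hx : x ∈ (Γ.src d : Sym2 V)) (hx' : x ∈ (Γ.src d' : Sym2 V)) :
    l = k + 1 ∧ x = d.snd := by
  have hk : k + 1 < L.length := by
    have := (List.getElem?_eq_some_iff.1 hd').1
    omega
  obtain ⟨d₁, hd₁⟩ : ∃ d₁, L[k + 1]? = some d₁ := ⟨_, List.getElem?_eq_getElem hk⟩
  have h1 := turn_of_isChain hL hd hd₁
  have h2 := reflTransGen_of_isChain hL hd₁ hd' h
  rcases h2.cases_tail with rfl | ⟨c, hc, hc'⟩
  · have h3 : l = k + 1 := by
      by_contra hne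
      obtain ⟨c, hc⟩ : ∃ c, L[k + 2]? = some c :=
        ⟨_, List.getElem?_eq_getElem (by have := (List.getElem?_eq_some_iff.1 hd').1; omega)⟩
      have h4 := reflTransGen_of_isChain hL hc hd' (by omega)
      have h5 := turn_of_isChain hL hd₁ hc
      rcases h4.cases_tail with rfl | ⟨c', hc1, hc2⟩
      · exact h5.src_ne rfl
      · exact not_beyond_fst d' ⟨c', .head h5 hc1, hc2.1⟩
    refine ⟨h3, ?_⟩
    rcases mem_src_iff.1 hx' with rfl | rfl
    · exact h1.1.symm
    · exfalso
      rcases mem_src_iff.1 hx with h4 | h4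
      · exact not_beyond_fst d ⟨d', .single h1, h4⟩
      · exact d'.snd_ne_fst (h4.trans h1.1)
  · exfalso
    have hb : Beyond d₁ x := by
      rcases mem_src_iff.1 hx' with rfl | rfl
      · exact ⟨c, hc, hc'.1⟩
      · exact ⟨d', h2, rfl⟩
    rcases mem_src_iff.1 hx with rfl | rfl
    · exact not_beyond_fst d (hb.of_turn h1)
    · rw [h1.1] at hb
      exact not_beyond_fst d₁ hb

end Chain

/-! ### Zigzags -/

/-- The links of a non-backtracking sequence of darts whose edges are alternately sources and
sinks, the first edge being a source if `t` is true. A link consists of a dart of the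
source and a dart of the sink at the common vertex of two successive edges. -/
def links (t : Bool) (L : List Γ.Arrow) : Set (Γ.Arrow × Γ.Arrow) :=
  {p | ∃ k d d', L[k]? = some d ∧ L[k + 1]? = some d' ∧
    ((t ^^ k.bodd) = true ∧ p = (d.symm, d') ∨ (t ^^ k.bodd) = false ∧ p = (d', d.symm))}

theorem links_cons_cons (t : Bool) (d d' : Γ.Arrow) (l : List Γ.Arrow) :
    links t (d :: d' :: l)
      = insert (if t then (d.symm, d') else (d', d.symm)) (links (!t) (d' :: l)) := by
  ext p
  constructor
  · rintro ⟨k, c, c', hc, hc', h⟩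
    rcases k with _ | k
    · left
      simp only [List.getElem?_cons_zero, Option.some_inj, List.getElem?_cons_succ] at hc hc'
      subst hc hc'
      cases t <;> simpa using h
    · right
      refine ⟨k, c, c', hc, hc', ?_⟩
      rw [Nat.bodd_succ] at h
      cases t <;> simpa using h
  · rintro (h | ⟨k, c, c', hc, hc', h⟩)
    · exact ⟨0, d, d', rfl, rfl, by cases t <;> simpa using h⟩
    · refine ⟨k + 1, c, c', hc, hc', ?_⟩
      rw [Nat.bodd_succ]
      cases t <;> simpa using h

theorem links_true_cons_cons (d d' : Γ.Arrow) (l : List Γ.Arrow) :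
    links true (d :: d' :: l) = insert (d.symm, d') (links false (d' :: l)) :=
  links_cons_cons true d d' l

theorem links_false_cons_cons (d d' : Γ.Arrow) (l : List Γ.Arrow) :
    links false (d :: d' :: l) = insert (d', d.symm) (links true (d' :: l)) :=
  links_cons_cons false d d' l

theorem links_singleton (t : Bool) (d : Γ.Arrow) : links t [d] = ∅ := by
  ext p
  simp [links]

/-- The properties of the set of links of a zigzag in a tree. -/
structure IsZigzag (Λ : Set (Γ.Arrow × Γ.Arrow)) : Prop where
  nonempty : Λ.Nonempty
  fst_eq : ∀ {σ τ}, (σ, τ) ∈ Λ → σ.fst = τ.fst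
  ne : ∀ {σ τ}, (σ, τ) ∈ Λ → σ ≠ τ
  source_eq : ∀ {σ τ σ' τ'}, (σ, τ) ∈ Λ → (σ', τ') ∈ Λ → ∀ {x : V},
    x ∈ (Γ.src σ : Sym2 V) → x ∈ (Γ.src σ' : Sym2 V) → Γ.src σ = Γ.src σ'
  sink_eq : ∀ {σ τ σ' τ'}, (σ, τ) ∈ Λ → (σ', τ') ∈ Λ → ∀ {x : V},
    x ∈ (Γ.src τ : Sym2 V) → x ∈ (Γ.src τ' : Sym2 V) → Γ.src τ = Γ.src τ'
  mem : ∀ {σ τ σ₁ τ₁ σ₂ τ₂}, (σ₁, τ₁) ∈ Λ → (σ₂, τ₂) ∈ Λ → Γ.src σ = Γ.src σ₁ →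
    Γ.src τ = Γ.src τ₂ → σ.fst = τ.fst → (σ, τ) ∈ Λ
  inner : ∀ {σ τ σ' τ' z}, (σ, τ) ∈ Λ → (σ', τ') ∈ Λ → z.fst = σ.fst → z.snd = σ'.fst →
    z = σ ∨ z = τ
  connected : ∀ P : Γ.Edge → Prop, (∀ {σ τ}, (σ, τ) ∈ Λ → (P (Γ.src σ) ↔ P (Γ.src τ))) →
    ∀ {σ τ σ' τ'}, (σ, τ) ∈ Λ → (σ', τ') ∈ Λ → P (Γ.src σ) → P (Γ.src σ')

theorem exists_source_index {t : Bool} {L : List Γ.Arrow} {σ τ : Γ.Arrow}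
    (h : (σ, τ) ∈ links t L) :
    ∃ (k : ℕ) (d : Γ.Arrow), L[k]? = some d ∧ (t ^^ k.bodd) = true ∧ Γ.src σ = Γ.src d := by
  obtain ⟨k, d, d', hd, hd', ⟨h, h'⟩ | ⟨h, h'⟩⟩ := h
  · obtain ⟨rfl, rfl⟩ := Prod.mk.inj h'
    exact ⟨k, d, hd, h, src_symm d⟩
  · obtain ⟨rfl, rfl⟩ := Prod.mk.inj h'
    exact ⟨k + 1, σ, hd', by rw [Nat.bodd_succ]; simpa using h, rfl⟩

theorem exists_sink_index {t : Bool} {L : List Γ.Arrow} {σ τ : Γ.Arrow}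
    (h : (σ, τ) ∈ links t L) :
    ∃ (k : ℕ) (d : Γ.Arrow), L[k]? = some d ∧ (t ^^ k.bodd) = false ∧ Γ.src τ = Γ.src d := by
  obtain ⟨k, d, d', hd, hd', ⟨h, h'⟩ | ⟨h, h'⟩⟩ := h
  · obtain ⟨rfl, rfl⟩ := Prod.mk.inj h'
    exact ⟨k + 1, τ, hd', by rw [Nat.bodd_succ]; simpa using h, rfl⟩
  · obtain ⟨rfl, rfl⟩ := Prod.mk.inj h'
    exact ⟨k, d, hd, h, src_symm d⟩

theorem exists_link_index {t : Bool} {L : List Γ.Arrow} (hL : L.IsChain Turn) {σ τ : Γ.Arrow}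
    (h : (σ, τ) ∈ links t L) :
    ∃ k d d', L[k]? = some d ∧ L[k + 1]? = some d' ∧ σ.fst = d.snd ∧ τ.fst = d.snd ∧
      (σ = d.symm ∧ τ = d' ∨ σ = d' ∧ τ = d.symm) := by
  obtain ⟨k, d, d', hd, hd', ⟨h, h'⟩ | ⟨h, h'⟩⟩ := h
  · obtain ⟨rfl, rfl⟩ := Prod.mk.inj h'
    exact ⟨k, d, τ, hd, hd', rfl, (turn_of_isChain hL hd hd').1.symm, Or.inl ⟨rfl, rfl⟩⟩
  · obtain ⟨rfl, rfl⟩ := Prod.mk.inj h'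
    exact ⟨k, d, σ, hd, hd', (turn_of_isChain hL hd hd').1.symm, rfl, Or.inr ⟨rfl, rfl⟩⟩

theorem src_eq_of_mem {t : Bool} {L : List Γ.Arrow} (hL : L.IsChain Turn) {k l : ℕ}
    {d d' : Γ.Arrow} (hd : L[k]? = some d) (hd' : L[l]? = some d')
    (h : (t ^^ k.bodd) = (t ^^ l.bodd)) {x : V} (hx : x ∈ (Γ.src d : Sym2 V))
    (hx' : x ∈ (Γ.src d' : Sym2 V)) : d = d' := by
  rcases lt_trichotomy k l with hlt | rfl | hlt
  · obtain ⟨rfl, -⟩ := eq_succ_of_mem hL hd hd' hlt hx hx'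
    rw [Nat.bodd_succ] at h
    cases t <;> cases hb : k.bodd <;> simp [hb] at h
  · exact Option.some_inj.1 (hd.symm.trans hd')
  · obtain ⟨rfl, -⟩ := eq_succ_of_mem hL hd' hd hlt hx' hx
    rw [Nat.bodd_succ] at h
    cases t <;> cases hb : l.bodd <;> simp [hb] at h

theorem isZigzag_links {t : Bool} {L : List Γ.Arrow} (hL : L.IsChain Turn)
    (hlen : 2 ≤ L.length) : IsZigzag (links t L) where
  nonempty := by
    have h0 : L[0]? = some (L[0]'(by omega)) := List.getElem?_eq_getElem _
    have h1 : L[0 + 1]? = some (L[0 + 1]'(by omega)) := List.getElem?_eq_getElem _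
    cases t
    · exact ⟨_, 0, _, _, h0, h1, Or.inr ⟨rfl, rfl⟩⟩
    · exact ⟨_, 0, _, _, h0, h1, Or.inl ⟨rfl, rfl⟩⟩
  fst_eq h := by
    obtain ⟨k, d, d', -, -, h1, h2, -⟩ := exists_link_index hL h
    rw [h1, h2]
  ne h := by
    obtain ⟨k, d, d', hd, hd', -, -, h⟩ := exists_link_index hL h
    have := turn_of_isChain hL hd hd'
    rcases h with ⟨rfl, rfl⟩ | ⟨rfl, rfl⟩
    · exact this.2.symm
    · exact this.2
  source_eq h h' := by
    intro x hx hx'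
    obtain ⟨k, d, hd, hk, h1⟩ := exists_source_index h
    obtain ⟨k', d', hd', hk', h1'⟩ := exists_source_index h'
    rw [h1] at hx
    rw [h1'] at hx'
    rw [h1, h1', src_eq_of_mem hL hd hd' (hk.trans hk'.symm) hx hx']
  sink_eq h h' := by
    intro x hx hx'
    obtain ⟨k, d, hd, hk, h1⟩ := exists_sink_index h
    obtain ⟨k', d', hd', hk', h1'⟩ := exists_sink_index h'
    rw [h1] at hx
    rw [h1'] at hx'
    rw [h1, h1', src_eq_of_mem hL hd hd' (hk.trans hk'.symm) hx hx']
  mem := by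
    intro σ τ σ₁ τ₁ σ₂ τ₂ h h' hσ hτ hfst
    obtain ⟨k, d, hd, hk, h1⟩ := exists_source_index h
    obtain ⟨l, c, hc, hl, h2⟩ := exists_sink_index h'
    rw [h1] at hσ
    rw [h2] at hτ
    have hx : σ.fst ∈ (Γ.src d : Sym2 V) := hσ ▸ fst_mem_src σ
    have hx' : σ.fst ∈ (Γ.src c : Sym2 V) := hfst ▸ hτ ▸ fst_mem_src τ
    rcases lt_trichotomy k l with hlt | rfl | hlt
    · obtain ⟨rfl, h3⟩ := eq_succ_of_mem hL hd hc hlt hx hx'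
      refine ⟨k, d, c, hd, hc, Or.inl ⟨hk, ?_⟩⟩
      have h4 := (turn_of_isChain hL hd hc).1
      rw [eq_of_fst_eq_of_src_eq (a := σ) (b := d.symm) h3 (hσ.trans (src_symm d).symm),
        eq_of_fst_eq_of_src_eq (a := τ) (b := c) (hfst.symm.trans (h3.trans h4)) hτ]
    · rw [hk] at hl
      exact absurd hl (by simp)
    · obtain ⟨rfl, h3⟩ := eq_succ_of_mem hL hc hd hlt hx' hx
      refine ⟨l, c, d, hc, hd, Or.inr ⟨hl, ?_⟩⟩
      have h4 := (turn_of_isChain hL hc hd).1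
      rw [eq_of_fst_eq_of_src_eq (a := τ) (b := c.symm) (hfst.symm.trans h3)
        (hτ.trans (src_symm c).symm),
        eq_of_fst_eq_of_src_eq (a := σ) (b := d) (h3.trans h4) hσ]
  inner := by
    intro σ τ σ' τ' z h h' hz hz'
    obtain ⟨k, d, d₁, hd, hd₁, h1, -, h2⟩ := exists_link_index hL h
    obtain ⟨l, c, c₁, hc, hc₁, h1', -, -⟩ := exists_link_index hL h'
    have ht := turn_of_isChain hL hd hd₁
    by_contra hne
    have hne1 : z ≠ d.symm ∧ z ≠ d₁ := by
      rcases h2 with ⟨rfl, rfl⟩ | ⟨rfl, rfl⟩ <;> tauto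
    rw [h1] at hz
    rw [h1'] at hz'
    rcases lt_trichotomy k l with hlt | rfl | hlt
    · have h3 := reflTransGen_of_isChain hL hd₁ hc hlt
      have h4 : Turn z.symm d₁ :=
        ⟨hz.trans ht.1, by rw [SimpleGraph.Dart.symm_symm]; exact hne1.2.symm⟩
      exact not_beyond_fst z.symm ⟨c, .head h4 h3, hz'.symm⟩
    · rw [hd, Option.some_inj] at hc
      subst hc
      exact z.fst_ne_snd (hz.trans hz'.symm)
    · have h3 := reflTransGen_of_isChain hL hc₁ hd hlt
      have h4 : Turn d z := ⟨hz.symm, hne1.1⟩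
      have h5 := turn_of_isChain hL hc hc₁
      exact not_beyond_fst c₁ ⟨z, h3.tail h4, hz'.trans h5.1⟩
  connected P hP := by
    have key : ∀ (k : ℕ) (d : Γ.Arrow), L[k]? = some d → (P (Γ.src d) ↔ P (Γ.src (L[0]'(by omega)))) := by
      intro k
      induction k with
      | zero =>
        intro d hd
        obtain ⟨_, rfl⟩ := List.getElem?_eq_some_iff.1 hd
        rfl
      | succ k ih =>
        intro d' hd'
        have hk := (List.getElem?_eq_some_iff.1 hd').1
        have hd : L[k]? = some (L[k]'(by omega)) := List.getElem?_eq_getElem _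
        rw [← ih _ hd]
        cases hb : t ^^ k.bodd
        · have := @hP d' (L[k]'(by omega)).symm ⟨k, _, _, hd, hd', Or.inr ⟨hb, rfl⟩⟩
          rwa [src_symm] at this
        · have := @hP (L[k]'(by omega)).symm d' ⟨k, _, _, hd, hd', Or.inl ⟨hb, rfl⟩⟩
          rw [src_symm] at this
          exact this.symm
    intro σ τ σ' τ' h h' hσ
    obtain ⟨k, d, hd, -, h1⟩ := exists_source_index h
    obtain ⟨k', d', hd', -, h1'⟩ := exists_source_index h'
    rw [h1', key _ _ hd']
    rwa [h1, key _ _ hd] at hσ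

/-- A zigzag given by two branches that start at a common edge. -/
theorem exists_links_eq_union (l : List Γ.Arrow) (t : Bool) (c : Γ.Arrow) (R : List Γ.Arrow)
    (hl : (c.symm :: l).IsChain Turn) (hR : (c :: R).IsChain Turn) :
    ∃ s L, L.IsChain Turn ∧ L.length = l.length + R.length + 1 ∧
      links s L = links t (c.symm :: l) ∪ links t (c :: R) := by
  induction l generalizing t c R with
  | nil =>
    refine ⟨t, c :: R, hR, by simp, ?_⟩
    rw [links_singleton, Set.empty_union]
  | cons d l ih =>
    rw [List.isChain_cons_cons] at hl
    have h1 : Turn d.symm c := by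
      refine ⟨hl.1.1.symm, fun h => hl.1.2 ?_⟩
      rw [h, SimpleGraph.Dart.symm_symm, SimpleGraph.Dart.symm_symm]
    obtain ⟨s, L, hL, hlen, h⟩ := ih (!t) d.symm (c :: R) (by
      rw [SimpleGraph.Dart.symm_symm]; exact hl.2) (List.isChain_cons_cons.2 ⟨h1, hR⟩)
    refine ⟨s, L, hL, by simp only [List.length_cons] at hlen ⊢; omega, ?_⟩
    rw [h, links_cons_cons, links_cons_cons, SimpleGraph.Dart.symm_symm,
      SimpleGraph.Dart.symm_symm, Bool.not_not]
    cases t <;> simp [Set.insert_union]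

end BrauerTree

/-! ### Admissible walks and zigzags -/

namespace BrauerTree

variable {V : Type v} [Finite V] {Γ : BrauerTree V} {K : Type u} [Field K]

/-- The arrows of the directed paths given by a set of links. -/
def runArrows (Λ : Set (Γ.Arrow × Γ.Arrow)) : Set Γ.Arrow :=
  {a | ∃ σ τ, (σ, τ) ∈ Λ ∧ ∃ n < steps σ τ, a = Γ.next^[n] σ}

theorem runArrows_empty : runArrows (∅ : Set (Γ.Arrow × Γ.Arrow)) = ∅ := by
  ext a; simp [runArrows]

theorem mem_runArrows_insert {Λ : Set (Γ.Arrow × Γ.Arrow)} {σ τ a : Γ.Arrow} :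
    a ∈ runArrows (insert (σ, τ) Λ)
      ↔ (∃ n < steps σ τ, a = Γ.next^[n] σ) ∨ a ∈ runArrows Λ := by
  constructor
  · rintro ⟨σ', τ', h | h, h'⟩
    · obtain ⟨rfl, rfl⟩ := Prod.mk.inj h
      exact Or.inl h'
    · exact Or.inr ⟨σ', τ', h, h'⟩
  · rintro (h | ⟨σ', τ', h, h'⟩)
    · exact ⟨σ, τ, Set.mem_insert _ _, h⟩
    · exact ⟨σ', τ', Set.mem_insert_of_mem _ h, h'⟩

theorem steps_next_right {a b : Γ.Arrow} (h : a.fst = b.fst) (hne : a ≠ b) :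
    steps a (Γ.next b) = steps a b + 1 := by
  refine steps_eq (Nat.succ_pos _) (steps_lt h hne) ?_
  rw [Function.iterate_succ_apply', iterate_steps h]

theorem runArrows_insert_single (Λ : Set (Γ.Arrow × Γ.Arrow)) (a : Γ.Arrow) :
    runArrows (insert (a, Γ.next a) Λ) = insert a (runArrows Λ) := by
  ext b
  rw [mem_runArrows_insert, steps_next]
  refine or_congr ⟨?_, ?_⟩ Iff.rfl
  · rintro ⟨n, hn, rfl⟩
    obtain rfl : n = 0 := by omega
    rfl
  · rintro rfl
    exact ⟨0, one_pos, rfl⟩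

theorem runArrows_insert_left (Λ : Set (Γ.Arrow × Γ.Arrow)) {a b : Γ.Arrow} (h : a.fst = b.fst)
    (hne : Γ.next a ≠ b) :
    runArrows (insert (a, b) Λ) = insert a (runArrows (insert (Γ.next a, b) Λ)) := by
  ext c
  rw [Set.mem_insert_iff, mem_runArrows_insert, mem_runArrows_insert, steps_eq_succ h hne,
    ← or_assoc]
  refine or_congr ⟨?_, ?_⟩ Iff.rfl
  · rintro ⟨n, hn, rfl⟩
    rcases n with _ | n
    · exact Or.inl rfl
    · exact Or.inr ⟨n, by omega, rfl⟩
  · rintro (rfl | ⟨n, hn, rfl⟩)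
    · exact ⟨0, by omega, rfl⟩
    · exact ⟨n + 1, by omega, rfl⟩

theorem runArrows_insert_right (Λ : Set (Γ.Arrow × Γ.Arrow)) {a b : Γ.Arrow} (h : a.fst = b.fst)
    (hne : a ≠ b) :
    runArrows (insert (a, Γ.next b) Λ) = insert b (runArrows (insert (a, b) Λ)) := by
  ext c
  rw [Set.mem_insert_iff, mem_runArrows_insert, mem_runArrows_insert, steps_next_right h hne,
    ← or_assoc]
  refine or_congr ⟨?_, ?_⟩ Iff.rfl
  · rintro ⟨n, hn, rfl⟩
    rcases (Nat.lt_succ_iff.1 hn).lt_or_eq with hn | rfl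
    · exact Or.inr ⟨n, hn, rfl⟩
    · exact Or.inl (iterate_steps h)
  · rintro (rfl | ⟨n, hn, rfl⟩)
    · exact ⟨_, Nat.lt_succ_self _, (iterate_steps h).symm⟩
    · exact ⟨n, by omega, rfl⟩

theorem walkVertices_cons (s : Γ.Arrow × Bool) (w : List (Γ.Arrow × Bool)) :
    walkVertices (s :: w) = stepStart s :: stepEnd s :: w.map stepEnd := rfl

theorem walkVertices_cons_cons {s s' : Γ.Arrow × Bool} {w : List (Γ.Arrow × Bool)}
    (h : stepEnd s = stepStart s') :
    walkVertices (s :: s' :: w) = stepStart s :: walkVertices (s' :: w) := by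
  rw [walkVertices_cons, walkVertices_cons, h]; rfl

theorem isAdmissibleWalk_singleton {s : Γ.Arrow × Bool} (h : stepStart s ≠ stepEnd s) :
    Γ.IsAdmissibleWalk K [s] where
  ne_nil := by simp
  connected := by simp
  simple := by rw [walkVertices_cons]; simpa using h
  turns := by simp

theorem isAdmissibleWalk_cons_cons {s s' : Γ.Arrow × Bool} {w : List (Γ.Arrow × Bool)} :
    Γ.IsAdmissibleWalk K (s :: s' :: w) ↔ stepEnd s = stepStart s' ∧
      stepStart s ∉ walkVertices (s' :: w) ∧ (s.1.fst ≠ s'.1.fst → s.2 ≠ s'.2) ∧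
      Γ.IsAdmissibleWalk K (s' :: w) := by
  constructor
  · rintro ⟨-, h1, h2, h3⟩
    rw [List.isChain_cons_cons] at h1 h3
    rw [walkVertices_cons_cons h1.1, List.nodup_cons] at h2
    rw [onSameACycle_iff] at h3
    exact ⟨h1.1, h2.1, h3.1, by simp, h1.2, h2.2, h3.2⟩
  · rintro ⟨h1, h2, h3, h4⟩
    refine ⟨by simp, List.isChain_cons_cons.2 ⟨h1, h4.connected⟩, ?_,
      List.isChain_cons_cons.2 ⟨?_, h4.turns⟩⟩
    · rw [walkVertices_cons_cons h1, List.nodup_cons]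
      exact ⟨h2, h4.simple⟩
    · rw [onSameACycle_iff]
      exact h3

/-- The set of arrows of a walk. -/
def walkArrows (w : List (Γ.Arrow × Bool)) : Set Γ.Arrow := {a | ∃ b, (a, b) ∈ w}

theorem walkArrows_cons (s : Γ.Arrow × Bool) (w : List (Γ.Arrow × Bool)) :
    walkArrows (s :: w) = insert s.1 (walkArrows w) := by
  ext a
  simp only [walkArrows, List.mem_cons, Set.mem_ofPred_eq, Set.mem_insert_iff]
  constructor
  · rintro ⟨b, rfl | h⟩
    · exact Or.inl rfl
    · exact Or.inr ⟨b, h⟩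
  · rintro (rfl | ⟨b, h⟩)
    · exact ⟨s.2, Or.inl rfl⟩
    · exact ⟨b, Or.inr h⟩

theorem walkArrows_nil : walkArrows ([] : List (Γ.Arrow × Bool)) = ∅ := by
  ext a; simp [walkArrows]

/-- The first step `s` of a walk leaves the edge of `d` around the end point of `d`, along an arrow
if `t` is true and against it otherwise. -/
def IsFirstStep (t : Bool) (d : Γ.Arrow) (s : Γ.Arrow × Bool) : Prop :=
  s.2 = t ∧ if t then s.1 = d.symm else Γ.next s.1 = d.symm

theorem IsFirstStep.stepStart_eq {t : Bool} {d : Γ.Arrow} {s : Γ.Arrow × Bool}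
    (h : IsFirstStep t d s) : stepStart s = Γ.src d := by
  obtain ⟨a, b⟩ := s
  obtain ⟨rfl, h⟩ := h
  cases b
  · exact (congrArg Γ.src (by simpa using h)).trans (src_symm d)
  · exact (congrArg Γ.src (by simpa using h)).trans (src_symm d)

theorem IsFirstStep.fst_eq {t : Bool} {d : Γ.Arrow} {s : Γ.Arrow × Bool}
    (h : IsFirstStep t d s) : s.1.fst = d.snd := by
  obtain ⟨a, b⟩ := s
  obtain ⟨rfl, h⟩ := h
  cases b
  · have h : Γ.next a = d.symm := by simpa using h
    change a.fst = d.snd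
    rw [← Γ.next_fst, h]; rfl
  · have h : a = d.symm := by simpa using h
    rw [h]; rfl

/-- Every admissible walk comes from a non-backtracking sequence of darts. -/
theorem exists_zigzag_of_walk (w : List (Γ.Arrow × Bool)) (s : Γ.Arrow × Bool)
    (hw : Γ.IsAdmissibleWalk K (s :: w)) :
    ∃ d d' l, (d :: d' :: l).IsChain Turn ∧ IsFirstStep s.2 d s ∧
      Γ.src d' ∈ walkVertices (s :: w) ∧
      walkArrows (s :: w) = runArrows (links s.2 (d :: d' :: l)) := by
  induction w generalizing s with
  | nil =>
    obtain ⟨a, b⟩ := s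
    have h := hw.simple
    rw [walkVertices_cons] at h
    have h : stepStart (a, b) ≠ stepEnd (a, b) := by simpa using h
    rw [walkArrows_cons, walkArrows_nil]
    cases b
    · refine ⟨(Γ.next a).symm, a, [], ?_, ⟨rfl, by simp⟩, ?_, ?_⟩
      · refine List.isChain_cons_cons.2 ⟨⟨Γ.next_fst a, ?_⟩, List.isChain_singleton _⟩
        rw [SimpleGraph.Dart.symm_symm]
        exact fun h' => h (congrArg Γ.src h').symm
      · rw [walkVertices_cons]
        simp [stepEnd]
      · rw [links_cons_cons, links_singleton]
        simp only [Bool.false_eq_true, if_false, SimpleGraph.Dart.symm_symm]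
        rw [runArrows_insert_single, runArrows_empty]
    · refine ⟨a.symm, Γ.next a, [], ?_, ⟨rfl, by simp⟩, ?_, ?_⟩
      · refine List.isChain_cons_cons.2 ⟨⟨(Γ.next_fst a).symm, ?_⟩, List.isChain_singleton _⟩
        rw [SimpleGraph.Dart.symm_symm]
        exact fun h' => h (congrArg Γ.src h').symm
      · rw [walkVertices_cons]
        simp [stepEnd, tgt]
      · rw [links_cons_cons, links_singleton]
        simp only [if_true, SimpleGraph.Dart.symm_symm]
        rw [runArrows_insert_single, runArrows_empty]
  | cons s' w ih =>
    rw [isAdmissibleWalk_cons_cons] at hw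
    obtain ⟨hconn, hnot, hturn, hw⟩ := hw
    obtain ⟨d, d', l, hL, hfirst, hmem, harr⟩ := ih s' hw
    have hL' := List.isChain_cons_cons.1 hL
    obtain ⟨a, b⟩ := s
    obtain ⟨a', b'⟩ := s'
    have hstart := hfirst.stepStart_eq
    rw [walkArrows_cons, harr, walkVertices_cons_cons hconn]
    by_cases hfst : a.fst = a'.fst
    · have hb : b = b' := by
        by_contra hb
        apply hnot
        rw [walkVertices_cons]
        refine List.mem_cons_of_mem _ (List.mem_cons.2 (Or.inl ?_))
        cases b <;> cases b'
        · exact absurd rfl hb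
        · have : a = a' := eq_of_fst_eq_of_src_eq hfst hconn
          rw [this]; rfl
        · have : Γ.next a = Γ.next a' :=
            eq_of_fst_eq_of_src_eq (by rw [Γ.next_fst, Γ.next_fst, hfst]) hconn
          rw [Γ.next.injective this]; rfl
        · exact absurd rfl hb
      subst hb
      have hd : d.snd = a.fst := hfirst.fst_eq.symm.trans hfst.symm
      cases b
      · have h1 : Γ.next a' = d.symm := by simpa [IsFirstStep] using hfirst
        have h2 : a = d.symm := by
          rw [← h1]
          exact eq_of_fst_eq_of_src_eq (by rw [Γ.next_fst, hfst]) hconn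
        have h3 : d' ≠ Γ.next a := by
          rintro rfl
          exact hnot hmem
        refine ⟨(Γ.next a).symm, d', l, ?_, ⟨rfl, by simp⟩, List.mem_cons_of_mem _ hmem, ?_⟩
        · refine List.isChain_cons_cons.2 ⟨⟨?_, ?_⟩, hL'.2⟩
          · change (Γ.next a).fst = _
            rw [Γ.next_fst, ← hd, hL'.1.1]
          · rwa [SimpleGraph.Dart.symm_symm]
        · change insert a (runArrows (links false _)) = runArrows (links false _)
          rw [links_false_cons_cons, links_false_cons_cons, SimpleGraph.Dart.symm_symm]
          rw [runArrows_insert_right, h2]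
          · rw [← hL'.1.1, hd]
          · rw [h2]
            exact hL'.1.2
      · have h1 : a' = d.symm := by simpa [IsFirstStep] using hfirst
        have h2 : Γ.next a = d.symm := by
          rw [← h1]
          exact eq_of_fst_eq_of_src_eq (by rw [Γ.next_fst, hfst]) hconn
        have h3 : d' ≠ a := by
          rintro rfl
          exact hnot hmem
        refine ⟨a.symm, d', l, ?_, ⟨rfl, by simp⟩, List.mem_cons_of_mem _ hmem, ?_⟩
        · refine List.isChain_cons_cons.2 ⟨⟨?_, ?_⟩, hL'.2⟩
          · change a.fst = _
            rw [← hd, hL'.1.1]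
          · rwa [SimpleGraph.Dart.symm_symm]
        · change insert a (runArrows (links true _)) = runArrows (links true _)
          rw [links_true_cons_cons, links_true_cons_cons, SimpleGraph.Dart.symm_symm]
          rw [runArrows_insert_left (a := a), h2]
          · rw [← hL'.1.1, hd]
          · rw [h2]
            exact hL'.1.2.symm
    · have hb : b' = !b := by
        have := hturn hfst
        revert this
        cases b <;> cases b' <;> simp
      subst hb
      rw [hconn.symm.trans rfl] at hstart
      have hd : ∀ x ∈ (Γ.src d : Sym2 V), x ≠ a'.fst → x = d.fst := by
        intro x hx hne
        rcases mem_src_iff.1 hx with h | h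
        · exact h
        · exact absurd (h.trans hfirst.fst_eq.symm) hne
      have hdmem : Γ.src d ∈ walkVertices ((a', !b) :: w) := by
        rw [← hfirst.stepStart_eq, walkVertices_cons]
        exact List.mem_cons_self
      have hne0 : stepStart (a, b) ≠ Γ.src d := fun h => hnot (h ▸ hdmem)
      cases b
      · have h1 : Γ.src a = Γ.src d := hstart
        have h2 : a = d :=
          eq_of_fst_eq_of_src_eq (hd _ (h1 ▸ fst_mem_src a) hfst) h1
        subst h2
        refine ⟨(Γ.next a).symm, a, d' :: l, ?_, ⟨rfl, by simp⟩,
          List.mem_cons_of_mem _ hdmem, ?_⟩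
        · refine List.isChain_cons_cons.2 ⟨⟨Γ.next_fst a, ?_⟩, hL⟩
          rw [SimpleGraph.Dart.symm_symm]
          exact fun h => hne0 (congrArg Γ.src h.symm)
        · change _ = runArrows (links false _)
          rw [links_false_cons_cons (Γ.next a).symm, SimpleGraph.Dart.symm_symm,
            runArrows_insert_single]
          rfl
      · have h1 : Γ.src (Γ.next a) = Γ.src d := hstart
        have h2 : Γ.next a = d :=
          eq_of_fst_eq_of_src_eq
            (hd _ (h1 ▸ fst_mem_src _) (by rw [Γ.next_fst]; exact hfst)) h1
        subst h2
        refine ⟨a.symm, Γ.next a, d' :: l, ?_, ⟨rfl, by simp⟩,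
          List.mem_cons_of_mem _ hdmem, ?_⟩
        · refine List.isChain_cons_cons.2 ⟨⟨(Γ.next_fst a).symm, ?_⟩, hL⟩
          rw [SimpleGraph.Dart.symm_symm]
          exact fun h => hne0 (congrArg Γ.src h.symm)
        · change _ = runArrows (links true _)
          rw [links_true_cons_cons a.symm, SimpleGraph.Dart.symm_symm, runArrows_insert_single]
          rfl

theorem exists_zigzag_of_path (Θ : Γ.AdmissiblePath K) :
    ∃ Λ, IsZigzag Λ ∧ Θ.arrows = runArrows Λ := by
  obtain ⟨w, hw, h⟩ := Θ.isPath
  rcases w with _ | ⟨s, w⟩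
  · exact absurd rfl hw.ne_nil
  · obtain ⟨d, d', l, hL, -, -, harr⟩ := exists_zigzag_of_walk w s hw
    exact ⟨_, isZigzag_links hL (by simp), h.trans harr⟩

/-- The number of steps around the first common vertex of a zigzag. -/
noncomputable def firstSteps (t : Bool) (d d' : Γ.Arrow) : ℕ :=
  if t then steps d.symm d' else steps d' d.symm

/-- The vertices of the walk constructed from `d :: d' :: l`. -/
def IsNear (d d' : Γ.Arrow) (t : Bool) (i : Γ.Edge) : Prop :=
  (∃ n ≤ firstSteps t d d', i = Γ.src (Γ.next^[n] (if t then d.symm else d'))) ∨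
    ∀ x ∈ (i : Sym2 V), Beyond d' x

theorem IsNear.eq_or_beyond {d d' : Γ.Arrow} (h : Turn d d') {t : Bool} {i : Γ.Edge}
    (hi : IsNear d d' t i) : i = Γ.src d ∨ ∀ x ∈ (i : Sym2 V), Beyond d x := by
  rcases hi with ⟨n, -, rfl⟩ | hi
  · apply BrauerTree.eq_or_beyond
    rw [iterate_next_fst]
    cases t
    · exact h.1.symm
    · rfl
  · exact Or.inr fun x hx => (hi x hx).of_turn h

theorem not_isNear_src {d d' : Γ.Arrow} (h : Turn d d') :
    ¬ ∀ x ∈ (Γ.src d : Sym2 V), Beyond d' x := by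
  intro h'
  have := h' _ (snd_mem_src d)
  rw [h.1] at this
  exact not_beyond_fst d' this

variable (K) in
/-- The sequence `d :: d' :: l` gives an admissible walk. -/
def HasWalk (t : Bool) (d d' : Γ.Arrow) (l : List Γ.Arrow) : Prop :=
  ∃ s w, Γ.IsAdmissibleWalk K (s :: w) ∧ IsFirstStep t d s ∧
    (∀ i ∈ walkVertices (s :: w), IsNear d d' t i) ∧
    walkArrows (s :: w) = runArrows (links t (d :: d' :: l))

theorem hasWalk_of_firstSteps_eq_one {l : List Γ.Arrow}
    (base : ∀ (t : Bool) (d d' : Γ.Arrow), firstSteps t d d' = 1 →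
      (d :: d' :: l).IsChain Turn → HasWalk K t d d' l) (n : ℕ) :
    ∀ (t : Bool) (d d' : Γ.Arrow), firstSteps t d d' = n + 1 →
      (d :: d' :: l).IsChain Turn → HasWalk K t d d' l := by
  induction n with
  | zero => exact base
  | succ n ih =>
    intro t d d' hn hL
    have hL' := List.isChain_cons_cons.1 hL
    have hT := hL'.1
    cases t
    · have hn : steps d' d.symm = n + 2 := hn
      have hfst : d'.fst = d.symm.fst := hT.1.symm
      obtain ⟨a, ha⟩ : ∃ a, Γ.next a = d.symm := ⟨Γ.next.symm d.symm, by simp⟩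
      have hafst : a.fst = d.snd := by rw [← Γ.next_fst, ha]; rfl
      have hne : d' ≠ a := by
        rintro rfl
        rw [← ha, steps_next] at hn
        omega
      have hfst' : d'.fst = a.fst := by rw [hafst]; exact hT.1.symm
      have hsteps : steps d' a = n + 1 := by
        have := steps_next_right hfst' hne
        rw [ha] at this
        omega
      have hT' : Turn a.symm d' := ⟨hfst'.symm, by rwa [SimpleGraph.Dart.symm_symm]⟩
      have hsteps' : firstSteps false a.symm d' = n + 1 := by
        change steps d' a.symm.symm = _
        rwa [SimpleGraph.Dart.symm_symm]
      obtain ⟨s, w, hw, hs, hnear, harr⟩ := ih false a.symm d' hsteps'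
        (List.isChain_cons_cons.2 ⟨hT', hL'.2⟩)
      have hconn : stepEnd (a, false) = stepStart s := by
        rw [hs.stepStart_eq, src_symm]; rfl
      have hstart : stepStart (a, false) = Γ.src d :=
        (congrArg Γ.src ha).trans (src_symm d)
      refine ⟨(a, false), s :: w, isAdmissibleWalk_cons_cons.2 ⟨hconn, ?_, ?_, hw⟩,
        ⟨rfl, ha⟩, ?_, ?_⟩
      · intro hmem
        rw [hstart] at hmem
        rcases hnear _ hmem with ⟨m, hm, h⟩ | h
        · rw [hsteps'] at hm
          have h1 : Γ.next^[m] d' = d.symm :=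
            eq_of_fst_eq_of_src_eq ((iterate_next_fst d' m).trans hfst)
              (h.symm.trans (src_symm d).symm)
          exact iterate_ne_of_lt_steps hfst hT.2 (by omega) h1
        · exact not_isNear_src hT h
      · intro h
        exact absurd hs.fst_eq.symm h
      · intro i hi
        rw [walkVertices_cons_cons hconn, List.mem_cons] at hi
        rcases hi with rfl | hi
        · refine Or.inl ⟨_, le_rfl, ?_⟩
          change _ = Γ.src (Γ.next^[steps d' d.symm] d')
          rw [iterate_steps hfst, src_symm, hstart]
        · rcases hnear _ hi with ⟨m, hm, h⟩ | h
          · refine Or.inl ⟨m, ?_, h⟩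
            rw [hsteps'] at hm
            change m ≤ steps d' d.symm
            omega
          · exact Or.inr h
      · rw [walkArrows_cons, harr, links_false_cons_cons, links_false_cons_cons,
          SimpleGraph.Dart.symm_symm, ← ha, runArrows_insert_right _ hfst' hne]
    · have hn : steps d.symm d' = n + 2 := hn
      have hfst : d.symm.fst = d'.fst := hT.1
      have hne : Γ.next d.symm ≠ d' := by
        rintro rfl
        rw [steps_next] at hn
        omega
      have hsteps : steps (Γ.next d.symm) d' = n + 1 := by
        have := steps_eq_succ hfst hne
        omega
      have hT' : Turn (Γ.next d.symm).symm d' :=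
        ⟨(Γ.next_fst _).trans hfst, by rw [SimpleGraph.Dart.symm_symm]; exact hne.symm⟩
      have hsteps' : firstSteps true (Γ.next d.symm).symm d' = n + 1 := by
        change steps (Γ.next d.symm).symm.symm d' = _
        rwa [SimpleGraph.Dart.symm_symm]
      obtain ⟨s, w, hw, hs, hnear, harr⟩ := ih true (Γ.next d.symm).symm d' hsteps'
        (List.isChain_cons_cons.2 ⟨hT', hL'.2⟩)
      have hconn : stepEnd (d.symm, true) = stepStart s := by
        rw [hs.stepStart_eq, src_symm]; rfl
      have hstart : stepStart (d.symm, true) = Γ.src d := src_symm d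
      refine ⟨(d.symm, true), s :: w, isAdmissibleWalk_cons_cons.2 ⟨hconn, ?_, ?_, hw⟩,
        ⟨rfl, rfl⟩, ?_, ?_⟩
      · intro hmem
        rw [hstart] at hmem
        rcases hnear _ hmem with ⟨m, hm, h⟩ | h
        · rw [hsteps'] at hm
          simp only [if_true, SimpleGraph.Dart.symm_symm] at h
          rw [← Function.iterate_succ_apply] at h
          have h1 : Γ.next^[m + 1] d.symm = d.symm :=
            eq_of_fst_eq_of_src_eq (iterate_next_fst _ _) (h.symm.trans (src_symm d).symm)
          exact iterate_ne_of_le_steps hfst hT.2.symm (Nat.succ_pos m) (by omega) h1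
        · exact not_isNear_src hT h
      · intro h
        exact absurd ((Γ.next_fst d.symm).symm.trans hs.fst_eq.symm) h
      · intro i hi
        rw [walkVertices_cons_cons hconn, List.mem_cons] at hi
        rcases hi with rfl | hi
        · exact Or.inl ⟨0, Nat.zero_le _, rfl⟩
        · rcases hnear _ hi with ⟨m, hm, h⟩ | h
          · refine Or.inl ⟨m + 1, ?_, ?_⟩
            · rw [hsteps'] at hm
              change m + 1 ≤ steps d.symm d'
              omega
            · simp only [if_true, SimpleGraph.Dart.symm_symm] at h
              exact h
          · exact Or.inr h
      · rw [walkArrows_cons, harr, links_true_cons_cons, links_true_cons_cons,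
          SimpleGraph.Dart.symm_symm, runArrows_insert_left _ hfst hne]

theorem firstSteps_pos {t : Bool} {d d' : Γ.Arrow} (h : Turn d d') : 0 < firstSteps t d d' := by
  cases t
  · exact steps_pos h.1.symm
  · exact steps_pos (a := d.symm) h.1

/-- The arrow of the only step around the first common vertex. -/
theorem exists_step_of_firstSteps_eq_one {t : Bool} {d d' : Γ.Arrow} (h : Turn d d')
    (hn : firstSteps t d d' = 1) : ∃ a, IsFirstStep t d (a, t) ∧ stepEnd (a, t) = Γ.src d' ∧
      ∀ Λ, runArrows (insert (if t then (d.symm, d') else (d', d.symm)) Λ)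
        = insert a (runArrows Λ) := by
  cases t
  · have hn : steps d' d.symm = 1 := hn
    have h1 := iterate_steps (a := d') (b := d.symm) h.1.symm
    rw [hn] at h1
    have h1 : Γ.next d' = d.symm := h1
    refine ⟨d', ⟨rfl, h1⟩, rfl, fun Λ => ?_⟩
    rw [← h1]
    exact runArrows_insert_single Λ d'
  · have hn : steps d.symm d' = 1 := hn
    have h1 := iterate_steps (a := d.symm) (b := d') h.1
    rw [hn] at h1
    have h1 : Γ.next d.symm = d' := h1
    refine ⟨d.symm, ⟨rfl, rfl⟩, congrArg Γ.src h1, fun Λ => ?_⟩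
    rw [← h1]
    exact runArrows_insert_single Λ d.symm

theorem isNear_src_left {t : Bool} {d d' : Γ.Arrow} (h : Turn d d') :
    IsNear d d' t (Γ.src d) := by
  cases t
  · refine Or.inl ⟨_, le_rfl, ?_⟩
    change _ = Γ.src (Γ.next^[steps d' d.symm] d')
    rw [iterate_steps (b := d.symm) h.1.symm, src_symm]
  · exact Or.inl ⟨0, Nat.zero_le _, (src_symm d).symm⟩

theorem isNear_src_right {t : Bool} {d d' : Γ.Arrow} (h : Turn d d') :
    IsNear d d' t (Γ.src d') := by
  cases t
  · exact Or.inl ⟨0, Nat.zero_le _, rfl⟩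
  · refine Or.inl ⟨_, le_rfl, ?_⟩
    change _ = Γ.src (Γ.next^[steps d.symm d'] d.symm)
    rw [iterate_steps (a := d.symm) h.1]

/-- A non-backtracking sequence of darts gives an admissible walk. -/
theorem hasWalk_of_isChain (l : List Γ.Arrow) (t : Bool) (d d' : Γ.Arrow)
    (hL : (d :: d' :: l).IsChain Turn) : HasWalk K t d d' l := by
  induction l generalizing t d d' with
  | nil =>
    obtain ⟨n, hn⟩ := Nat.exists_eq_succ_of_ne_zero
      (firstSteps_pos (t := t) (List.isChain_cons_cons.1 hL).1).ne'
    refine hasWalk_of_firstSteps_eq_one (fun t d d' hn hL => ?_) n t d d' hn hL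
    have hT := (List.isChain_cons_cons.1 hL).1
    obtain ⟨a, ha, hend, hrun⟩ := exists_step_of_firstSteps_eq_one hT hn
    refine ⟨(a, t), [], isAdmissibleWalk_singleton ?_, ha, ?_, ?_⟩
    · rw [hend, ha.stepStart_eq]
      exact hT.src_ne
    · intro i hi
      rw [walkVertices_cons, hend, ha.stepStart_eq] at hi
      simp only [List.map_nil, List.mem_cons, List.not_mem_nil, or_false] at hi
      rcases hi with rfl | rfl
      · exact isNear_src_left hT
      · exact isNear_src_right hT
    · rw [walkArrows_cons, walkArrows_nil, links_cons_cons, links_singleton, hrun,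
        runArrows_empty]
  | cons c l ih =>
    obtain ⟨n, hn⟩ := Nat.exists_eq_succ_of_ne_zero
      (firstSteps_pos (t := t) (List.isChain_cons_cons.1 hL).1).ne'
    refine hasWalk_of_firstSteps_eq_one (fun t d d' hn hL => ?_) n t d d' hn hL
    have hT := (List.isChain_cons_cons.1 hL).1
    have hL' := (List.isChain_cons_cons.1 hL).2
    have hT' := (List.isChain_cons_cons.1 hL').1
    obtain ⟨a, ha, hend, hrun⟩ := exists_step_of_firstSteps_eq_one hT hn
    obtain ⟨s, w, hw, hs, hnear, harr⟩ := ih (!t) d' c hL'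
    have hconn : stepEnd (a, t) = stepStart s := by rw [hend, hs.stepStart_eq]
    refine ⟨(a, t), s :: w, isAdmissibleWalk_cons_cons.2 ⟨hconn, ?_, ?_, hw⟩, ha, ?_, ?_⟩
    · intro hmem
      rw [ha.stepStart_eq] at hmem
      rcases (hnear _ hmem).eq_or_beyond hT' with h | h
      · exact hT.src_ne h
      · exact not_isNear_src hT h
    · intro _
      rw [hs.1]
      cases t <;> simp
    · intro i hi
      rw [walkVertices_cons_cons hconn, List.mem_cons, ha.stepStart_eq] at hi
      rcases hi with rfl | hi
      · exact isNear_src_left hT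
      · rcases (hnear _ hi).eq_or_beyond hT' with rfl | h
        · exact isNear_src_right hT
        · exact Or.inr h
    · rw [walkArrows_cons, harr, links_cons_cons t, hrun]

variable (K) in
theorem exists_path_of_isChain {t : Bool} {L : List Γ.Arrow} (hL : L.IsChain Turn)
    (hlen : 2 ≤ L.length) : ∃ Θ : Γ.AdmissiblePath K, Θ.arrows = runArrows (links t L) := by
  rcases L with _ | ⟨d, _ | ⟨d', l⟩⟩
  · simp at hlen
  · simp at hlen
  · obtain ⟨s, w, hw, -, -, h⟩ := hasWalk_of_isChain (K := K) l t d d' hL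
    exact ⟨⟨walkArrows (s :: w), s :: w, hw, rfl⟩, h⟩

end BrauerTree

/-! ### Sources, sinks and coefficients of a zigzag -/

namespace BrauerTree

variable {V : Type v} [Finite V] {Γ : BrauerTree V} {K : Type u} [Field K]

/-- The list of `k` successive arrows starting with `a`. -/
def runList (a : Γ.Arrow) (k : ℕ) : List Γ.Arrow := (List.range k).map fun m => Γ.next^[m] a

theorem runList_succ (a : Γ.Arrow) (k : ℕ) :
    runList a (k + 1) = a :: runList (Γ.next a) k := by
  rw [runList, List.range_succ_eq_map, List.map_cons, List.map_map]; rfl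

theorem pathElement_runList (a : Γ.Arrow) (k : ℕ) :
    Γ.pathElement K (Γ.src a) (runList a k) = arc K a k := by
  rw [pathElement, runList, List.map_map]; rfl

namespace IsZigzag

variable {Λ : Set (Γ.Arrow × Γ.Arrow)} {σ τ σ' τ' : Γ.Arrow}

theorem src_ne (hΛ : IsZigzag Λ) (h : (σ, τ) ∈ Λ) (h' : (σ', τ') ∈ Λ) : Γ.src σ ≠ Γ.src τ' :=
  fun h0 => hΛ.ne (hΛ.mem h h' rfl h0 rfl) rfl

theorem eq_of_fst_eq (hΛ : IsZigzag Λ) (h : (σ, τ) ∈ Λ) (h' : (σ', τ') ∈ Λ)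
    (hf : σ.fst = σ'.fst) :
    σ = σ' ∧ τ = τ' := by
  have hτ : τ.fst = τ'.fst := by rw [← hΛ.fst_eq h, ← hΛ.fst_eq h', hf]
  exact ⟨eq_of_fst_eq_of_src_eq hf
    (hΛ.source_eq h h' (fst_mem_src σ) (hf ▸ fst_mem_src σ')),
    eq_of_fst_eq_of_src_eq hτ (hΛ.sink_eq h h' (fst_mem_src τ) (hτ ▸ fst_mem_src _))⟩

/-- A link is determined by its source and its sink. -/
theorem eq_of_src_eq (hΛ : IsZigzag Λ) (h : (σ, τ) ∈ Λ) (h' : (σ', τ') ∈ Λ)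
    (hs : Γ.src σ = Γ.src σ') (ht : Γ.src τ = Γ.src τ') : σ = σ' ∧ τ = τ' := by
  apply hΛ.eq_of_fst_eq h h'
  rcases src_eq_src_iff.1 hs with rfl | rfl
  · rfl
  rcases src_eq_src_iff.1 ht with rfl | rfl
  · rw [hΛ.fst_eq h, hΛ.fst_eq h']
  · exfalso
    have h1 : σ'.snd = τ'.snd := hΛ.fst_eq h
    have h2 : σ'.fst = τ'.fst := hΛ.fst_eq h'
    exact hΛ.ne h' (SimpleGraph.Dart.ext _ _ (Prod.ext h2 h1))

theorem mem_of_eq (hΛ : IsZigzag Λ) (h : (σ, τ) ∈ Λ) (h' : (σ, τ') ∈ Λ) : τ = τ' := (hΛ.eq_of_fst_eq h h' rfl).2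

variable {Θ : Γ.AdmissiblePath K}

theorem isSource_iff (hΛ : IsZigzag Λ) (hΘ : Θ.arrows = runArrows Λ)
    {i : Γ.Edge} : Θ.IsSource i ↔ ∃ σ τ, (σ, τ) ∈ Λ ∧ Γ.src σ = i := by
  constructor
  · rintro ⟨⟨a, ha, rfl⟩, h⟩
    rw [hΘ] at ha h
    obtain ⟨σ, τ, hm, n, hn, rfl⟩ := ha
    rcases n with _ | n
    · exact ⟨σ, τ, hm, rfl⟩
    · refine absurd ?_ (h (Γ.next^[n] σ) ⟨σ, τ, hm, n, by omega, rfl⟩)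
      rw [Function.iterate_succ_apply']; rfl
  · rintro ⟨σ, τ, hm, rfl⟩
    refine ⟨⟨σ, ?_, rfl⟩, ?_⟩
    · rw [hΘ]
      exact ⟨σ, τ, hm, 0, steps_pos (hΛ.fst_eq hm), rfl⟩
    · intro a ha h
      rw [hΘ] at ha
      obtain ⟨σ', τ', hm', n, hn, rfl⟩ := ha
      rw [tgt, ← Function.iterate_succ_apply' (f := Γ.next)] at h
      have h1 : σ'.fst ∈ (Γ.src σ : Sym2 V) := by
        rw [← h, ← iterate_next_fst σ' (n + 1)]
        exact fst_mem_src _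
      have h2 := hΛ.source_eq hm hm' h1 (fst_mem_src σ')
      exact iterate_ne_of_le_steps (hΛ.fst_eq hm') (hΛ.ne hm') (Nat.succ_pos n) hn
        (eq_of_fst_eq_of_src_eq (iterate_next_fst _ _) (h.trans h2))

theorem isSink_iff (hΛ : IsZigzag Λ) (hΘ : Θ.arrows = runArrows Λ)
    {j : Γ.Edge} : Θ.IsSink j ↔ ∃ σ τ, (σ, τ) ∈ Λ ∧ Γ.src τ = j := by
  constructor
  · rintro ⟨⟨a, ha, rfl⟩, h⟩
    rw [hΘ] at ha h
    obtain ⟨σ, τ, hm, n, hn, rfl⟩ := ha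
    rw [tgt, ← Function.iterate_succ_apply' (f := Γ.next)] at h ⊢
    rcases (Nat.succ_le_of_lt hn).lt_or_eq with hn | hn
    · exact absurd rfl (h _ ⟨σ, τ, hm, n + 1, hn, rfl⟩)
    · refine ⟨σ, τ, hm, ?_⟩
      rw [← iterate_steps (hΛ.fst_eq hm), ← hn]
  · rintro ⟨σ, τ, hm, rfl⟩
    have hpos := steps_pos (hΛ.fst_eq hm)
    refine ⟨⟨Γ.next^[steps σ τ - 1] σ, ?_, ?_⟩, ?_⟩
    · rw [hΘ]
      exact ⟨σ, τ, hm, _, by omega, rfl⟩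
    · rw [tgt, ← Function.iterate_succ_apply' (f := Γ.next), Nat.sub_one,
        Nat.succ_pred_eq_of_pos hpos, iterate_steps (hΛ.fst_eq hm)]
    · intro a ha h
      rw [hΘ] at ha
      obtain ⟨σ', τ', hm', n, hn, rfl⟩ := ha
      have h1 : τ'.fst ∈ (Γ.src τ : Sym2 V) := by
        rw [← h, ← hΛ.fst_eq hm', ← iterate_next_fst σ' n]
        exact fst_mem_src _
      have h2 := hΛ.sink_eq hm hm' h1 (fst_mem_src τ')
      exact iterate_ne_of_lt_steps (hΛ.fst_eq hm') (hΛ.ne hm') hn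
        (eq_of_fst_eq_of_src_eq ((iterate_next_fst _ _).trans (hΛ.fst_eq hm')) (h.trans h2))

theorem isDirectedSubpath_runList (hΛ : IsZigzag Λ) (hΘ : Θ.arrows = runArrows Λ)
    (h : (σ, τ) ∈ Λ) (k t : ℕ) (hk : t + k = steps σ τ) :
    Θ.IsDirectedSubpath (Γ.src (Γ.next^[t] σ)) (runList (Γ.next^[t] σ) k) (Γ.src τ) := by
  induction k generalizing t with
  | zero =>
    rw [add_zero] at hk
    change Γ.src _ = _
    rw [hk, iterate_steps (hΛ.fst_eq h)]
  | succ k ih =>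
    rw [runList_succ]
    refine ⟨?_, rfl, ?_⟩
    · rw [hΘ]
      exact ⟨σ, τ, h, t, by omega, rfl⟩
    · have := ih (t + 1) (by omega)
      rwa [Function.iterate_succ_apply'] at this

theorem eq_runList (hΛ : IsZigzag Λ) (hΘ : Θ.arrows = runArrows Λ)
    (h : (σ, τ) ∈ Λ) {p : List Γ.Arrow} {j : Γ.Edge} (hj : Θ.IsSink j) (t : ℕ)
    (ht : 0 < t) (ht' : t ≤ steps σ τ)
    (hp : Θ.IsDirectedSubpath (Γ.src (Γ.next^[t] σ)) p j) :
    j = Γ.src τ ∧ p = runList (Γ.next^[t] σ) (steps σ τ - t) := by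
  induction p generalizing t with
  | nil =>
    have hp : Γ.src (Γ.next^[t] σ) = j := hp
    subst hp
    rcases ht'.lt_or_eq with hlt | rfl
    · exact absurd rfl (hj.2 _ (by rw [hΘ]; exact ⟨σ, τ, h, t, hlt, rfl⟩))
    · rw [Nat.sub_self, iterate_steps (hΛ.fst_eq h)]
      exact ⟨rfl, rfl⟩
  | cons a p ih =>
    obtain ⟨ha, hsrc, hp⟩ := hp
    have hlt : t < steps σ τ := by
      refine lt_of_le_of_ne ht' ?_
      rintro rfl
      rw [iterate_steps (hΛ.fst_eq h)] at hsrc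
      exact ((hΛ.isSink_iff hΘ).2 ⟨σ, τ, h, rfl⟩).2 a ha hsrc
    have hat : a = Γ.next^[t] σ := by
      rcases src_eq_src_iff.1 hsrc with h1 | h1
      · exact h1
      · exfalso
        rw [hΘ] at ha
        obtain ⟨σ', τ', hm', n, hn, rfl⟩ := ha
        have h2 : (Γ.next^[t] σ).snd = σ'.fst := by
          rw [← iterate_next_fst σ' n, h1]; rfl
        rcases hΛ.inner h hm' (iterate_next_fst σ t) h2 with h3 | h3
        · exact iterate_ne_of_le_steps (hΛ.fst_eq h) (hΛ.ne h) ht ht' h3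
        · exact iterate_ne_of_lt_steps (hΛ.fst_eq h) (hΛ.ne h) hlt h3
    subst hat
    obtain ⟨m, hm⟩ : ∃ m, steps σ τ - t = m + 1 := ⟨steps σ τ - t - 1, by omega⟩
    have := ih (t + 1) (by omega) hlt (by rw [Function.iterate_succ_apply']; exact hp)
    refine ⟨this.1, ?_⟩
    rw [hm, runList_succ, this.2, Function.iterate_succ_apply']
    congr 2
    omega

theorem isDirectedSubpath_iff (hΛ : IsZigzag Λ) (hΘ : Θ.arrows = runArrows Λ)
    {i j : Γ.Edge} (hi : Θ.IsSource i) (hj : Θ.IsSink j)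
    {p : List Γ.Arrow} : Θ.IsDirectedSubpath i p j ↔
      ∃ σ τ, (σ, τ) ∈ Λ ∧ Γ.src σ = i ∧ Γ.src τ = j ∧ p = runList σ (steps σ τ) := by
  constructor
  · intro hp
    rcases p with _ | ⟨a, p⟩
    · have hp : i = j := hp
      subst hp
      obtain ⟨a, ha, ha'⟩ := hi.1
      exact absurd ha' (hj.2 a ha)
    · obtain ⟨ha, rfl, hp⟩ := hp
      have ha' := ha
      rw [hΘ] at ha
      obtain ⟨σ, τ, hm, n, hn, rfl⟩ := ha
      rcases n with _ | n
      · have := hΛ.eq_runList hΘ hm hj 1 one_pos (steps_pos (hΛ.fst_eq hm)) hp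
        refine ⟨σ, τ, hm, rfl, this.1.symm, ?_⟩
        obtain ⟨m, hm'⟩ := Nat.exists_eq_succ_of_ne_zero (steps_pos (hΛ.fst_eq hm)).ne'
        rw [this.2, hm', Nat.succ_eq_add_one, runList_succ]
        rfl
      · refine absurd ?_ (hi.2 (Γ.next^[n] σ) (by rw [hΘ]; exact ⟨σ, τ, hm, n, by omega, rfl⟩))
        rw [Function.iterate_succ_apply']; rfl
  · rintro ⟨σ, τ, hm, rfl, rfl, rfl⟩
    exact hΛ.isDirectedSubpath_runList hΘ hm (steps σ τ) 0 (zero_add _)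

theorem coefficient_of_mem (hΛ : IsZigzag Λ) (hΘ : Θ.arrows = runArrows Λ)
    (h : (σ, τ) ∈ Λ) :
    Θ.coefficient (Γ.src σ) (Γ.src τ) = arc K σ (steps σ τ) := by
  have hset : {p | Θ.IsDirectedSubpath (Γ.src σ) p (Γ.src τ)} = {runList σ (steps σ τ)} := by
    ext p
    rw [Set.mem_singleton_iff, Set.mem_ofPred_eq,
      hΛ.isDirectedSubpath_iff hΘ ((hΛ.isSource_iff hΘ).2 ⟨σ, τ, h, rfl⟩)
      ((hΛ.isSink_iff hΘ).2 ⟨σ, τ, h, rfl⟩)]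
    constructor
    · rintro ⟨σ', τ', h', hs, ht, rfl⟩
      obtain ⟨rfl, rfl⟩ := hΛ.eq_of_src_eq h' h hs ht
      rfl
    · rintro rfl
      exact ⟨σ, τ, h, rfl, rfl, rfl⟩
  change ∑ᶠ p ∈ {p | Θ.IsDirectedSubpath (Γ.src σ) p (Γ.src τ)}, _ = _
  rw [hset, finsum_mem_singleton, pathElement_runList]

theorem coefficient_eq_zero (hΛ : IsZigzag Λ) (hΘ : Θ.arrows = runArrows Λ)
    {i j : Γ.Edge} (hi : Θ.IsSource i) (hj : Θ.IsSink j)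
    (h : ∀ σ τ, (σ, τ) ∈ Λ → Γ.src σ = i → Γ.src τ ≠ j) : Θ.coefficient i j = 0 := by
  have hset : {p | Θ.IsDirectedSubpath i p j} = ∅ := by
    rw [Set.eq_empty_iff_forall_notMem]
    intro p hp
    obtain ⟨σ, τ, h', hs, ht, -⟩ := (hΛ.isDirectedSubpath_iff hΘ hi hj).1 hp
    exact h σ τ h' hs ht
  change ∑ᶠ p ∈ {p | Θ.IsDirectedSubpath i p j}, _ = _
  rw [hset, finsum_mem_empty]

end IsZigzag

/-- A path is determined by its sources and sinks. -/
theorem path_ext {Θ Θ' : Γ.AdmissiblePath K} (hs : ∀ i, Θ.IsSource i ↔ Θ'.IsSource i)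
    (ht : ∀ i, Θ.IsSink i ↔ Θ'.IsSink i) : Θ = Θ' := by
  obtain ⟨Λ, hΛ, hΘ⟩ := exists_zigzag_of_path Θ
  obtain ⟨Λ', hΛ', hΘ'⟩ := exists_zigzag_of_path Θ'
  have key : Λ = Λ' := by
    ext ⟨σ, τ⟩
    constructor
    · intro h
      obtain ⟨σ₁, τ₁, h1, h1'⟩ := (hΛ'.isSource_iff hΘ').1
        ((hs _).1 ((hΛ.isSource_iff hΘ).2 ⟨σ, τ, h, rfl⟩))
      obtain ⟨σ₂, τ₂, h2, h2'⟩ := (hΛ'.isSink_iff hΘ').1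
        ((ht _).1 ((hΛ.isSink_iff hΘ).2 ⟨σ, τ, h, rfl⟩))
      exact hΛ'.mem h1 h2 h1'.symm h2'.symm (hΛ.fst_eq h)
    · intro h
      obtain ⟨σ₁, τ₁, h1, h1'⟩ := (hΛ.isSource_iff hΘ).1
        ((hs _).2 ((hΛ'.isSource_iff hΘ').2 ⟨σ, τ, h, rfl⟩))
      obtain ⟨σ₂, τ₂, h2, h2'⟩ := (hΛ.isSink_iff hΘ).1
        ((ht _).2 ((hΛ'.isSink_iff hΘ').2 ⟨σ, τ, h, rfl⟩))
      exact hΛ.mem h1 h2 h1'.symm h2'.symm (hΛ'.fst_eq h)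
  have : Θ.arrows = Θ'.arrows := by rw [hΘ, hΘ', key]
  cases Θ
  cases Θ'
  congr

end BrauerTree

/-! ### Projective covers and indecomposable modules -/

section Modules

variable {A : Type u} [Ring A]

theorem IsSuperfluous.mono {M : Type v} [AddCommGroup M] [Module A M] {N N' : Submodule A M}
    (h : IsSuperfluous N') (hle : N ≤ N') : IsSuperfluous N := fun L hL =>
  h L (eq_top_iff.2 (hL ▸ sup_le_sup_left hle L))

section ComplexIso

variable {P₀ P₁ Q₀ Q₁ R₀ R₁ : Type u}
  [AddCommGroup P₀] [Module A P₀] [AddCommGroup P₁] [Module A P₁]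
  [AddCommGroup Q₀] [Module A Q₀] [AddCommGroup Q₁] [Module A Q₁]
  [AddCommGroup R₀] [Module A R₀] [AddCommGroup R₁] [Module A R₁]
  {d : P₀ →ₗ[A] P₁} {d' : Q₀ →ₗ[A] Q₁} {d'' : R₀ →ₗ[A] R₁}

theorem ComplexIso.symm (h : ComplexIso d d') : ComplexIso d' d := by
  obtain ⟨φ₀, φ₁, h⟩ := h
  refine ⟨φ₀.symm, φ₁.symm, fun x => ?_⟩
  rw [LinearEquiv.symm_apply_eq, h, LinearEquiv.apply_symm_apply]

theorem ComplexIso.trans (h : ComplexIso d d') (h' : ComplexIso d' d'') : ComplexIso d d'' := by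
  obtain ⟨φ₀, φ₁, h⟩ := h
  obtain ⟨ψ₀, ψ₁, h'⟩ := h'
  refine ⟨φ₀.trans ψ₀, φ₁.trans ψ₁, fun x => ?_⟩
  rw [LinearEquiv.trans_apply, LinearEquiv.trans_apply, h, h']

end ComplexIso

/-- Projective covers are unique. -/
theorem exists_equiv_of_projective_covers {P Q X : Type v} [AddCommGroup P] [Module A P]
    [AddCommGroup Q] [Module A Q] [AddCommGroup X] [Module A X] [Module.Projective A P]
    [Module.Projective A Q] (f : P →ₗ[A] X) (g : Q →ₗ[A] X) (hf : Function.Surjective f)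
    (hg : Function.Surjective g) (hf' : IsSuperfluous (LinearMap.ker f))
    (hg' : IsSuperfluous (LinearMap.ker g)) : ∃ φ : P ≃ₗ[A] Q, ∀ x, g (φ x) = f x := by
  obtain ⟨φ, hφ⟩ := Module.projective_lifting_property g f hg
  have hφ' : ∀ x, g (φ x) = f x := fun x => LinearMap.congr_fun hφ x
  have hsurj : Function.Surjective φ := by
    rw [← LinearMap.range_eq_top]
    refine hg' _ (eq_top_iff.2 fun y _ => ?_)
    obtain ⟨x, hx⟩ := hf (g y)
    rw [← sub_add_cancel y (φ x), add_comm]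
    refine Submodule.add_mem_sup ⟨x, rfl⟩ ?_
    rw [LinearMap.mem_ker, map_sub, hφ', hx, sub_self]
  obtain ⟨s, hs⟩ := φ.exists_rightInverse_of_surjective (LinearMap.range_eq_top.2 hsurj)
  have hs' : ∀ y, φ (s y) = y := fun y => LinearMap.congr_fun hs y
  have hssurj : Function.Surjective s := by
    rw [← LinearMap.range_eq_top]
    refine hf' _ (eq_top_iff.2 fun x _ => ?_)
    rw [← sub_add_cancel x (s (φ x)), add_comm]
    refine Submodule.add_mem_sup ⟨φ x, rfl⟩ ?_
    rw [LinearMap.mem_ker, map_sub, ← hφ', ← hφ', hs', sub_self]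
  refine ⟨LinearEquiv.ofBijective φ ⟨fun x y hxy => ?_, hsurj⟩, hφ'⟩
  obtain ⟨x, rfl⟩ := hssurj x
  obtain ⟨y, rfl⟩ := hssurj y
  rw [hs', hs'] at hxy
  rw [hxy]

/-- Minimal projective presentations of isomorphic modules are isomorphic. -/
theorem complexIso_of_equiv {P₀ P₁ M Q₀ Q₁ N : Type u}
    [AddCommGroup P₀] [Module A P₀] [AddCommGroup P₁] [Module A P₁] [AddCommGroup M] [Module A M]
    [AddCommGroup Q₀] [Module A Q₀] [AddCommGroup Q₁] [Module A Q₁] [AddCommGroup N] [Module A N]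
    {d : P₀ →ₗ[A] P₁} {π : P₁ →ₗ[A] M} {d' : Q₀ →ₗ[A] Q₁} {π' : Q₁ →ₗ[A] N}
    (h : IsMinimalProjectivePresentation d π) (h' : IsMinimalProjectivePresentation d' π')
    (θ : M ≃ₗ[A] N) : ComplexIso d d' := by
  have := h.projective₀
  have := h.projective₁
  have := h'.projective₀
  have := h'.projective₁
  obtain ⟨φ₁, hφ₁⟩ := exists_equiv_of_projective_covers (θ.toLinearMap.comp π) π'
    (θ.surjective.comp h.surjective) h'.surjective
    (h.minimal₁.mono (le_of_eq (LinearEquiv.ker_comp θ π))) h'.minimal₁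
  have hφ₁' : ∀ x, π' (φ₁ x) = θ (π x) := hφ₁
  let f : P₀ →ₗ[A] LinearMap.ker π' :=
    (φ₁.toLinearMap.comp d).codRestrict _ fun x => by
      change π' (φ₁ (d x)) = 0
      rw [hφ₁', h.exact.apply_apply_eq_zero, map_zero]
  let g : Q₀ →ₗ[A] LinearMap.ker π' :=
    d'.codRestrict _ fun x => h'.exact.apply_apply_eq_zero x
  have hf : Function.Surjective f := by
    rintro ⟨y, hy⟩
    have h1 : π (φ₁.symm y) = 0 := by
      apply θ.injective
      rw [← hφ₁', LinearEquiv.apply_symm_apply, map_zero]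
      exact hy
    obtain ⟨x, hx⟩ := (h.exact _).1 h1
    refine ⟨x, Subtype.ext ?_⟩
    change φ₁ (d x) = y
    rw [hx, LinearEquiv.apply_symm_apply]
  have hg : Function.Surjective g := by
    rintro ⟨y, hy⟩
    obtain ⟨x, hx⟩ := (h'.exact _).1 hy
    exact ⟨x, Subtype.ext hx⟩
  have hkf : LinearMap.ker f ≤ LinearMap.ker d := by
    intro x hx
    have : φ₁ (d x) = 0 := congrArg Subtype.val hx
    rwa [LinearEquiv.map_eq_zero_iff] at this
  have hkg : LinearMap.ker g ≤ LinearMap.ker d' := fun x hx => congrArg Subtype.val hx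
  obtain ⟨φ₀, hφ₀⟩ := exists_equiv_of_projective_covers f g hf hg (h.minimal₀.mono hkf)
    (h'.minimal₀.mono hkg)
  exact ⟨φ₀, φ₁, fun x => (congrArg Subtype.val (hφ₀ x)).symm⟩

/-- A nonzero retract of an indecomposable module is the whole module. -/
theorem bijective_of_retract {M : Type v} {N : Type w} [AddCommGroup M] [Module A M]
    [AddCommGroup N] [Module A N] (hM : IsIndecomposableModule A M) [Nontrivial N]
    (f : N →ₗ[A] M) (g : M →ₗ[A] N) (h : ∀ x, g (f x) = x) : Function.Bijective f := by
  have hinj : Function.Injective f := fun x y hxy => by rw [← h x, hxy, h]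
  refine ⟨hinj, ?_⟩
  have hc : IsCompl (LinearMap.range f) (LinearMap.ker g) := by
    constructor
    · rw [Submodule.disjoint_def]
      rintro _ ⟨x, rfl⟩ hx
      rw [LinearMap.mem_ker, h] at hx
      rw [hx, map_zero]
    · rw [codisjoint_iff, eq_top_iff]
      intro y _
      rw [← sub_add_cancel y (f (g y)), add_comm]
      refine Submodule.add_mem_sup ⟨_, rfl⟩ ?_
      rw [LinearMap.mem_ker, map_sub, h, sub_self]
  rcases hM.2 _ _ hc with h0 | h0
  · obtain ⟨x, hx⟩ := exists_ne (0 : N)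
    exfalso
    apply hx
    apply hinj
    rw [map_zero, ← Submodule.mem_bot A, ← h0]
    exact ⟨x, rfl⟩
  · have := hc.sup_eq_top
    rw [h0, sup_bot_eq] at this
    exact LinearMap.range_eq_top.1 this

end Modules

namespace BrauerTree

variable {V : Type v} [Finite V] {Γ : BrauerTree V} {K : Type u} [Field K]

/-! ### The radical -/

variable (Γ K) in
/-- The radical of a module over a Brauer tree algebra: the submodule generated by the multiples
of arrows. -/
noncomputable def radical (M : Type w) [AddCommGroup M] [Module (Γ.Alg K) M] : Submodule (Γ.Alg K) M :=
  Submodule.span (Γ.Alg K) {x | ∃ a y, x = Γ.arr K a • y}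

theorem arc_mul_arc_eq_zero_or (a b : Γ.Arrow) (k l : ℕ) :
    arc K a k * arc K b l = 0 ∨ ∃ c, arc K a k * arc K b l = arc K c (k + l) := by
  rcases Nat.eq_zero_or_pos k with rfl | hk
  · rw [arc_zero]
    by_cases h : Γ.src a = Γ.src b
    · exact Or.inr ⟨b, by rw [h, e_mul_arc, zero_add]⟩
    · exact Or.inl (e_mul_arc_of_ne h l)
  · rcases Nat.eq_zero_or_pos l with rfl | hl
    · rw [arc_zero]
      by_cases h : Γ.src (Γ.next^[k] a) = Γ.src b
      · exact Or.inr ⟨a, by rw [← h, arc_mul_e, add_zero]⟩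
      · exact Or.inl (arc_mul_e_of_ne h)
    · by_cases h : Γ.next^[k] a = b
      · exact Or.inr ⟨a, arc_mul_arc l h⟩
      · exact Or.inl (arc_mul_arc_of_ne hk hl h)

section Radical

variable {M : Type w} [AddCommGroup M] [Module (Γ.Alg K) M]

theorem arr_smul_mem_radical (a : Γ.Arrow) (x : M) : Γ.arr K a • x ∈ radical Γ K M :=
  Submodule.subset_span ⟨a, x, rfl⟩

theorem arc_smul_mem_radical (a : Γ.Arrow) {l : ℕ} (hl : 0 < l) (x : M) :
    arc K a l • x ∈ radical Γ K M := by
  obtain ⟨l, rfl⟩ := Nat.exists_eq_succ_of_ne_zero hl.ne'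
  rw [Nat.succ_eq_add_one, ← arr_mul_arc_next, mul_smul]
  exact arr_smul_mem_radical _ _

theorem map_mem_radical {N : Type*} [AddCommGroup N] [Module (Γ.Alg K) N]
    (f : M →ₗ[Γ.Alg K] N) {x : M} (hx : x ∈ radical Γ K M) : f x ∈ radical Γ K N := by
  induction hx using Submodule.span_induction with
  | mem x hx => obtain ⟨a, y, rfl⟩ := hx; rw [map_smul]; exact arr_smul_mem_radical _ _
  | zero => rw [map_zero]; exact Submodule.zero_mem _
  | add x y _ _ hx hy => rw [map_add]; exact Submodule.add_mem _ hx hy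
  | smul r x _ hx => rw [map_smul]; exact Submodule.smul_mem _ _ hx

theorem algebraMap_smul_mul_smul (r : K) (x : Γ.Alg K) (m : M) :
    (r • x) • m = algebraMap K (Γ.Alg K) r • x • m := by
  rw [Algebra.smul_def, mul_smul]

/-- Nakayama's lemma. -/
theorem isSuperfluous_radical : IsSuperfluous (radical Γ K M) := by
  intro L hL
  obtain ⟨B, hB⟩ : ∃ B, ∀ a : Γ.Arrow, per a ≤ B := by
    obtain ⟨B, hB⟩ := (Set.finite_range (per : Γ.Arrow → ℕ)).bddAbove
    exact ⟨B, fun a => hB ⟨a, rfl⟩⟩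
  have key : ∀ n l, B < l + n → ∀ (a : Γ.Arrow) (x : M), arc K a l • x ∈ L := by
    intro n
    induction n with
    | zero =>
      intro l hl a x
      rw [arc_eq_zero (show per a < l from lt_of_le_of_lt (hB a) hl), zero_smul]
      exact L.zero_mem
    | succ n ih =>
      intro l hl a x
      have hx : x ∈ L ⊔ radical Γ K M := by rw [hL]; trivial
      obtain ⟨y, hy, z, hz, rfl⟩ := Submodule.mem_sup.1 hx
      rw [smul_add]
      refine L.add_mem (L.smul_mem _ hy) ?_
      clear hx hy
      refine Submodule.span_induction ?_ ?_ ?_ ?_ hz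
        (p := fun z _ => ∀ c : Γ.Alg K, (arc K a l * c) • z ∈ L) (1 : Γ.Alg K)
        |> fun h => by simpa using h
      · rintro _ ⟨b, z, rfl⟩ c
        rw [← mul_smul]
        induction c using arc_induction with
        | arcs c k =>
          rcases arc_mul_arc_eq_zero_or (K := K) a c l k with h | ⟨c', h⟩
          · rw [h, zero_mul, zero_smul]; exact L.zero_mem
          · rw [h, ← arc_one b]
            rcases arc_mul_arc_eq_zero_or (K := K) c' b (l + k) 1 with h | ⟨c'', h⟩
            · rw [h, zero_smul]; exact L.zero_mem
            · rw [h]; exact ih _ (by omega) _ _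
        | zero => rw [mul_zero, zero_mul, zero_smul]; exact L.zero_mem
        | add x y hx hy => rw [mul_add, add_mul, add_smul]; exact L.add_mem hx hy
        | smul r x hx =>
          rw [mul_smul_comm, smul_mul_assoc, algebraMap_smul_mul_smul]; exact L.smul_mem _ hx
      · intro c; rw [smul_zero]; exact L.zero_mem
      · intro x y _ _ hx hy c; rw [smul_add]; exact L.add_mem (hx c) (hy c)
      · intro r x _ hx c; rw [← mul_smul, mul_assoc]; exact hx _
  rw [eq_top_iff]
  intro x _
  rw [← one_smul (Γ.Alg K) x, ← sum_e, Finset.sum_smul]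
  refine L.sum_mem fun i _ => ?_
  obtain ⟨a, rfl⟩ := exists_src_eq i
  rw [← arc_zero]
  exact key (B + 1) 0 (by omega) a x

theorem exists_smul_sub_mem_radical {i : Γ.Edge} {x : M} (hx : Γ.e K i • x = x) (y : Γ.Alg K) :
    ∃ r : K, y • x - algebraMap K (Γ.Alg K) r • x ∈ radical Γ K M := by
  induction y using arc_induction with
  | arcs a l =>
    rcases Nat.eq_zero_or_pos l with rfl | hl
    · by_cases h : Γ.src a = i
      · exact ⟨1, by rw [arc_zero, h, hx]; simp⟩
      · refine ⟨0, ?_⟩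
        rw [arc_zero, ← hx, ← mul_smul, e_mul_e_of_ne h]
        simp
    · exact ⟨0, by simpa using arc_smul_mem_radical a hl x⟩
  | zero => exact ⟨0, by simp⟩
  | add y z hy hz =>
    obtain ⟨r, hr⟩ := hy
    obtain ⟨s, hs⟩ := hz
    refine ⟨r + s, ?_⟩
    convert Submodule.add_mem _ hr hs using 1
    rw [map_add, add_smul, add_smul]
    abel
  | smul c y hy =>
    obtain ⟨r, hr⟩ := hy
    refine ⟨c * r, ?_⟩
    convert Submodule.smul_mem _ (algebraMap K (Γ.Alg K) c) hr using 1
    rw [map_mul, mul_smul, smul_sub, algebraMap_smul_mul_smul]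

theorem arc_per_smul_radical (a : Γ.Arrow) {x : M} (hx : x ∈ radical Γ K M) :
    arc K a (per a) • x = 0 := by
  have key : ∀ y : Γ.Alg K, (arc K a (per a) * y) • x = 0 := by
    induction hx using Submodule.span_induction with
    | mem x hx =>
      obtain ⟨b, z, rfl⟩ := hx
      intro y
      obtain ⟨r, hr⟩ := exists_arc_per_mul a y
      rw [hr, ← mul_smul, smul_mul_assoc, arc_per_mul_arr, smul_zero, zero_smul]
    | zero => intro y; rw [smul_zero]
    | add x y _ _ hx hy => intro z; rw [smul_add, hx, hy, add_zero]
    | smul r x _ hx => intro y; rw [← mul_smul, mul_assoc]; exact hx _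
  simpa using key 1

variable (Γ K) in
/-- Elements killed by all arrows form a submodule. -/
noncomputable def arrowKernel (M : Type w) [AddCommGroup M] [Module (Γ.Alg K) M] :
    Submodule (Γ.Alg K) M where
  carrier := {x | ∀ (a : Γ.Arrow) (y : Γ.Alg K), Γ.arr K a • y • x = 0}
  zero_mem' := by intro a y; rw [smul_zero, smul_zero]
  add_mem' := by intro x z hx hz a y; rw [smul_add, smul_add, hx, hz, add_zero]
  smul_mem' := by intro c x hx a y; rw [← mul_smul y]; exact hx a _

theorem moduleSocle_le_arrowKernel : moduleSocle (Γ.Alg K) M ≤ arrowKernel Γ K M := by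
  refine sSup_le fun S hS => ?_
  have hS : IsSimpleModule (Γ.Alg K) S := hS
  have h0 : radical Γ K S = ⊥ := by
    rcases eq_bot_or_eq_top (radical Γ K S) with h | h
    · exact h
    · have := isSuperfluous_radical (M := S) ⊥ (by rw [h, bot_sup_eq])
      exact absurd this bot_ne_top
  intro x hx a y
  have h1 := arr_smul_mem_radical (K := K) a (y • (⟨x, hx⟩ : S))
  rw [h0, Submodule.mem_bot] at h1
  exact congrArg Subtype.val h1

end Radical

theorem mem_radical_of_arr_mul_eq_zero {c : Γ.Alg K} (hc : ∀ a, Γ.arr K a * c = 0) :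
    c ∈ radical Γ K (Γ.Alg K) := by
  have h1 : ∀ i : Γ.Edge, c * Γ.e K i ∈ radical Γ K (Γ.Alg K) := by
    intro i
    obtain ⟨a, rfl⟩ := exists_src_eq i
    obtain ⟨r, hr⟩ := exists_smul_sub_mem_radical (K := K) (i := Γ.src a)
      (x := Γ.e K (Γ.src a)) (e_mul_self _) c
    have h2 := arc_per_smul_radical a hr
    obtain ⟨n, hn⟩ := Nat.exists_eq_succ_of_ne_zero (per_pos a).ne'
    have h3 : arc K a (per a) * c = 0 := by
      rw [hn, Nat.succ_eq_add_one, arc_succ, mul_assoc, hc, mul_zero]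
    rw [smul_eq_mul, smul_eq_mul, smul_eq_mul, mul_sub, ← mul_assoc, h3, zero_mul, zero_sub,
      neg_eq_zero, ← Algebra.smul_def, mul_smul_comm, arc_per_mul_e] at h2
    have h4 : r = 0 := (smul_eq_zero.1 h2).resolve_right (arc_per_ne_zero a)
    rw [h4, map_zero, zero_smul, sub_zero] at hr
    exact hr
  rw [← mul_one c, ← sum_e, Finset.mul_sum]
  exact Submodule.sum_mem _ fun i _ => h1 i

/-- A nonzero projective module is not killed by all arrows. -/
theorem eq_zero_of_projective {P : Type w} [AddCommGroup P] [Module (Γ.Alg K) P]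
    [Module.Projective (Γ.Alg K) P] (h : ∀ (a : Γ.Arrow) (x : P), Γ.arr K a • x = 0) (x : P) :
    x = 0 := by
  obtain ⟨s, hs⟩ := (Module.projective_def' (R := Γ.Alg K) (P := P)).1 inferInstance
  have hrad : ∀ y ∈ radical Γ K P, y = 0 := by
    intro y hy
    induction hy using Submodule.span_induction with
    | mem x hx => obtain ⟨a, z, rfl⟩ := hx; exact h a z
    | zero => rfl
    | add x y _ _ hx hy => rw [hx, hy, add_zero]
    | smul r x _ hx => rw [hx, smul_zero]
  have h1 : ∀ p, s x p • p = 0 := by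
    intro p
    apply hrad
    refine map_mem_radical (LinearMap.toSpanSingleton (Γ.Alg K) P p)
      (mem_radical_of_arr_mul_eq_zero fun a => ?_)
    have := congrArg (fun f => f p) (map_smul s (Γ.arr K a) x)
    rw [h, map_zero] at this
    exact this.symm
  have h2 : Finsupp.linearCombination (Γ.Alg K) id (s x) = x := LinearMap.congr_fun hs x
  rw [← h2, Finsupp.linearCombination_apply, Finsupp.sum]
  exact Finset.sum_eq_zero fun p _ => h1 p

/-- The socle of an indecomposable projective module is superfluous. -/
theorem isSuperfluous_moduleSocle {P : Type w} [AddCommGroup P] [Module (Γ.Alg K) P]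
    [Module.Projective (Γ.Alg K) P] (hP : IsIndecomposableModule (Γ.Alg K) P) :
    IsSuperfluous (moduleSocle (Γ.Alg K) P) := by
  intro L hL
  have hss : IsSemisimpleModule (Γ.Alg K) (moduleSocle (Γ.Alg K) P) := by
    unfold moduleSocle
    rw [sSup_eq_iSup]
    exact isSemisimpleModule_biSup_of_isSemisimpleModule_submodule fun S (hS : IsSimpleModule _ S) =>
      inferInstance
  set S := moduleSocle (Γ.Alg K) P with hSdef
  obtain ⟨C, hC⟩ := exists_isCompl ((L ⊓ S).comap S.subtype)
  have hcompl : IsCompl L (C.map S.subtype) := by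
    constructor
    · rw [Submodule.disjoint_def]
      rintro _ hx ⟨y, hy, rfl⟩
      have : y ∈ (L ⊓ S).comap S.subtype := ⟨hx, y.2⟩
      have := (Submodule.disjoint_def.1 hC.disjoint) y this hy
      rw [this, map_zero]
    · rw [codisjoint_iff, eq_top_iff, ← hL]
      refine sup_le le_sup_left fun x hx => ?_
      have h1 : (⟨x, hx⟩ : S) ∈ (L ⊓ S).comap S.subtype ⊔ C := by rw [hC.sup_eq_top]; trivial
      obtain ⟨y, hy, z, hz, h2⟩ := Submodule.mem_sup.1 h1
      have h3 : x = y + z := (congrArg Subtype.val h2).symm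
      rw [h3]
      exact Submodule.add_mem_sup hy.1 ⟨z, hz, rfl⟩
  rcases hP.2 _ _ hcompl with h | h
  · exfalso
    have hS : S = ⊤ := by rw [← hL, h, bot_sup_eq]
    obtain ⟨hnt, -⟩ := hP
    obtain ⟨x, hx⟩ := exists_ne (0 : P)
    apply hx
    refine eq_zero_of_projective (Γ := Γ) (K := K) (fun a y => ?_) x
    have : y ∈ S := by rw [hS]; trivial
    simpa using moduleSocle_le_arrowKernel this a 1
  · have := hcompl.sup_eq_top
    rwa [h, sup_bot_eq] at this

/-- A `K`-linear map that commutes with idempotents and arrows is linear over the algebra. -/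
theorem map_smul_of_commutes {M N : Type*} [AddCommGroup M] [Module (Γ.Alg K) M] [Module K M]
    [IsScalarTower K (Γ.Alg K) M] [AddCommGroup N] [Module (Γ.Alg K) N] [Module K N]
    [IsScalarTower K (Γ.Alg K) N] (g : M →ₗ[K] N)
    (he : ∀ i m, g (Γ.e K i • m) = Γ.e K i • g m)
    (ha : ∀ a m, g (Γ.arr K a • m) = Γ.arr K a • g m) (x : Γ.Alg K) (m : M) :
    g (x • m) = x • g m := by
  induction x using alg_induction generalizing m with
  | scalar r => rw [algebraMap_smul, algebraMap_smul, map_smul]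
  | idem i => exact he i m
  | arrow a => exact ha a m
  | add x y hx hy => rw [add_smul, add_smul, map_add, hx, hy]
  | mul x y hx hy => rw [mul_smul, mul_smul, hx, hy]

end BrauerTree

namespace BrauerTree

variable {V : Type v} [Finite V] {Γ : BrauerTree V} {K : Type u} [Field K]

/-! ### Sums of indecomposable projective modules -/

theorem mem_proj_iff {i : Γ.Edge} {x : Γ.Alg K} : x ∈ Γ.proj K i ↔ x * Γ.e K i = x := by
  rw [proj, Submodule.mem_span_singleton]
  constructor
  · rintro ⟨y, rfl⟩
    rw [smul_eq_mul, mul_assoc, e_mul_self]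
  · intro h
    exact ⟨x, h⟩

instance finite_proj (i : Γ.Edge) : Module.Finite (Γ.Alg K) (Γ.proj K i) :=
  Module.Finite.span_singleton _ _

instance projective_proj (i : Γ.Edge) : Module.Projective (Γ.Alg K) (Γ.proj K i) := by
  refine Module.Projective.of_split (Γ.proj K i).subtype
    ((LinearMap.toSpanSingleton (Γ.Alg K) (Γ.Alg K) (Γ.e K i)).codRestrict _ fun x =>
      Submodule.smul_mem _ _ (Submodule.mem_span_singleton_self _)) ?_
  ext x
  exact mem_proj_iff.1 x.2

section ProjSum

variable {s : Γ.Edge → Prop}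

instance finite_projSum : Module.Finite (Γ.Alg K) ((i : {i // s i}) → Γ.proj K i.1) :=
  Module.Finite.pi

instance projective_projSum :
    Module.Projective (Γ.Alg K) ((i : {i // s i}) → Γ.proj K i.1) := by
  classical
  have := Fintype.ofFinite {i // s i}
  exact Module.Projective.of_equiv
    (DFinsupp.linearEquivFunOnFintype (R := Γ.Alg K) (M := fun i : {i // s i} => Γ.proj K i.1))

open Classical in
variable (K) in
/-- The generator `e_i` of the summand `A e_i`. -/
noncomputable def gen (i : {i // s i}) : (i : {i // s i}) → Γ.proj K i.1 :=
  Pi.single i ⟨Γ.e K i.1, Submodule.mem_span_singleton_self _⟩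

theorem gen_self (i : {i // s i}) : (gen K i i : Γ.Alg K) = Γ.e K i.1 := by
  classical
  rw [gen, Pi.single_eq_same]

theorem gen_of_ne {i j : {i // s i}} (h : j ≠ i) : (gen K i j : Γ.Alg K) = 0 := by
  classical
  rw [gen, Pi.single_eq_of_ne h]
  rfl

theorem e_smul_gen (i : {i // s i}) : Γ.e K i.1 • gen K i = gen K i := by
  funext j
  apply Subtype.ext
  by_cases h : j = i
  · subst h
    exact (congrArg _ (gen_self j)).trans ((e_mul_self _).trans (gen_self j).symm)
  · exact (congrArg _ (gen_of_ne h)).trans ((mul_zero _).trans (gen_of_ne h).symm)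

theorem smul_gen_self (i : {i // s i}) (c : Γ.Alg K) :
    ((c • gen K i) i : Γ.Alg K) = c * Γ.e K i.1 :=
  congrArg (c * ·) (gen_self i)

theorem smul_gen_of_ne {i j : {i // s i}} (h : j ≠ i) (c : Γ.Alg K) :
    ((c • gen K i) j : Γ.Alg K) = 0 :=
  (congrArg (c * ·) (gen_of_ne h)).trans (mul_zero c)

theorem eq_sum_gen [Fintype {i // s i}] (x : (i : {i // s i}) → Γ.proj K i.1) :
    x = ∑ i, (x i : Γ.Alg K) • gen K i := by
  classical
  funext j
  apply Subtype.ext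
  rw [Finset.sum_apply, AddSubmonoidClass.coe_finsetSum, Finset.sum_eq_single j]
  · rw [smul_gen_self, mem_proj_iff.1 (x j).2]
  · intro i _ h
    exact smul_gen_of_ne (Ne.symm h) _
  · intro h
    exact absurd (Finset.mem_univ _) h

theorem arc_per_smul_gen_ne_zero {i : {i // s i}} {a : Γ.Arrow} (h : Γ.src a = i.1) :
    arc K a (per a) • gen K i ≠ 0 := by
  intro h0
  have h1 : ((arc K a (per a) • gen K i) i : Γ.Alg K) = 0 := by rw [h0]; rfl
  rw [smul_gen_self, ← h, arc_per_mul_e] at h1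
  exact arc_per_ne_zero a h1

theorem gen_ne_zero (i : {i // s i}) : gen K i ≠ 0 := by
  obtain ⟨a, ha⟩ := exists_src_eq i.1
  intro h0
  exact arc_per_smul_gen_ne_zero (K := K) ha (by rw [h0, smul_zero])

/-- The summands are detected by the socle elements. -/
theorem exists_arc_per_smul_ne_zero_iff (a : Γ.Arrow) :
    (∃ x : (i : {i // s i}) → Γ.proj K i.1, arc K a (per a) • x ≠ 0) ↔ s (Γ.src a) := by
  constructor
  · rintro ⟨x, hx⟩
    obtain ⟨i, hi⟩ := Function.ne_iff.1 hx
    have hi : arc K a (per a) * (x i : Γ.Alg K) ≠ 0 := fun h => hi (Subtype.ext h)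
    obtain ⟨r, hr⟩ := exists_arc_per_mul a (x i : Γ.Alg K)
    rw [← mem_proj_iff.1 (x i).2, ← mul_assoc, hr, smul_mul_assoc] at hi
    by_contra h
    have hne : Γ.src a ≠ i.1 := fun h' => h (h' ▸ i.2)
    rw [← arc_per_mul_e, mul_assoc, e_mul_e_of_ne hne, mul_zero, smul_zero] at hi
    exact hi rfl
  · intro h
    exact ⟨gen K ⟨Γ.src a, h⟩, arc_per_smul_gen_ne_zero rfl⟩

/-- Maps out of a sum of projective modules are given by the images of the generators. -/
theorem exists_map_gen {X : Type*} [AddCommGroup X] [Module (Γ.Alg K) X] (μ : {i // s i} → X)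
    (h : ∀ i : {i // s i}, Γ.e K i.1 • μ i = μ i) :
    ∃ f : ((i : {i // s i}) → Γ.proj K i.1) →ₗ[Γ.Alg K] X, ∀ i, f (gen K i) = μ i := by
  classical
  have := Fintype.ofFinite {i // s i}
  refine ⟨∑ i, (LinearMap.toSpanSingleton (Γ.Alg K) X (μ i)).comp
    ((Γ.proj K i.1).subtype.comp (LinearMap.proj i)), fun i => ?_⟩
  rw [LinearMap.sum_apply, Finset.sum_eq_single i]
  · change (gen K i i : Γ.Alg K) • μ i = _
    rw [gen_self, h]
  · intro j _ hj
    change (gen K i j : Γ.Alg K) • μ j = _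
    rw [gen_of_ne hj, zero_smul]
  · intro h
    exact absurd (Finset.mem_univ _) h

end ProjSum

theorem mem_radical_of_arc_per_mul_eq_zero {a : Γ.Arrow} {x : Γ.Alg K}
    (hx : x * Γ.e K (Γ.src a) = x) (h : arc K a (per a) * x = 0) :
    x ∈ radical Γ K (Γ.Alg K) := by
  obtain ⟨r, hr⟩ := exists_smul_sub_mem_radical (K := K) (i := Γ.src a)
    (x := Γ.e K (Γ.src a)) (e_mul_self _) x
  have h2 := arc_per_smul_radical a hr
  rw [smul_eq_mul, smul_eq_mul, smul_eq_mul, mul_sub, hx, h, zero_sub,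
    neg_eq_zero, ← Algebra.smul_def, mul_smul_comm, arc_per_mul_e] at h2
  have h4 : r = 0 := (smul_eq_zero.1 h2).resolve_right (arc_per_ne_zero a)
  rw [h4, map_zero, zero_smul, sub_zero, smul_eq_mul, hx] at hr
  exact hr

/-! ### Solutions of the relations of a zigzag -/

section Solution

variable {Λ : Set (Γ.Arrow × Γ.Arrow)} {X : Type*} [AddCommGroup X] [Module (Γ.Alg K) X]

open Classical in
/-- The contribution of the link that starts with the dart `σ`. -/
noncomputable def linkValue (Λ : Set (Γ.Arrow × Γ.Arrow)) (μ : Γ.Edge → X) (σ : Γ.Arrow) : X :=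
  if h : ∃ τ, (σ, τ) ∈ Λ then arc K σ (steps σ h.choose) • μ (Γ.src h.choose) else 0

theorem linkValue_of_mem (hΛ : IsZigzag Λ) (μ : Γ.Edge → X) {σ τ : Γ.Arrow} (h : (σ, τ) ∈ Λ) :
    linkValue (K := K) Λ μ σ = arc K σ (steps σ τ) • μ (Γ.src τ) := by
  have h' : ∃ τ, (σ, τ) ∈ Λ := ⟨τ, h⟩
  rw [linkValue, dif_pos h', ← hΛ.mem_of_eq h h'.choose_spec]

theorem linkValue_of_notMem (μ : Γ.Edge → X) {σ : Γ.Arrow} (h : ∀ τ, (σ, τ) ∉ Λ) :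
    linkValue (K := K) Λ μ σ = 0 := by
  rw [linkValue, dif_neg]
  rintro ⟨τ, hτ⟩
  exact h τ hτ

variable (K) in
/-- Elements of a module, one for each sink of a zigzag, which satisfy the relations given by the
sources of the zigzag. -/
structure IsSolution (Λ : Set (Γ.Arrow × Γ.Arrow)) (μ : Γ.Edge → X) : Prop where
  e_smul : ∀ {σ τ}, (σ, τ) ∈ Λ → Γ.e K (Γ.src τ) • μ (Γ.src τ) = μ (Γ.src τ)
  rel : ∀ {σ τ}, (σ, τ) ∈ Λ →
    linkValue (K := K) Λ μ σ + linkValue (K := K) Λ μ σ.symm = 0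

theorem sum_coefficient_smul (hΛ : IsZigzag Λ) {Θ : Γ.AdmissiblePath K}
    (hΘ : Θ.arrows = runArrows Λ) [Fintype {j // Θ.IsSink j}] (μ : Γ.Edge → X) {σ : Γ.Arrow}
    (hσ : Θ.IsSource (Γ.src σ)) :
    ∑ j : {j // Θ.IsSink j}, Θ.coefficient (Γ.src σ) j.1 • μ j.1
      = linkValue (K := K) Λ μ σ + linkValue (K := K) Λ μ σ.symm := by
  classical
  let c : Γ.Arrow → Γ.Edge → Γ.Alg K := fun σ j =>
    if h : ∃ τ, (σ, τ) ∈ Λ ∧ Γ.src τ = j then arc K σ (steps σ h.choose) else 0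
  have hc1 : ∀ {σ τ}, (σ, τ) ∈ Λ → c σ (Γ.src τ) = arc K σ (steps σ τ) := by
    intro σ τ h
    have h' : ∃ τ', (σ, τ') ∈ Λ ∧ Γ.src τ' = Γ.src τ := ⟨τ, h, rfl⟩
    have hd : c σ (Γ.src τ) = arc K σ (steps σ h'.choose) := dif_pos h'
    rw [hd, ← hΛ.mem_of_eq h h'.choose_spec.1]
  have hc2 : ∀ {σ j}, (∀ τ, (σ, τ) ∈ Λ → Γ.src τ ≠ j) → c σ j = 0 := by
    intro σ j h
    exact dif_neg (fun ⟨τ, h1, h2⟩ => h τ h1 h2)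
  have hc3 : ∀ j : {j // Θ.IsSink j}, Θ.coefficient (Γ.src σ) j.1 = c σ j.1 + c σ.symm j.1 := by
    rintro ⟨j, hj⟩
    by_cases h : ∃ σ' τ, (σ', τ) ∈ Λ ∧ Γ.src σ' = Γ.src σ ∧ Γ.src τ = j
    · obtain ⟨σ', τ, h1, h2, rfl⟩ := h
      have key : c σ'.symm (Γ.src τ) = 0 := by
        refine hc2 fun τ' h' h'' => ?_
        exact σ'.symm_ne ((hΛ.eq_of_src_eq h1 h' (src_symm _).symm h''.symm).1).symm
      rw [← h2, hΛ.coefficient_of_mem hΘ h1, ← hc1 h1]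
      rcases src_eq_src_iff.1 h2 with rfl | rfl
      · rw [key, add_zero]
      · rw [SimpleGraph.Dart.symm_symm] at key
        rw [key, zero_add]
    · rw [hΛ.coefficient_eq_zero hΘ hσ hj fun σ' τ h1 h2 h3 => h ⟨σ', τ, h1, h2, h3⟩,
        hc2 fun τ h1 h2 => h ⟨σ, τ, h1, rfl, h2⟩,
        hc2 fun τ h1 h2 => h ⟨σ.symm, τ, h1, src_symm _, h2⟩, add_zero]
  have hc4 : ∀ σ, ∑ j : {j // Θ.IsSink j}, c σ j.1 • μ j.1 = linkValue (K := K) Λ μ σ := by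
    intro σ
    by_cases h : ∃ τ, (σ, τ) ∈ Λ
    · obtain ⟨τ, h⟩ := h
      rw [linkValue_of_mem hΛ μ h,
        Finset.sum_eq_single ⟨Γ.src τ, (hΛ.isSink_iff hΘ).2 ⟨σ, τ, h, rfl⟩⟩, hc1 h]
      · rintro ⟨j, hj⟩ _ hne
        rw [hc2, zero_smul]
        rintro τ' h' rfl
        exact hne (Subtype.ext (congrArg Γ.src (hΛ.mem_of_eq h h').symm))
      · intro h
        exact absurd (Finset.mem_univ _) h
    · have h : ∀ τ, (σ, τ) ∉ Λ := fun τ hτ => h ⟨τ, hτ⟩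
      rw [linkValue_of_notMem μ h]
      refine Finset.sum_eq_zero fun j _ => ?_
      rw [hc2 fun τ hτ => absurd hτ (h τ), zero_smul]
  rw [← hc4, ← hc4, ← Finset.sum_add_distrib]
  refine Finset.sum_congr rfl fun j _ => ?_
  rw [hc3, add_smul]

end Solution

end BrauerTree

namespace BrauerTree

variable {V : Type v} [Finite V] {Γ : BrauerTree V} {K : Type u} [Field K]

section Scalars

variable {M : Type*} [AddCommGroup M] [Module (Γ.Alg K) M]

theorem algebraMap_smul_comm (r : K) (x : Γ.Alg K) (m : M) :
    algebraMap K (Γ.Alg K) r • x • m = x • algebraMap K (Γ.Alg K) r • m := by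
  rw [← mul_smul, ← mul_smul, Algebra.commutes]

theorem algebraMap_smul_eq_zero {r : K} {m : M} (h : algebraMap K (Γ.Alg K) r • m = 0) :
    r = 0 ∨ m = 0 := by
  by_cases hr : r = 0
  · exact Or.inl hr
  · right
    rw [← one_smul (Γ.Alg K) m, ← map_one (algebraMap K _), ← inv_mul_cancel₀ hr, map_mul,
      mul_smul, h, smul_zero]

end Scalars

theorem arc_per_mul_arc (a b : Γ.Arrow) {l : ℕ} (hl : 0 < l) :
    arc K a (per a) * arc K b l = 0 := by
  obtain ⟨l, rfl⟩ := Nat.exists_eq_succ_of_ne_zero hl.ne'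
  rw [Nat.succ_eq_add_one, ← arr_mul_arc_next, ← mul_assoc, arc_per_mul_arr, zero_mul]

theorem iterate_per_sub_steps {σ τ : Γ.Arrow} (h : σ.fst = τ.fst) :
    Γ.next^[per τ - steps σ τ] τ = σ := by
  have h1 : steps σ τ ≤ per τ := per_eq_of_fst_eq h ▸ steps_le h
  have h2 : Γ.next^[per τ - steps σ τ] (Γ.next^[steps σ τ] σ) = σ := by
    rw [← Function.iterate_add_apply, Nat.sub_add_cancel h1, ← per_eq_of_fst_eq h, iterate_per]
  rwa [iterate_steps h] at h2

namespace IsSolution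

variable {Λ : Set (Γ.Arrow × Γ.Arrow)} {X : Type*} [AddCommGroup X] [Module (Γ.Alg K) X]
  {μ : Γ.Edge → X}

theorem arc_per_smul (hμ : IsSolution K Λ μ) (hΛ : IsZigzag Λ) {σ τ : Γ.Arrow}
    (h : (σ, τ) ∈ Λ) : arc K τ (per τ) • μ (Γ.src τ) = 0 := by
  have hf := hΛ.fst_eq h
  have h1 : steps σ τ < per τ := per_eq_of_fst_eq hf ▸ steps_lt hf (hΛ.ne h)
  have h2 : arc K τ (per τ) = arc K τ (per τ - steps σ τ) * arc K σ (steps σ τ) := by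
    rw [arc_mul_arc _ (iterate_per_sub_steps hf), Nat.sub_add_cancel h1.le]
  rw [h2, mul_smul, ← linkValue_of_mem hΛ μ h, eq_neg_of_add_eq_zero_left (hμ.rel h), smul_neg,
    neg_eq_zero]
  by_cases h' : ∃ τ', (σ.symm, τ') ∈ Λ
  · obtain ⟨τ', h'⟩ := h'
    rw [linkValue_of_mem hΛ μ h', ← mul_smul, arc_mul_arc_of_ne (by omega)
      (steps_pos (hΛ.fst_eq h')), zero_smul]
    rw [iterate_per_sub_steps hf]
    exact σ.symm_ne.symm
  · rw [linkValue_of_notMem μ fun τ' hτ' => h' ⟨τ', hτ'⟩, smul_zero]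

end IsSolution

/-! ### The cokernel of the complex of a path -/

namespace AdmissiblePath

variable (Θ : Γ.AdmissiblePath K)

noncomputable instance : Fintype {j : Γ.Edge // Θ.IsSink j} := Fintype.ofFinite _

theorem e_mul_coefficient (i j : Γ.Edge) : Γ.e K i * Θ.coefficient i j = Θ.coefficient i j :=
  finsum_mem_induction (s := {p | Θ.IsDirectedSubpath i p j}) (fun x => Γ.e K i * x = x)
    (mul_zero _) (fun x y hx hy => by rw [mul_add, hx, hy])
    (fun p _ => by rw [pathElement, ← mul_assoc, e_mul_self])

theorem differential_apply (x : Θ.Term₀) (j : {j // Θ.IsSink j}) :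
    (Θ.differential x j : Γ.Alg K) = ∑ i, (x i : Γ.Alg K) * Θ.coefficient i.1 j.1 := by
  change (((∑ i : {i : Γ.Edge // Θ.IsSource i},
    (Θ.component i.1 j.1).comp (LinearMap.proj i)) x : Γ.proj K j.1) : Γ.Alg K) = _
  rw [LinearMap.sum_apply, AddSubmonoidClass.coe_finsetSum]
  rfl

theorem differential_gen (i : {i // Θ.IsSource i}) :
    Θ.differential (gen K i) = ∑ j, Θ.coefficient i.1 j.1 • gen K j := by
  rw [eq_sum_gen (Θ.differential (gen K i))]
  refine Finset.sum_congr rfl fun j _ => ?_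
  rw [differential_apply, Finset.sum_eq_single i]
  · rw [gen_self, e_mul_coefficient]
  · intro k _ hk
    rw [gen_of_ne hk, zero_mul]
  · intro h
    exact absurd (Finset.mem_univ _) h

/-- The cokernel of the complex of a path. -/
abbrev Cokernel : Type (max u v) := Θ.Term₁ ⧸ LinearMap.range Θ.differential

open Classical in
/-- The generators of the cokernel. -/
noncomputable def cokernelGen (j : Γ.Edge) : Θ.Cokernel :=
  if h : Θ.IsSink j then Submodule.Quotient.mk (gen K ⟨j, h⟩) else 0

theorem cokernelGen_eq (j : {j // Θ.IsSink j}) :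
    Θ.cokernelGen j.1 = Submodule.Quotient.mk (gen K j) := dif_pos j.2

theorem exists_eq_sum_cokernelGen (x : Θ.Cokernel) :
    ∃ c : {j // Θ.IsSink j} → Γ.Alg K, x = ∑ j, (c j * Γ.e K j.1) • Θ.cokernelGen j.1 := by
  obtain ⟨y, rfl⟩ := Submodule.Quotient.mk_surjective _ x
  refine ⟨fun j => y j, ?_⟩
  conv_lhs => rw [eq_sum_gen y, ← Submodule.mkQ_apply, map_sum]
  refine Finset.sum_congr rfl fun j _ => ?_
  rw [mem_proj_iff.1 (y j).2, map_smul, cokernelGen_eq, Submodule.mkQ_apply]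

section Zigzag

variable {Θ} {Λ : Set (Γ.Arrow × Γ.Arrow)}

theorem coefficient_eq_zero_or (hΛ : IsZigzag Λ) (hΘ : Θ.arrows = runArrows Λ)
    (i : {i // Θ.IsSource i}) (j : {j // Θ.IsSink j}) :
    Θ.coefficient i.1 j.1 = 0 ∨ ∃ (σ : Γ.Arrow) (l : ℕ), 0 < l ∧
      Θ.coefficient i.1 j.1 = arc K σ l := by
  obtain ⟨i, hi⟩ := i
  obtain ⟨j, hj⟩ := j
  by_cases h : ∃ σ τ, (σ, τ) ∈ Λ ∧ Γ.src σ = i ∧ Γ.src τ = j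
  · obtain ⟨σ, τ, h, rfl, rfl⟩ := h
    exact Or.inr ⟨σ, steps σ τ, steps_pos (hΛ.fst_eq h), hΛ.coefficient_of_mem hΘ h⟩
  · exact Or.inl (hΛ.coefficient_eq_zero hΘ hi hj fun σ τ h1 h2 h3 => h ⟨σ, τ, h1, h2, h3⟩)

theorem range_differential_le (hΛ : IsZigzag Λ) (hΘ : Θ.arrows = runArrows Λ)
    : LinearMap.range Θ.differential ≤ radical Γ K Θ.Term₁ := by
  rintro _ ⟨x, rfl⟩
  rw [eq_sum_gen x, map_sum]
  refine Submodule.sum_mem _ fun i _ => ?_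
  rw [map_smul, differential_gen]
  refine Submodule.smul_mem _ _ (Submodule.sum_mem _ fun j _ => ?_)
  rcases coefficient_eq_zero_or hΛ hΘ i j with h | ⟨σ, l, hl, h⟩
  · rw [h, zero_smul]
    exact Submodule.zero_mem _
  · rw [h]
    exact arc_smul_mem_radical _ hl _

theorem exists_e_mul_differential (hΛ : IsZigzag Λ) (hΘ : Θ.arrows = runArrows Λ)
    (x : Θ.Term₀) {σ τ : Γ.Arrow} (h : (σ, τ) ∈ Λ) :
    ∃ r : K, (∀ j, Γ.e K (Γ.src σ) * (Θ.differential x j : Γ.Alg K)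
      = r • Θ.coefficient (Γ.src σ) j.1) ∧ ∀ hi : Θ.IsSource (Γ.src σ),
      arc K σ (per σ) * (x ⟨Γ.src σ, hi⟩ : Γ.Alg K) = r • arc K σ (per σ) := by
  have hi : Θ.IsSource (Γ.src σ) := (hΛ.isSource_iff hΘ).2 ⟨σ, τ, h, rfl⟩
  obtain ⟨r, s, hrs⟩ := exists_e_mul_mul_e_self σ (x ⟨Γ.src σ, hi⟩ : Γ.Alg K)
  have hx := mem_proj_iff.1 (x ⟨Γ.src σ, hi⟩).2
  rw [mul_assoc, hx] at hrs
  refine ⟨r, fun j => ?_, fun _ => ?_⟩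
  · rw [differential_apply, Finset.mul_sum, Finset.sum_eq_single ⟨Γ.src σ, hi⟩]
    · rw [← mul_assoc, hrs, add_mul, smul_mul_assoc, smul_mul_assoc, e_mul_coefficient]
      rcases coefficient_eq_zero_or hΛ hΘ ⟨Γ.src σ, hi⟩ j with h | ⟨σ', l, hl, h⟩
      · rw [show Θ.coefficient (Γ.src σ) j.1 = 0 from h, mul_zero, smul_zero, smul_zero, add_zero]
      · rw [show Θ.coefficient (Γ.src σ) j.1 = arc K σ' l from h, arc_per_mul_arc _ _ hl,
          smul_zero, add_zero]
    · intro i _ hne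
      obtain ⟨σ', τ', h', hi'⟩ := (hΛ.isSource_iff hΘ).1 i.2
      rw [← mul_assoc, ← mem_proj_iff.1 (x i).2, ← mul_assoc, e_mul_mul_e_eq_zero, zero_mul]
      intro y hy hy'
      rw [← hi'] at hy'
      exact hne (Subtype.ext (hi'.symm.trans (hΛ.source_eq h h' hy hy').symm))
    · intro h
      exact absurd (Finset.mem_univ _) h
  · rw [← arc_per_mul_e, mul_assoc, hrs, mul_add, mul_smul_comm, mul_smul_comm,
      arc_per_mul_arc _ _ (per_pos _), smul_zero, add_zero]

theorem ker_differential_le (hΛ : IsZigzag Λ) (hΘ : Θ.arrows = runArrows Λ)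
    : LinearMap.ker Θ.differential ≤ radical Γ K Θ.Term₀ := by
  intro x hx
  rw [LinearMap.mem_ker] at hx
  rw [eq_sum_gen x]
  refine Submodule.sum_mem _ fun i _ => ?_
  obtain ⟨i, hi⟩ := i
  obtain ⟨σ, τ, h, rfl⟩ := (hΛ.isSource_iff hΘ).1 hi
  refine map_mem_radical (LinearMap.toSpanSingleton (Γ.Alg K) _ _)
    (mem_radical_of_arc_per_mul_eq_zero (mem_proj_iff.1 (x ⟨_, hi⟩).2) ?_)
  obtain ⟨r, h1, h2⟩ := exists_e_mul_differential hΛ hΘ x h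
  have h3 := h1 ⟨Γ.src τ, (hΛ.isSink_iff hΘ).2 ⟨σ, τ, h, rfl⟩⟩
  rw [hx, hΛ.coefficient_of_mem hΘ h] at h3
  have h4 : r = 0 := by
    refine (smul_eq_zero.1 (h3.symm.trans (mul_zero _))).resolve_right ?_
    exact arc_ne_zero (steps_le (hΛ.fst_eq h))
  rw [h2, h4, zero_smul]

theorem isMinimalProjectivePresentation (hΛ : IsZigzag Λ) (hΘ : Θ.arrows = runArrows Λ)
    :
    IsMinimalProjectivePresentation Θ.differential (LinearMap.range Θ.differential).mkQ where
  finite₀ := finite_projSum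
  finite₁ := finite_projSum
  projective₀ := projective_projSum
  projective₁ := projective_projSum
  surjective := Submodule.mkQ_surjective _
  exact := LinearMap.exact_map_mkQ_range _
  minimal₁ := isSuperfluous_radical.mono
    ((Submodule.ker_mkQ _).le.trans (range_differential_le hΛ hΘ))
  minimal₀ := isSuperfluous_radical.mono (ker_differential_le hΛ hΘ)

theorem isSolution_cokernelGen (hΛ : IsZigzag Λ) (hΘ : Θ.arrows = runArrows Λ)
    : IsSolution K Λ Θ.cokernelGen where
  e_smul {σ τ} h := by
    rw [Θ.cokernelGen_eq ⟨_, (hΛ.isSink_iff hΘ).2 ⟨σ, τ, h, rfl⟩⟩, ← Submodule.mkQ_apply,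
      ← map_smul]
    exact congrArg _ (e_smul_gen ⟨_, (hΛ.isSink_iff hΘ).2 ⟨σ, τ, h, rfl⟩⟩)
  rel {σ τ} h := by
    have hi : Θ.IsSource (Γ.src σ) := (hΛ.isSource_iff hΘ).2 ⟨σ, τ, h, rfl⟩
    rw [← sum_coefficient_smul hΛ hΘ _ hi]
    have h0 : (LinearMap.range Θ.differential).mkQ (Θ.differential (gen K ⟨_, hi⟩)) = 0 :=
      (Submodule.Quotient.mk_eq_zero _).2 ⟨_, rfl⟩
    rw [differential_gen, map_sum] at h0
    rw [← h0]
    refine Finset.sum_congr rfl fun j _ => ?_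
    rw [cokernelGen_eq, map_smul]
    rfl

/-- The universal property of the cokernel. -/
theorem exists_map_cokernel (hΛ : IsZigzag Λ) (hΘ : Θ.arrows = runArrows Λ)
    {X : Type*} [AddCommGroup X] [Module (Γ.Alg K) X] {μ : Γ.Edge → X}
    (hμ : IsSolution K Λ μ) : ∃ f : Θ.Cokernel →ₗ[Γ.Alg K] X, ∀ {σ τ}, (σ, τ) ∈ Λ →
      f (Θ.cokernelGen (Γ.src τ)) = μ (Γ.src τ) := by
  obtain ⟨f, hf⟩ := exists_map_gen (K := K) (fun j : {j // Θ.IsSink j} => μ j.1) (by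
    rintro ⟨j, hj⟩
    obtain ⟨σ, τ, h, rfl⟩ := (hΛ.isSink_iff hΘ).1 hj
    exact hμ.e_smul h)
  have hle : LinearMap.range Θ.differential ≤ LinearMap.ker f := by
    rintro _ ⟨x, rfl⟩
    rw [LinearMap.mem_ker, eq_sum_gen x, map_sum, map_sum]
    refine Finset.sum_eq_zero fun i _ => ?_
    obtain ⟨i, hi⟩ := i
    obtain ⟨σ, τ, h, rfl⟩ := (hΛ.isSource_iff hΘ).1 hi
    rw [map_smul, map_smul, differential_gen, map_sum]
    simp only [map_smul, hf]
    rw [sum_coefficient_smul hΛ hΘ μ hi, hμ.rel h, smul_zero]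
  refine ⟨Submodule.liftQ _ f hle, fun {σ τ} h => ?_⟩
  rw [Θ.cokernelGen_eq ⟨_, (hΛ.isSink_iff hΘ).2 ⟨σ, τ, h, rfl⟩⟩, Submodule.liftQ_apply, hf]

theorem cokernelGen_ne_zero (hΛ : IsZigzag Λ) (hΘ : Θ.arrows = runArrows Λ)
    {σ τ : Γ.Arrow} (h : (σ, τ) ∈ Λ) :
    Θ.cokernelGen (Γ.src τ) ≠ 0 := by
  rw [Θ.cokernelGen_eq ⟨_, (hΛ.isSink_iff hΘ).2 ⟨σ, τ, h, rfl⟩⟩]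
  intro h0
  rw [Submodule.Quotient.mk_eq_zero] at h0
  exact arc_per_smul_gen_ne_zero (K := K) rfl
    (arc_per_smul_radical τ (range_differential_le hΛ hΘ h0))

theorem exists_e_smul_eq (hΛ : IsZigzag Λ) (hΘ : Θ.arrows = runArrows Λ)
    {σ τ : Γ.Arrow} (h : (σ, τ) ∈ Λ) (x : Θ.Cokernel) :
    ∃ r : K, Γ.e K (Γ.src τ) • x
      = algebraMap K (Γ.Alg K) r • Θ.cokernelGen (Γ.src τ) := by
  obtain ⟨c, rfl⟩ := Θ.exists_eq_sum_cokernelGen x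
  have hj : Θ.IsSink (Γ.src τ) := (hΛ.isSink_iff hΘ).2 ⟨σ, τ, h, rfl⟩
  obtain ⟨r, s, hrs⟩ := exists_e_mul_mul_e_self τ (c ⟨_, hj⟩)
  refine ⟨r, ?_⟩
  have hsol := isSolution_cokernelGen hΛ hΘ
  rw [Finset.smul_sum, Finset.sum_eq_single ⟨_, hj⟩]
  · rw [← mul_smul, ← mul_assoc, hrs, add_smul, algebraMap_smul_mul_smul,
      algebraMap_smul_mul_smul, hsol.e_smul h, hsol.arc_per_smul hΛ h, smul_zero, add_zero]
  · intro j _ hne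
    obtain ⟨σ', τ', h', hj'⟩ := (hΛ.isSink_iff hΘ).1 j.2
    rw [← mul_smul, ← mul_assoc, e_mul_mul_e_eq_zero, zero_smul]
    intro y hy hy'
    rw [← hj'] at hy'
    exact hne (Subtype.ext (hj'.symm.trans (hΛ.sink_eq h h' hy hy').symm))
  · intro h
    exact absurd (Finset.mem_univ _) h

theorem arc_smul_cokernelGen_ne_zero (hΛ : IsZigzag Λ) (hΘ : Θ.arrows = runArrows Λ)
    {σ τ τ' : Γ.Arrow} (h : (σ, τ) ∈ Λ)
    (h' : (σ.symm, τ') ∈ Λ) : arc K σ (steps σ τ) • Θ.cokernelGen (Γ.src τ) ≠ 0 := by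
  have hj : Θ.IsSink (Γ.src τ) := (hΛ.isSink_iff hΘ).2 ⟨σ, τ, h, rfl⟩
  have hj' : Θ.IsSink (Γ.src τ') := (hΛ.isSink_iff hΘ).2 ⟨σ.symm, τ', h', rfl⟩
  rw [Θ.cokernelGen_eq ⟨_, hj⟩, ← Submodule.mkQ_apply, ← map_smul]
  intro h0
  obtain ⟨x, hx⟩ := (Submodule.Quotient.mk_eq_zero _).1 h0
  obtain ⟨r, h1, -⟩ := exists_e_mul_differential hΛ hΘ x h
  have hne : arc K σ (steps σ τ) ≠ 0 := arc_ne_zero (steps_le (hΛ.fst_eq h))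
  have hne' : arc K σ.symm (steps σ.symm τ') ≠ 0 := arc_ne_zero (steps_le (hΛ.fst_eq h'))
  have h2 := h1 ⟨_, hj⟩
  have h3 := h1 ⟨_, hj'⟩
  rw [hx, smul_gen_self, hΛ.coefficient_of_mem hΘ h, ← mul_assoc, e_mul_arc] at h2
  rw [hx, smul_gen_of_ne, ← src_symm, hΛ.coefficient_of_mem hΘ h', mul_zero] at h3
  · rw [(smul_eq_zero.1 h3.symm).resolve_right hne', zero_smul] at h2
    apply hne
    rw [← h2]
    conv_lhs => rw [← arc_mul_e, iterate_steps (hΛ.fst_eq h)]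
  · intro h4
    exact σ.symm_ne (hΛ.eq_of_src_eq h' h (src_symm _) (congrArg Subtype.val h4)).1

/-- The endomorphisms of the cokernel are multiplications with scalars. -/
theorem exists_endomorphism_eq (hΛ : IsZigzag Λ) (hΘ : Θ.arrows = runArrows Λ)
    (f : Θ.Cokernel →ₗ[Γ.Alg K] Θ.Cokernel) :
    ∃ r : K, ∀ x, f x = algebraMap K (Γ.Alg K) r • x := by
  have hsol := isSolution_cokernelGen hΛ hΘ
  have hex : ∀ {σ τ}, (σ, τ) ∈ Λ → ∃ r : K, f (Θ.cokernelGen (Γ.src τ))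
      = algebraMap K (Γ.Alg K) r • Θ.cokernelGen (Γ.src τ) := by
    intro σ τ h
    obtain ⟨r, hr⟩ := exists_e_smul_eq hΛ hΘ h (f (Θ.cokernelGen (Γ.src τ)))
    exact ⟨r, by rw [← hr, ← map_smul, hsol.e_smul h]⟩
  obtain ⟨⟨σ₀, τ₀⟩, h₀⟩ := hΛ.nonempty
  obtain ⟨r, hr⟩ := hex h₀
  let C : Γ.Edge → Prop := fun k => ∀ σ τ, (σ, τ) ∈ Λ → (Γ.src σ = k ∨ Γ.src τ = k) →
    f (Θ.cokernelGen (Γ.src τ)) = algebraMap K (Γ.Alg K) r • Θ.cokernelGen (Γ.src τ)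
  have hC : ∀ {σ τ}, (σ, τ) ∈ Λ → (C (Γ.src σ) ↔ C (Γ.src τ)) := by
    intro σ τ h
    constructor
    · rintro H σ' τ' h' (h1 | h1)
      · exact absurd h1 (hΛ.src_ne h' h)
      · rw [h1]
        exact H σ τ h (Or.inl rfl)
    · rintro H σ' τ' h' (h1 | h1)
      · have h2 := H σ τ h (Or.inr rfl)
        rcases src_eq_src_iff.1 h1 with rfl | rfl
        · rw [hΛ.mem_of_eq h' h]
          exact h2
        · obtain ⟨s, hs⟩ := hex h'
          have h3 := hsol.rel h
          rw [linkValue_of_mem hΛ _ h, linkValue_of_mem hΛ _ h'] at h3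
          have h4 := congrArg f h3
          have h5 := congrArg (algebraMap K (Γ.Alg K) s • ·) h3
          simp only [smul_add, algebraMap_smul_comm, smul_zero] at h5
          rw [map_add, map_smul, map_smul, h2, hs, map_zero, ← h5, add_left_inj,
            ← algebraMap_smul_comm, ← algebraMap_smul_comm, ← sub_eq_zero, ← sub_smul,
            ← map_sub] at h4
          have h6 := (algebraMap_smul_eq_zero h4).resolve_right
            (arc_smul_cokernelGen_ne_zero hΛ hΘ h h')
          rw [hs, sub_eq_zero.1 h6]
      · exact absurd h1.symm (hΛ.src_ne h h')
  have hall : ∀ {σ τ}, (σ, τ) ∈ Λ → f (Θ.cokernelGen (Γ.src τ))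
      = algebraMap K (Γ.Alg K) r • Θ.cokernelGen (Γ.src τ) := by
    intro σ τ h
    refine hΛ.connected C hC h₀ h ((hC h₀).2 ?_) σ τ h (Or.inl rfl)
    rintro σ' τ' h' (h1 | h1)
    · exact absurd h1 (hΛ.src_ne h' h₀)
    · rw [h1, hr]
  refine ⟨r, fun x => ?_⟩
  obtain ⟨c, rfl⟩ := Θ.exists_eq_sum_cokernelGen x
  rw [map_sum, Finset.smul_sum]
  refine Finset.sum_congr rfl fun j _ => ?_
  obtain ⟨σ, τ, h, hj⟩ := (hΛ.isSink_iff hΘ).1 j.2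
  rw [map_smul, ← hj, hall h, algebraMap_smul_comm]

theorem nontrivial_cokernel (hΛ : IsZigzag Λ) (hΘ : Θ.arrows = runArrows Λ)
    : Nontrivial Θ.Cokernel := by
  obtain ⟨⟨σ, τ⟩, h⟩ := hΛ.nonempty
  exact ⟨⟨_, 0, cokernelGen_ne_zero hΛ hΘ h⟩⟩

theorem isIndecomposable_cokernel (hΛ : IsZigzag Λ) (hΘ : Θ.arrows = runArrows Λ)
    : IsIndecomposableModule (Γ.Alg K) Θ.Cokernel := by
  refine ⟨nontrivial_cokernel hΛ hΘ, fun N N' h => ?_⟩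
  obtain ⟨r, hr⟩ := exists_endomorphism_eq hΛ hΘ (N.projection N' h)
  by_cases h0 : r = 0
  · left
    rw [eq_bot_iff]
    intro x hx
    have h1 := hr x
    rw [h0, map_zero, zero_smul] at h1
    rw [Submodule.mem_bot, ← h1]
    exact (Submodule.projection_apply_left h ⟨x, hx⟩).symm
  · right
    rw [eq_bot_iff]
    intro x hx
    have h1 := hr x
    rw [Submodule.projection_apply_of_mem_right h hx] at h1
    exact (algebraMap_smul_eq_zero h1.symm).resolve_left h0

theorem not_projective_cokernel (hΛ : IsZigzag Λ) (hΘ : Θ.arrows = runArrows Λ)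
    : ¬ Module.Projective (Γ.Alg K) Θ.Cokernel := by
  intro hp
  have hmin := isMinimalProjectivePresentation hΛ hΘ
  set π := (LinearMap.range Θ.differential).mkQ with hπ
  obtain ⟨s, hs⟩ := π.exists_rightInverse_of_surjective
    (LinearMap.range_eq_top.2 hmin.surjective)
  have hs' : ∀ y, π (s y) = y := fun y => LinearMap.congr_fun hs y
  have h1 : LinearMap.range s = ⊤ := by
    refine hmin.minimal₁ _ (eq_top_iff.2 fun y _ => ?_)
    rw [← sub_add_cancel y (s (π y)), add_comm]
    refine Submodule.add_mem_sup ⟨_, rfl⟩ ?_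
    rw [LinearMap.mem_ker, map_sub, hs', sub_self]
  have h2 : ∀ x, Θ.differential x = 0 := by
    intro x
    obtain ⟨y, hy⟩ := LinearMap.range_eq_top.1 h1 (Θ.differential x)
    have h3 := hs' y
    rw [hy, hmin.exact.apply_apply_eq_zero] at h3
    rw [← hy, ← h3, map_zero]
  have h3 : (⊥ : Submodule (Γ.Alg K) Θ.Term₀) = ⊤ := by
    refine hmin.minimal₀ _ (eq_top_iff.2 fun x _ => ?_)
    rw [bot_sup_eq]
    exact h2 x
  obtain ⟨⟨σ, τ⟩, h⟩ := hΛ.nonempty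
  have h4 : gen K ⟨Γ.src σ, (hΛ.isSource_iff hΘ).2 ⟨σ, τ, h, rfl⟩⟩ ∈
    (⊥ : Submodule (Γ.Alg K) Θ.Term₀) := by rw [h3]; trivial
  exact gen_ne_zero _ h4

theorem isEmpty_equiv_mod_socle (hΛ : IsZigzag Λ) (hΘ : Θ.arrows = runArrows Λ)
    (P : Type (max u v)) [AddCommGroup P] [Module (Γ.Alg K) P]
    [Module.Projective (Γ.Alg K) P] (hP : IsIndecomposableModule (Γ.Alg K) P) :
    IsEmpty (Θ.Cokernel ≃ₗ[Γ.Alg K] P ⧸ moduleSocle (Γ.Alg K) P) := by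
  refine ⟨fun θ => ?_⟩
  have hmin := isMinimalProjectivePresentation hΛ hΘ
  have := hmin.projective₁
  obtain ⟨φ, hφ⟩ := exists_equiv_of_projective_covers
    (LinearMap.range Θ.differential).mkQ
    (θ.symm.toLinearMap.comp (moduleSocle (Γ.Alg K) P).mkQ) hmin.surjective
    (θ.symm.surjective.comp (Submodule.mkQ_surjective _)) hmin.minimal₁
    ((isSuperfluous_moduleSocle hP).mono
      ((LinearEquiv.ker_comp _ _).trans (Submodule.ker_mkQ _)).le)
  obtain ⟨⟨σ, τ⟩, h⟩ := hΛ.nonempty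
  have hi : Θ.IsSource (Γ.src σ) := (hΛ.isSource_iff hΘ).2 ⟨σ, τ, h, rfl⟩
  have hj : Θ.IsSink (Γ.src τ) := (hΛ.isSink_iff hΘ).2 ⟨σ, τ, h, rfl⟩
  have h1 := hφ (Θ.differential (gen K ⟨_, hi⟩))
  rw [hmin.exact.apply_apply_eq_zero] at h1
  have h2 : φ (Θ.differential (gen K ⟨_, hi⟩)) ∈ moduleSocle (Γ.Alg K) P := by
    rw [← Submodule.Quotient.mk_eq_zero]
    exact (LinearEquiv.map_eq_zero_iff θ.symm).1 h1
  have h3 := moduleSocle_le_arrowKernel h2 (Γ.next.symm σ) 1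
  rw [one_smul, ← map_smul, LinearEquiv.map_eq_zero_iff] at h3
  have h4 : Γ.arr K (Γ.next.symm σ) *
      (Θ.differential (gen K ⟨_, hi⟩) ⟨_, hj⟩ : Γ.Alg K) = 0 :=
    congrArg Subtype.val (congrFun h3 ⟨_, hj⟩)
  rw [differential_apply, Finset.sum_eq_single ⟨Γ.src σ, hi⟩] at h4
  · rw [gen_self, e_mul_coefficient, hΛ.coefficient_of_mem hΘ h] at h4
    have h5 := arr_mul_arc_next (K := K) (Γ.next.symm σ) (steps σ τ)
    rw [Equiv.apply_symm_apply, h4] at h5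
    refine arc_ne_zero (K := K) (a := Γ.next.symm σ) (l := steps σ τ + 1) ?_ h5.symm
    rw [per_eq_of_fst_eq (next_symm_fst σ)]
    exact steps_lt (hΛ.fst_eq h) (hΛ.ne h)
  · intro k _ hk
    rw [gen_of_ne hk, zero_mul]
  · intro h
    exact absurd (Finset.mem_univ _) h

end Zigzag

/-- The presentation given by a path. -/
theorem exists_presentation :
    ∃ T : Presentation (Γ.Alg K), ComplexIso T.d Θ.differential := by
  obtain ⟨Λ, hΛ, hΘ⟩ := exists_zigzag_of_path Θ
  exact ⟨{
    P₀ := ModuleCat.of _ Θ.Term₀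
    P₁ := ModuleCat.of _ Θ.Term₁
    M := ModuleCat.of _ Θ.Cokernel
    d := Θ.differential
    π := (LinearMap.range Θ.differential).mkQ
    minimal := isMinimalProjectivePresentation hΛ hΘ
    indecomposable := isIndecomposable_cokernel hΛ hΘ
    not_projective := not_projective_cokernel hΛ hΘ
    not_mod_socle := fun P _ _ _ _ hP => isEmpty_equiv_mod_socle hΛ hΘ P hP },
    LinearEquiv.refl _ _, LinearEquiv.refl _ _, fun _ => rfl⟩

/-- A path is determined by its complex. -/
theorem eq_of_complexIso {Θ Θ' : Γ.AdmissiblePath K}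
    (h : ComplexIso Θ.differential Θ'.differential) : Θ = Θ' := by
  obtain ⟨φ₀, φ₁, -⟩ := h
  have key : ∀ {P Q : Type (max u v)} [AddCommGroup P] [Module (Γ.Alg K) P] [AddCommGroup Q]
      [Module (Γ.Alg K) Q] (_ : P ≃ₗ[Γ.Alg K] Q) (x : Γ.Alg K),
      (∃ p : P, x • p ≠ 0) ↔ ∃ q : Q, x • q ≠ 0 := by
    intro P Q _ _ _ _ φ x
    constructor
    · rintro ⟨p, hp⟩
      exact ⟨φ p, by rwa [← map_smul, Ne, LinearEquiv.map_eq_zero_iff]⟩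
    · rintro ⟨q, hq⟩
      exact ⟨φ.symm q, by rwa [← map_smul, Ne, LinearEquiv.map_eq_zero_iff]⟩
  apply path_ext
  · intro i
    obtain ⟨a, rfl⟩ := exists_src_eq i
    exact ((exists_arc_per_smul_ne_zero_iff a).symm.trans (key φ₀ _)).trans
      (exists_arc_per_smul_ne_zero_iff a)
  · intro i
    obtain ⟨a, rfl⟩ := exists_src_eq i
    exact ((exists_arc_per_smul_ne_zero_iff a).symm.trans (key φ₁ _)).trans
      (exists_arc_per_smul_ne_zero_iff a)

end AdmissiblePath
end BrauerTree

namespace BrauerTree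

variable {V : Type v} [Finite V] {Γ : BrauerTree V} {K : Type u} [Field K]

/-! ### Linear maps of rank one -/

section Outer

variable {M : Type*} [AddCommGroup M] [Module (Γ.Alg K) M] [Module K M]
  [IsScalarTower K (Γ.Alg K) M]
variable {N : Type*} [AddCommGroup N] [Module (Γ.Alg K) N] [Module K N]
  [IsScalarTower K (Γ.Alg K) N]

/-- The linear map `m ↦ φ (x m) n`. -/
noncomputable def outer (x : Γ.Alg K) (φ : M →ₗ[K] K) (n : N) : M →ₗ[K] N :=
  (LinearMap.toSpanSingleton K N n).comp (φ.comp (Algebra.lsmul K K M x))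

theorem outer_apply (x : Γ.Alg K) (φ : M →ₗ[K] K) (n : N) (m : M) :
    outer x φ n m = φ (x • m) • n := rfl

/-- The sum of the maps of rank one along the inner edges of a run of arrows. -/
noncomputable def runMap (y : Γ.Arrow) (L : ℕ) (φ : M →ₗ[K] K) (n : N) : M →ₗ[K] N :=
  ∑ t ∈ Finset.range (L - 1),
    outer (arc K y (t + 1)) φ (arc K (Γ.next^[t + 1] y) (L - 1 - t) • n)

/-- The linear map is compatible with the idempotents and vanishes on the edges
outside of `S`. -/
structure IsGraded (S : Γ.Edge → Prop) (g : M →ₗ[K] N) : Prop where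
  map_e : ∀ i m, g (Γ.e K i • m) = Γ.e K i • g m
  map_e_of_not : ∀ i m, ¬ S i → g (Γ.e K i • m) = 0

namespace IsGraded

variable {S S' : Γ.Edge → Prop} {g g' : M →ₗ[K] N}

theorem add (h : IsGraded S g) (h' : IsGraded S g') : IsGraded S (g + g') where
  map_e i m := by rw [LinearMap.add_apply, LinearMap.add_apply, h.map_e, h'.map_e, smul_add]
  map_e_of_not i m hi := by
    rw [LinearMap.add_apply, h.map_e_of_not i m hi, h'.map_e_of_not i m hi, add_zero]

theorem neg (h : IsGraded S g) : IsGraded S (-g) where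
  map_e i m := by rw [LinearMap.neg_apply, LinearMap.neg_apply, h.map_e, smul_neg]
  map_e_of_not i m hi := by rw [LinearMap.neg_apply, h.map_e_of_not i m hi, neg_zero]

theorem mono (h : IsGraded S g) (hS : ∀ i, S i → S' i) : IsGraded S' g where
  map_e := h.map_e
  map_e_of_not i m hi := h.map_e_of_not i m fun h' => hi (hS i h')

theorem zero : IsGraded S (0 : M →ₗ[K] N) where
  map_e i m := by rw [LinearMap.zero_apply, LinearMap.zero_apply, smul_zero]
  map_e_of_not i m _ := rfl

theorem sum {ι : Type*} (s : Finset ι) {f : ι → M →ₗ[K] N} (h : ∀ t ∈ s, IsGraded S (f t)) :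
    IsGraded S (∑ t ∈ s, f t) := by
  classical
  induction s using Finset.induction_on with
  | empty => exact zero
  | insert t s ht ih =>
    rw [Finset.sum_insert ht]
    exact (h t (Finset.mem_insert_self _ _)).add
      (ih fun t' ht' => h t' (Finset.mem_insert_of_mem ht'))

theorem outer {x : Γ.Alg K} {j : Γ.Edge} (hx : x * Γ.e K j = x) (φ : M →ₗ[K] K) {n : N}
    (hn : Γ.e K j • n = n) (hj : S j) : IsGraded S (outer x φ n) where
  map_e i m := by
    rw [outer_apply, outer_apply, ← mul_smul, smul_comm]
    by_cases h : i = j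
    · rw [h, hx, hn]
    · rw [← hx, ← hn, mul_assoc, e_mul_e_of_ne (Ne.symm h), mul_zero, zero_smul, map_zero, zero_smul,
        ← mul_smul, e_mul_e_of_ne h, zero_smul, smul_zero]
  map_e_of_not i m hi := by
    have h : j ≠ i := by
      rintro rfl
      exact hi hj
    rw [outer_apply, ← hx, mul_smul, ← mul_smul (Γ.e K j), e_mul_e_of_ne h, zero_smul, smul_zero,
      map_zero, zero_smul]

theorem runMap {y : Γ.Arrow} {L : ℕ} (φ : M →ₗ[K] K) (n : N)
    (hS : ∀ t, 0 < t → t < L → S (Γ.src (Γ.next^[t] y))) : IsGraded S (runMap y L φ n) := by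
  refine sum _ fun t ht => ?_
  rw [Finset.mem_range] at ht
  refine outer (arc_mul_e y (t + 1)) φ ?_ (hS _ (Nat.succ_pos t) (by omega))
  rw [← mul_smul, e_mul_arc]

end IsGraded

open Classical in
/-- The map of a run commutes with the arrows up to terms at the ends of the run. -/
theorem runMap_arr_smul (y : Γ.Arrow) {L : ℕ} (hL : 0 < L) (φ : M →ₗ[K] K) (n : N)
    (a : Γ.Arrow) (m : M) :
    runMap y L φ n (Γ.arr K a • m) = Γ.arr K a • runMap y L φ n m
      + (if Γ.next a = Γ.next^[L] y then φ (arc K y L • m) • Γ.arr K a • n else 0)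
      - (if a = y then φ (Γ.arr K a • m) • arc K y L • n else 0) := by
  obtain ⟨L, rfl⟩ := Nat.exists_eq_succ_of_ne_zero hL.ne'
  let F : ℕ → N := fun t =>
    if Γ.next^[t] y = a then φ (arc K y (t + 1) • m) • arc K a (L + 1 - t) • n else 0
  have h1 : runMap y (L + 1) φ n (Γ.arr K a • m) = ∑ t ∈ Finset.range L, F (t + 1) := by
    rw [runMap, LinearMap.sum_apply, Nat.add_sub_cancel]
    refine Finset.sum_congr rfl fun t ht => ?_
    rw [Finset.mem_range] at ht
    rw [outer_apply, ← mul_smul]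
    by_cases h : Γ.next^[t + 1] y = a
    · simp only [F]
      rw [if_pos h, h, ← h, ← arc_succ, h]
      congr 3
      omega
    · simp only [F]
      rw [if_neg h, ← arc_one a, arc_mul_arc_of_ne (Nat.succ_pos t) one_pos h, zero_smul, map_zero,
        zero_smul]
  have h2 : Γ.arr K a • runMap y (L + 1) φ n m = ∑ t ∈ Finset.range L, F t := by
    rw [runMap, LinearMap.sum_apply, Nat.add_sub_cancel, Finset.smul_sum]
    refine Finset.sum_congr rfl fun t ht => ?_
    rw [Finset.mem_range] at ht
    rw [outer_apply, smul_comm, ← mul_smul]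
    by_cases h : Γ.next^[t] y = a
    · simp only [F]
      rw [if_pos h, Function.iterate_succ_apply', h, arr_mul_arc_next]
      congr 3
      omega
    · simp only [F]
      rw [if_neg h, arr_mul_arc_of_ne _ (by omega), zero_smul, smul_zero]
      rw [Function.iterate_succ_apply']
      exact fun h' => h (Γ.next.injective h')
  have h3 : F L = if Γ.next a = Γ.next^[L + 1] y
      then φ (arc K y (L + 1) • m) • Γ.arr K a • n else 0 := by
    simp only [F]
    rw [Function.iterate_succ_apply', Nat.add_sub_cancel_left, arc_one]
    refine if_congr ?_ rfl rfl
    rw [Γ.next.injective.eq_iff, eq_comm]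
  have h4 : F 0 = if a = y then φ (Γ.arr K a • m) • arc K y (L + 1) • n else 0 := by
    simp only [F]
    rw [Function.iterate_zero, id, zero_add, arc_one, Nat.sub_zero]
    by_cases h : y = a
    · rw [if_pos h, if_pos h.symm, h]
    · rw [if_neg h, if_neg (Ne.symm h)]
  rw [Nat.succ_eq_add_one, h1, h2, ← h3, ← h4, ← Finset.sum_range_succ, Finset.sum_range_succ']
  abel

/-! ### Partial homomorphisms at sinks and sources -/

/-- All end points of the edge are beyond the dart `d`. -/
def EdgeBeyond (d : Γ.Arrow) (i : Γ.Edge) : Prop := ∀ x ∈ (i : Sym2 V), Beyond d x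

theorem EdgeBeyond.of_turn {d d' : Γ.Arrow} (h : Turn d d') {i : Γ.Edge} (hi : EdgeBeyond d' i) :
    EdgeBeyond d i := fun x hx => (hi x hx).of_turn h

theorem edgeBeyond_of_ne {d z : Γ.Arrow} (h : z.fst = d.snd) (hne : z ≠ d.symm) :
    EdgeBeyond d (Γ.src z) :=
  (eq_or_beyond h).resolve_left fun h' =>
    hne (eq_of_fst_eq_of_src_eq h (h'.trans (src_symm d).symm))

theorem not_edgeBeyond_src (d : Γ.Arrow) : ¬ EdgeBeyond d (Γ.src d) := fun h =>
  not_beyond_fst d (h _ (fst_mem_src d))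

open Classical in
/-- There is a linear map that corrects `m ↦ φ (e m) n` on the side of the sink `b`. -/
def HasLift (b : Γ.Arrow) (φ : M →ₗ[K] K) (n : N) : Prop :=
  ∃ g : M →ₗ[K] N, IsGraded (EdgeBeyond b.symm) g ∧ ∀ a m,
    g (Γ.arr K a • m) = Γ.arr K a • g m
      + if Γ.next a = b then φ (Γ.e K (Γ.src b) • m) • Γ.arr K a • n else 0

open Classical in
/-- There is a linear map that corrects `m ↦ φ (e m) n` on the side of the source `c`. -/
def HasSourceLift (c : Γ.Arrow) (φ : M →ₗ[K] K) (n : N) : Prop :=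
  ∃ g : M →ₗ[K] N, IsGraded (EdgeBeyond c.symm) g ∧ ∀ a m,
    g (Γ.arr K a • m) = Γ.arr K a • g m - if a = c then φ (Γ.arr K a • m) • n else 0

theorem hasLift_of_arr_smul_eq_zero {b : Γ.Arrow} (φ : M →ₗ[K] K) {n : N}
    (h : ∀ a, Γ.next a = b → Γ.arr K a • n = 0) : HasLift b φ n := by
  refine ⟨0, IsGraded.zero, fun a m => ?_⟩
  split_ifs with ha
  · rw [h a ha, smul_zero, LinearMap.zero_apply, LinearMap.zero_apply, smul_zero, add_zero]
  · rw [LinearMap.zero_apply, LinearMap.zero_apply, smul_zero, add_zero]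

theorem hasSourceLift_of_map_eq_zero {c : Γ.Arrow} {φ : M →ₗ[K] K} (n : N)
    (h : ∀ m, φ (Γ.arr K c • m) = 0) : HasSourceLift c φ n := by
  refine ⟨0, IsGraded.zero, fun a m => ?_⟩
  split_ifs with ha
  · rw [ha, h, zero_smul, LinearMap.zero_apply, LinearMap.zero_apply, smul_zero, sub_zero]
  · rw [LinearMap.zero_apply, LinearMap.zero_apply, smul_zero, sub_zero]

theorem HasSourceLift.hasLift {b c : Γ.Arrow} (hf : c.fst = b.fst) (hne : c ≠ b)
    {φ ψ : M →ₗ[K] K} {n : N}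
    (hφ : ∀ m, φ (Γ.e K (Γ.src b) • m) = ψ (arc K c (steps c b) • m))
    (hn : ∀ a, Γ.next a = c → Γ.arr K a • arc K c (steps c b) • n = 0)
    (h : HasSourceLift c.symm ψ (arc K c (steps c b) • n)) : HasLift b φ n := by
  classical
  obtain ⟨g, hg, hg'⟩ := h
  rw [SimpleGraph.Dart.symm_symm] at hg
  have hpos := steps_pos hf
  have hc : EdgeBeyond b.symm (Γ.src c) :=
    edgeBeyond_of_ne hf (by rwa [SimpleGraph.Dart.symm_symm])
  have hturn : Turn b.symm c := ⟨hf.symm, by rwa [SimpleGraph.Dart.symm_symm]⟩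
  refine ⟨runMap c (steps c b) ψ n + outer (Γ.e K (Γ.src c)) ψ (arc K c (steps c b) • n) + g,
    ((IsGraded.runMap ψ n fun t ht ht' => ?_).add (IsGraded.outer (e_mul_self _) ψ ?_ hc)).add
      (hg.mono fun i hi => hi.of_turn hturn), fun a m => ?_⟩
  · refine edgeBeyond_of_ne ((iterate_next_fst c t).trans hf) ?_
    rw [SimpleGraph.Dart.symm_symm]
    exact iterate_ne_of_lt_steps hf hne ht'
  · rw [← mul_smul, e_mul_arc]
  · have ha : Γ.arr K a • arc K c (steps c b) • n = 0 := by
      by_cases h : Γ.next a = c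
      · exact hn a h
      · rw [← mul_smul, arr_mul_arc_of_ne (Ne.symm h) hpos, zero_smul]
    simp only [LinearMap.add_apply, smul_add]
    rw [runMap_arr_smul c hpos, hg', outer_apply, outer_apply, smul_comm (Γ.arr K a), ha,
      smul_zero, iterate_steps hf, hφ, ← mul_smul (Γ.e K _)]
    by_cases h1 : a = c
    · rw [if_pos h1, if_neg (show ¬ a = c.symm from h1 ▸ a.symm_ne.symm), h1, e_mul_arr]
      abel
    · by_cases h2 : a = c.symm
      · rw [if_neg h1, if_pos h2, h2, ← src_symm c, e_mul_arr]
        abel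
      · rw [if_neg h1, if_neg h2, e_mul_arr_of_ne, zero_smul, map_zero, zero_smul]
        · abel
        · intro h3
          rcases src_eq_src_iff.1 h3 with h3 | h3
          · exact h1 h3.symm
          · exact h2 (by rw [h3, SimpleGraph.Dart.symm_symm])

theorem HasLift.hasSourceLift {c d : Γ.Arrow} (hf : c.fst = d.fst) (hne : c ≠ d)
    {ψ : M →ₗ[K] K} {n : N} (hn : Γ.e K (Γ.src d) • n = n)
    (hψ : ∀ m, ψ (arc K c (steps c d) • Γ.arr K d • m) = 0)
    (h : HasLift d.symm (ψ.comp (Algebra.lsmul K K M (arc K c (steps c d)))) n) :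
    HasSourceLift c ψ (-(arc K c (steps c d) • n)) := by
  classical
  obtain ⟨g, hg, hg'⟩ := h
  rw [SimpleGraph.Dart.symm_symm] at hg
  have hpos := steps_pos hf
  have hturn : Turn c.symm d := ⟨hf, by rw [SimpleGraph.Dart.symm_symm]; exact hne.symm⟩
  have harc : arc K c (steps c d) * Γ.e K (Γ.src d) = arc K c (steps c d) := by
    conv_rhs => rw [← arc_mul_e, iterate_steps hf]
  refine ⟨-runMap c (steps c d) ψ n + -outer (arc K c (steps c d)) ψ n + -g,
    ((IsGraded.runMap ψ n fun t ht ht' => ?_).neg.add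
      (IsGraded.outer harc ψ hn (edgeBeyond_of_ne hturn.1.symm hturn.2)).neg).add
      (hg.mono fun i hi => hi.of_turn hturn).neg, fun a m => ?_⟩
  · refine edgeBeyond_of_ne (iterate_next_fst c t) ?_
    rw [SimpleGraph.Dart.symm_symm]
    exact iterate_ne_of_le_steps hf hne ht ht'.le
  · have h0 : ψ (arc K c (steps c d) • Γ.arr K a • m) = 0 := by
      by_cases h : d = a
      · rw [← h, hψ]
      · rw [← mul_smul, ← arc_one a, arc_mul_arc_of_ne hpos one_pos, zero_smul, map_zero]
        rwa [iterate_steps hf]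
    have h1 : ψ.comp (Algebra.lsmul K K M (arc K c (steps c d))) (Γ.e K (Γ.src d.symm) • m)
        = ψ (arc K c (steps c d) • m) := by
      change ψ (arc K c (steps c d) • Γ.e K (Γ.src d.symm) • m) = _
      rw [← mul_smul, src_symm, harc]
    simp only [LinearMap.add_apply, LinearMap.neg_apply, smul_add, smul_neg]
    rw [runMap_arr_smul c hpos, hg', outer_apply, outer_apply, h0, iterate_steps hf,
      smul_comm (Γ.arr K a) (ψ _)]
    rw [h1, zero_smul]
    by_cases h2 : Γ.next a = d
    · have h3 : Γ.next a ≠ d.symm := h2 ▸ d.symm_ne.symm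
      rw [if_pos h2, if_neg h3]
      split_ifs <;> abel
    · by_cases h3 : Γ.next a = d.symm
      · rw [if_neg h2, if_pos h3]
        split_ifs <;> abel
      · have h4 : Γ.arr K a • n = 0 := by
          rw [← hn, ← mul_smul, arr_mul_e_of_ne, zero_smul]
          intro h
          rcases src_eq_src_iff.1 h with h | h
          · exact h2 h
          · exact h3 h
        rw [if_neg h2, if_neg h3, h4, smul_zero]
        split_ifs <;> abel

end Outer

end BrauerTree

namespace BrauerTree

variable {V : Type v} [Finite V] {Γ : BrauerTree V} {K : Type u} [Field K]

/-! ### Relations along a half of a zigzag -/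

variable (K) in
/-- The relations given by the sources of a sequence that starts with the sink `b` and continues
with the list of darts, alternating between sources and sinks. -/
def WordRelations {X : Type*} [AddCommGroup X] [Module (Γ.Alg K) X] (μ : Γ.Edge → X) :
    Γ.Arrow → List Γ.Arrow → Prop
  | _, [] => True
  | b, [c] => arc K c (steps c b) • μ (Γ.src b) = 0
  | b, c :: d :: l =>
    (arc K c (steps c b) • μ (Γ.src b) = -(arc K c.symm (steps c.symm d) • μ (Γ.src d)) ∧
      Γ.e K (Γ.src d) • μ (Γ.src d) = μ (Γ.src d)) ∧ WordRelations μ d.symm l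

theorem edgeBeyond_of_turn {d d' : Γ.Arrow} (h : Turn d d') : EdgeBeyond d (Γ.src d') :=
  edgeBeyond_of_ne h.1.symm h.2

theorem WordRelations.congr {X : Type*} [AddCommGroup X] [Module (Γ.Alg K) X]
    {μ μ' : Γ.Edge → X} {b : Γ.Arrow} {l : List Γ.Arrow} (hl : (b.symm :: l).IsChain Turn)
    (h : WordRelations K μ b l) (hb : μ (Γ.src b) = μ' (Γ.src b))
    (hμ : ∀ i, EdgeBeyond b.symm i → μ i = μ' i) : WordRelations K μ' b l := by
  induction l using List.twoStepInduction generalizing b with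
  | nil => trivial
  | singleton c =>
    simp only [WordRelations] at h ⊢
    rwa [← hb]
  | cons_cons c d l ih _ =>
    simp only [WordRelations] at h ⊢
    rw [List.isChain_cons_cons, List.isChain_cons_cons] at hl
    obtain ⟨hc, hd, hl⟩ := hl
    have hd' : μ (Γ.src d) = μ' (Γ.src d) := hμ _ ((edgeBeyond_of_turn hd).of_turn hc)
    refine ⟨by rw [← hb, ← hd']; exact h.1, ih ?_ h.2 ?_ ?_⟩
    · rwa [SimpleGraph.Dart.symm_symm]
    · rwa [src_symm]
    · intro i hi
      rw [SimpleGraph.Dart.symm_symm] at hi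
      exact hμ i ((hi.of_turn hd).of_turn hc)

/-- Along a half of a zigzag the relations are those of the zigzag. -/
theorem wordRelations_iff {X : Type*} [AddCommGroup X] [Module (Γ.Alg K) X] {μ : Γ.Edge → X}
    {Λ : Set (Γ.Arrow × Γ.Arrow)} (hΛ : IsZigzag Λ) {b : Γ.Arrow} {l : List Γ.Arrow}
    (hl : (b.symm :: l).IsChain Turn) (hsub : links false (b.symm :: l) ⊆ Λ)
    (hB : ∀ {σ τ}, (σ, τ) ∈ Λ → Beyond b.symm σ.fst → (σ, τ) ∈ links false (b.symm :: l))
    (hb : Γ.e K (Γ.src b) • μ (Γ.src b) = μ (Γ.src b)) :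
    WordRelations K μ b l ↔ ∀ {σ τ}, (σ, τ) ∈ links false (b.symm :: l) →
      Γ.e K (Γ.src τ) • μ (Γ.src τ) = μ (Γ.src τ) ∧
        linkValue (K := K) Λ μ σ + linkValue (K := K) Λ μ σ.symm = 0 := by
  induction l using List.twoStepInduction generalizing b with
  | nil =>
    simp only [WordRelations, true_iff]
    intro σ τ h
    rw [links_singleton] at h
    exact h.elim
  | singleton c =>
    rw [links_false_cons_cons, links_singleton, SimpleGraph.Dart.symm_symm] at hsub hB
    rw [links_false_cons_cons, links_singleton, SimpleGraph.Dart.symm_symm]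
    rw [List.isChain_cons_cons] at hl
    have hmem : (c, b) ∈ Λ := hsub (Set.mem_insert _ _)
    have hc : linkValue (K := K) Λ μ c.symm = 0 := by
      refine linkValue_of_notMem μ fun τ hτ => ?_
      have h1 := hB hτ ((beyond_snd c).of_turn hl.1)
      rw [Set.mem_insert_iff] at h1
      rcases h1 with h1 | h1
      · exact c.symm_ne (Prod.mk.inj h1).1
      · exact h1.elim
    simp only [WordRelations]
    constructor
    · intro h σ τ h'
      rcases h' with h' | h'
      · obtain ⟨rfl, rfl⟩ := Prod.mk.inj h'
        exact ⟨hb, by rw [hc, linkValue_of_mem hΛ μ hmem, h, add_zero]⟩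
      · exact h'.elim
    · intro h
      have := (h (Set.mem_insert _ _)).2
      rwa [hc, linkValue_of_mem hΛ μ hmem, add_zero] at this
  | cons_cons c d l ih _ =>
    rw [links_false_cons_cons, links_true_cons_cons, SimpleGraph.Dart.symm_symm] at hsub hB
    rw [links_false_cons_cons, links_true_cons_cons, SimpleGraph.Dart.symm_symm]
    rw [List.isChain_cons_cons, List.isChain_cons_cons] at hl
    obtain ⟨hc, hd, hl⟩ := hl
    have hmem : (c, b) ∈ Λ := hsub (Set.mem_insert _ _)
    have hmem' : (c.symm, d) ∈ Λ := hsub (Set.mem_insert_of_mem _ (Set.mem_insert _ _))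
    simp only [WordRelations]
    have hval : linkValue (K := K) Λ μ c + linkValue (K := K) Λ μ c.symm = 0 ↔
        arc K c (steps c b) • μ (Γ.src b)
          = -(arc K c.symm (steps c.symm d) • μ (Γ.src d)) := by
      rw [linkValue_of_mem hΛ μ hmem, linkValue_of_mem hΛ μ hmem', add_eq_zero_iff_eq_neg]
    have hval' : linkValue (K := K) Λ μ c.symm + linkValue (K := K) Λ μ c.symm.symm = 0 ↔
        linkValue (K := K) Λ μ c + linkValue (K := K) Λ μ c.symm = 0 := by
      rw [SimpleGraph.Dart.symm_symm, add_comm]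
    have hih : Γ.e K (Γ.src d) • μ (Γ.src d) = μ (Γ.src d) → (WordRelations K μ d.symm l ↔
        ∀ {σ τ}, (σ, τ) ∈ links false (d :: l) →
          Γ.e K (Γ.src τ) • μ (Γ.src τ) = μ (Γ.src τ) ∧
            linkValue (K := K) Λ μ σ + linkValue (K := K) Λ μ σ.symm = 0) := by
      intro hd'
      have := ih (b := d.symm)
      rw [SimpleGraph.Dart.symm_symm, src_symm] at this
      refine this hl (fun p hp => hsub (Set.mem_insert_of_mem _ (Set.mem_insert_of_mem _ hp))) ?_
        hd'
      intro σ τ h h'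
      rcases hB h ((h'.of_turn hd).of_turn hc) with h1 | h1 | h1
      · obtain ⟨rfl, rfl⟩ := Prod.mk.inj h1
        exact absurd (h'.of_turn hd) (not_beyond_fst _)
      · obtain ⟨rfl, -⟩ := Prod.mk.inj h1
        have h2 : (c.symm).fst = d.fst := hd.1
        rw [h2] at h'
        exact absurd h' (not_beyond_fst _)
      · exact h1
    rw [← hval]
    constructor
    · rintro ⟨⟨h1, h2⟩, h3⟩ σ τ (h' | h' | h')
      · obtain ⟨rfl, rfl⟩ := Prod.mk.inj h'
        exact ⟨hb, h1⟩
      · obtain ⟨rfl, rfl⟩ := Prod.mk.inj h'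
        exact ⟨h2, hval'.2 h1⟩
      · exact (hih h2).1 h3 h'
    · intro h
      have h2 := (h (Set.mem_insert_of_mem _ (Set.mem_insert _ _))).1
      exact ⟨⟨(h (Set.mem_insert _ _)).2, h2⟩, (hih h2).2 fun h' =>
        h (Set.mem_insert_of_mem _ (Set.mem_insert_of_mem _ h'))⟩

theorem Turn.symm {d d' : Γ.Arrow} (h : Turn d d') : Turn d'.symm d.symm :=
  ⟨h.1.symm, fun h' => h.2 (by rw [SimpleGraph.Dart.symm_symm] at h'; exact h'.symm)⟩

/-- The two sides of an edge are disjoint. -/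
theorem Beyond.not_symm {d : Γ.Arrow} {x : V} (h : Beyond d x) : ¬ Beyond d.symm x := by
  rintro ⟨c, hc, rfl⟩
  obtain ⟨c', hc', h'⟩ := h
  have h1 : Relation.ReflTransGen Turn c.symm d := by
    have : ∀ {a b : Γ.Arrow}, Relation.ReflTransGen Turn a b →
        Relation.ReflTransGen Turn b.symm a.symm := by
      intro a b hab
      induction hab with
      | refl => exact .refl
      | tail _ h ih => exact .head h.symm ih
    simpa using this hc
  exact not_beyond_fst c.symm ⟨c', h1.trans hc', h'⟩

theorem beyond_of_mem_links {t : Bool} {d : Γ.Arrow} {l : List Γ.Arrow}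
    (hl : (d :: l).IsChain Turn) {σ τ : Γ.Arrow} (h : (σ, τ) ∈ links t (d :: l)) :
    Beyond d σ.fst := by
  induction l generalizing t d with
  | nil => rw [links_singleton] at h; exact h.elim
  | cons d' l ih =>
    rw [List.isChain_cons_cons] at hl
    rw [links_cons_cons] at h
    rcases h with h | h
    · have h1 : σ.fst = d.snd := by
        cases t
        · obtain ⟨rfl, rfl⟩ := Prod.mk.inj h
          exact hl.1.1.symm
        · obtain ⟨rfl, rfl⟩ := Prod.mk.inj h
          rfl
      rw [h1]
      exact beyond_snd d
    · exact (ih hl.2 h).of_turn hl.1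

end BrauerTree

/-- A linear form which vanishes wherever a linear map has values in `W` factors through it. -/
theorem LinearMap.exists_factor {K M : Type*} [Field K] [AddCommGroup M] [Module K M]
    (f : M →ₗ[K] M) (E W : Submodule K M) (φ : M →ₗ[K] K)
    (h : ∀ m ∈ E, f m ∈ W → φ m = 0) :
    ∃ ψ : M →ₗ[K] K, (∀ m ∈ E, φ m = ψ (f m)) ∧ ∀ m ∈ W, ψ m = 0 := by
  let F : E →ₗ[K] M ⧸ W := W.mkQ.comp (f.comp E.subtype)
  have h1 : φ.comp E.subtype ∈ LinearMap.range F.dualMap := by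
    rw [LinearMap.range_dualMap_eq_dualAnnihilator_ker, Submodule.mem_dualAnnihilator]
    rintro ⟨m, hm⟩ hm'
    exact h m hm ((Submodule.Quotient.mk_eq_zero W).1 hm')
  obtain ⟨ψ, hψ⟩ := h1
  refine ⟨LinearMap.comp ψ W.mkQ, fun m hm => ?_, fun m hm => ?_⟩
  · exact (LinearMap.congr_fun hψ ⟨m, hm⟩).symm
  · change ψ (W.mkQ m) = 0
    rw [Submodule.mkQ_apply, (Submodule.Quotient.mk_eq_zero W).2 hm, map_zero]

theorem Submodule.exists_form_eq_one {K M : Type*} [Field K] [AddCommGroup M] [Module K M]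
    {U : Submodule K M} {m : M} (hm : m ∉ U) :
    ∃ φ : M →ₗ[K] K, φ m = 1 ∧ ∀ x ∈ U, φ x = 0 := by
  obtain ⟨φ, hφ, hker⟩ := Submodule.exists_le_ker_of_notMem hm
  refine ⟨(φ m)⁻¹ • φ, ?_, fun x hx => ?_⟩
  · rw [LinearMap.smul_apply, smul_eq_mul, inv_mul_cancel₀ hφ]
  · rw [LinearMap.smul_apply, LinearMap.mem_ker.1 (hker hx), smul_zero]

theorem exists_apply_ne_succ {T : Type*} (f : ℕ → T) {k n : ℕ} (hk : k ≤ n) (h : f k ≠ f n) :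
    ∃ t, k ≤ t ∧ t < n ∧ f t ≠ f (t + 1) := by
  induction n, hk using Nat.le_induction with
  | base => exact absurd rfl h
  | succ n hn ih =>
    by_cases h' : f n = f (n + 1)
    · obtain ⟨t, h1, h2, h3⟩ := ih (h' ▸ h)
      exact ⟨t, h1, by omega, h3⟩
    · exact ⟨n, hn, by omega, h'⟩

namespace BrauerTree

variable {V : Type v} [Finite V] {Γ : BrauerTree V} {K : Type u} [Field K]

section Search

variable {M : Type*} [AddCommGroup M] [Module (Γ.Alg K) M] [Module K M]
  [IsScalarTower K (Γ.Alg K) M]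

variable (K M) in
/-- The space `e_i M`. -/
noncomputable def space (i : Γ.Edge) : Submodule K M :=
  LinearMap.range (Algebra.lsmul K K M (Γ.e K i))

variable (K M) in
/-- The image of the arrow that ends at the edge of `b` on the side opposite to `b`. -/
noncomputable def image (b : Γ.Arrow) : Submodule K M :=
  LinearMap.range (Algebra.lsmul K K M (Γ.arr K b.symm))

theorem mem_space {i : Γ.Edge} {m : M} : m ∈ space K M i ↔ Γ.e K i • m = m := by
  constructor
  · rintro ⟨x, rfl⟩
    change Γ.e K i • Γ.e K i • x = Γ.e K i • x
    rw [← mul_smul, e_mul_self]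
  · intro h
    exact ⟨m, h⟩

theorem arr_smul_mem_image (b : Γ.Arrow) (m : M) : Γ.arr K b.symm • m ∈ image K M b :=
  ⟨m, rfl⟩

theorem image_le_space (b : Γ.Arrow) : image K M b ≤ space K M (Γ.src b) := by
  rintro _ ⟨x, rfl⟩
  rw [mem_space]
  change Γ.e K (Γ.src b) • Γ.arr K b.symm • x = Γ.arr K b.symm • x
  rw [← mul_smul, ← src_symm, e_mul_arr]

variable (M) in
/-- The elements of `e_j M` that are mapped into `W` by the path of length `k` that ends
with `b`. -/
noncomputable def preimage (b : Γ.Arrow) (k : ℕ) (W : Submodule K M) : Submodule K M :=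
  W.comap (Algebra.lsmul K K M (arc K (Γ.next.symm^[k] b) k)) ⊓ space K M (Γ.src b)

theorem mem_preimage {b : Γ.Arrow} {k : ℕ} {W : Submodule K M} {m : M} :
    m ∈ preimage M b k W ↔
      arc K (Γ.next.symm^[k] b) k • m ∈ W ∧ Γ.e K (Γ.src b) • m = m := by
  rw [← mem_space]
  rfl

theorem preimage_mono {b : Γ.Arrow} {k : ℕ} {W W' : Submodule K M} (h : W ≤ W') :
    preimage M b k W ≤ preimage M b k W' := fun _ hm =>
  mem_preimage.2 ⟨h (mem_preimage.1 hm).1, (mem_preimage.1 hm).2⟩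

theorem iterate_iterate_symm (b : Γ.Arrow) (k : ℕ) : Γ.next^[k] (Γ.next.symm^[k] b) = b :=
  Function.LeftInverse.iterate Γ.next.apply_symm_apply k b

theorem iterate_symm_fst (b : Γ.Arrow) (k : ℕ) : (Γ.next.symm^[k] b).fst = b.fst := by
  rw [← iterate_next_fst _ k, iterate_iterate_symm]

theorem next_iterate_symm_succ (b : Γ.Arrow) (k : ℕ) :
    Γ.next (Γ.next.symm^[k + 1] b) = Γ.next.symm^[k] b := by
  rw [Function.iterate_succ_apply', Equiv.apply_symm_apply]

theorem iterate_symm_per (b : Γ.Arrow) : Γ.next.symm^[per b] b = b := by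
  have h := Function.LeftInverse.iterate Γ.next.symm_apply_apply (per b) b
  rwa [iterate_per] at h

theorem steps_iterate_symm {b : Γ.Arrow} {k : ℕ} (hk : 0 < k) (hk' : k ≤ per b) :
    steps (Γ.next.symm^[k] b) b = k := by
  refine steps_eq hk ?_ (iterate_iterate_symm b k)
  rwa [per_eq_of_fst_eq (iterate_symm_fst b k)]

theorem iterate_symm_ne {b : Γ.Arrow} {k : ℕ} (hk : 0 < k) (hk' : k < per b) :
    Γ.next.symm^[k] b ≠ b := by
  intro h
  have := iterate_iterate_symm b k
  rw [h] at this
  exact iterate_ne_self hk hk' this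

theorem image_le_preimage {b : Γ.Arrow} {k : ℕ} (hk : 0 < k) (W : Submodule K M) :
    image K M b ≤ preimage M b k W := by
  intro m hm
  refine mem_preimage.2 ⟨?_, mem_space.1 (image_le_space b hm)⟩
  obtain ⟨x, rfl⟩ := hm
  change arc K _ k • Γ.arr K b.symm • x ∈ W
  rw [← mul_smul, ← arc_one b.symm, arc_mul_arc_of_ne hk one_pos, zero_smul]
  · exact W.zero_mem
  · rw [iterate_iterate_symm]
    exact b.symm_ne.symm

theorem preimage_image_zero (b : Γ.Arrow) : preimage M b 0 (image K M b) = image K M b := by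
  ext m
  rw [mem_preimage]
  constructor
  · rintro ⟨h1, h2⟩
    rw [Function.iterate_zero, id, arc_zero, h2] at h1
    exact h1
  · intro h
    have := mem_space.1 (image_le_space b h)
    refine ⟨?_, this⟩
    rw [Function.iterate_zero, id, arc_zero, this]
    exact h

theorem preimage_image_le (b : Γ.Arrow) (k : ℕ) :
    preimage M b k (image K M (Γ.next.symm^[k] b)) ≤ preimage M b (k + 1) ⊥ := by
  intro m hm
  obtain ⟨⟨x, hx⟩, h2⟩ := mem_preimage.1 hm
  refine mem_preimage.2 ⟨?_, h2⟩
  have hx : Γ.arr K (Γ.next.symm^[k] b).symm • x = arc K (Γ.next.symm^[k] b) k • m := hx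
  rw [← arr_mul_arc_next, next_iterate_symm_succ, mul_smul, ← hx, ← mul_smul, arr_mul_arr_of_ne,
    zero_smul]
  · exact Submodule.zero_mem _
  · rw [next_iterate_symm_succ]
    exact SimpleGraph.Dart.symm_ne _

theorem arc_mul_e_src {a b : Γ.Arrow} {k : ℕ} (h : Γ.next^[k] a = b) :
    arc K a k * Γ.e K (Γ.src b) = arc K a k := by
  rw [← h, arc_mul_e]

theorem Search.exists_of_ne (hM : ∀ (a : Γ.Arrow) (m : M), arc K a (per a) • m = 0) (b : Γ.Arrow)
    (h : Submodule K M → Submodule K M) (hne : h (image K M b) ≠ h (space K M (Γ.src b))) :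
    (∃ k, k < per b ∧ h (preimage M b k (image K M (Γ.next.symm^[k] b)))
      ≠ h (preimage M b (k + 1) ⊥)) ∨
    ∃ k, 0 < k ∧ k < per b ∧
      h (preimage M b k (image K M (Γ.next.symm^[k] b))) ≠ h (preimage M b k ⊥) := by
  by_contra hcon
  push Not at hcon
  obtain ⟨h1, h2⟩ := hcon
  have key : ∀ k, k < per b → h (preimage M b (k + 1) ⊥) = h (image K M b) := by
    intro k
    induction k with
    | zero =>
      intro hk
      rw [← h1 0 hk]
      exact congrArg h (preimage_image_zero b)
    | succ k ih =>
      intro hk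
      rw [← ih (by omega), ← h1 _ hk, h2 _ (Nat.succ_pos k) hk]
  obtain ⟨p, hp⟩ := Nat.exists_eq_succ_of_ne_zero (per_pos b).ne'
  apply hne
  rw [← key p (by omega), ← Nat.succ_eq_add_one, ← hp]
  congr 1
  ext m
  rw [mem_preimage, iterate_symm_per, hM, mem_space]
  exact ⟨fun h => h.2, fun h => ⟨Submodule.zero_mem _, h⟩⟩

/-- Two subspaces that are distinguished by `h`, together with a half of a zigzag: the elements of
the larger one satisfy the relations of this half, and the linear forms that vanish on the smaller
one can be extended to homomorphisms on this side. -/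
theorem exists_word (hM : ∀ (a : Γ.Arrow) (m : M), arc K a (per a) • m = 0) (b : Γ.Arrow)
    (h : Submodule K M → Submodule K M) (hne : h (image K M b) ≠ h (space K M (Γ.src b))) :
    ∃ (U U' : Submodule K M) (l : List Γ.Arrow), image K M b ≤ U ∧ U ≤ U' ∧
      U' ≤ space K M (Γ.src b) ∧ h U ≠ h U' ∧ (b.symm :: l).IsChain Turn ∧
      (∀ m ∈ U', ∃ μ : Γ.Edge → M, μ (Γ.src b) = m ∧ WordRelations K μ b l) ∧
      ∀ φ : M →ₗ[K] K, (∀ m ∈ U, φ m = 0) → ∀ (N : Type w) [AddCommGroup N]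
        [Module (Γ.Alg K) N] [Module K N] [IsScalarTower K (Γ.Alg K) N],
        (∀ (a : Γ.Arrow) (x : N), arc K a (per a) • x = 0) → ∀ μ : Γ.Edge → N,
        WordRelations K μ b l → HasLift b φ (μ (Γ.src b)) := by
  classical
  obtain ⟨d, hd⟩ : ∃ d, b.symm = d := ⟨_, rfl⟩
  induction d using (wellFounded_turn (Γ := Γ)).transGen.induction generalizing b h with
  | _ d ih =>
  subst hd
  rcases Search.exists_of_ne hM b h hne with ⟨k, hk, hU⟩ | ⟨k, hk, hk', hU⟩
  · obtain ⟨l, hl, hl1, hl2⟩ : ∃ l : List Γ.Arrow, (b.symm :: l).IsChain Turn ∧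
        (∀ m : M, arc K (Γ.next.symm^[k + 1] b) (k + 1) • m = 0 →
          WordRelations K (fun _ => m) b l) ∧
        ∀ (N : Type w) [AddCommGroup N] [Module (Γ.Alg K) N],
          (∀ (a : Γ.Arrow) (x : N), arc K a (per a) • x = 0) → ∀ μ : Γ.Edge → N, WordRelations K μ b l →
            arc K (Γ.next.symm^[k + 1] b) (k + 1) • μ (Γ.src b) = 0 := by
      by_cases hkp : k + 1 = per b
      · refine ⟨[], List.isChain_singleton _, fun _ _ => trivial, fun N _ _ hN μ _ => ?_⟩
        rw [hkp, iterate_symm_per, hN]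
      · have hlt : k + 1 < per b := by omega
        have hs := steps_iterate_symm (Nat.succ_pos k) hlt.le
        refine ⟨[Γ.next.symm^[k + 1] b], ?_, fun m hm => ?_, fun N _ _ hN μ hμ => ?_⟩
        · rw [List.isChain_cons_cons]
          refine ⟨⟨(iterate_symm_fst b _).symm, ?_⟩, List.isChain_singleton _⟩
          rw [SimpleGraph.Dart.symm_symm]
          exact iterate_symm_ne (Nat.succ_pos k) hlt
        · simp only [WordRelations]
          rwa [hs]
        · simp only [WordRelations] at hμ
          rwa [hs] at hμ
    refine ⟨_, _, l, ?_, preimage_image_le b k, inf_le_right, hU, hl, ?_, ?_⟩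
    · rcases Nat.eq_zero_or_pos k with rfl | hk0
      · exact (preimage_image_zero b).ge
      · exact image_le_preimage hk0 _
    · intro m hm
      exact ⟨fun _ => m, rfl, hl1 m (mem_preimage.1 hm).1⟩
    · intro φ hφ N _ _ _ _ hN μ hμ
      have hn := hl2 N hN μ hμ
      rcases Nat.eq_zero_or_pos k with rfl | hk0
      · refine hasLift_of_arr_smul_eq_zero φ fun a ha => ?_
        rwa [zero_add, Function.iterate_one, next_symm_apply_eq.2 ha, arc_one] at hn
      · have hs := steps_iterate_symm hk0 hk.le
        obtain ⟨ψ, hψ1, hψ2⟩ := LinearMap.exists_factor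
          (Algebra.lsmul K K M (arc K (Γ.next.symm^[k] b) k)) (space K M (Γ.src b))
          (image K M (Γ.next.symm^[k] b)) φ fun m hm hm' => hφ m ⟨hm', hm⟩
        refine HasSourceLift.hasLift (ψ := ψ) (iterate_symm_fst b k) (iterate_symm_ne hk0 hk)
          (fun m => ?_) (fun a ha => ?_)
          (hasSourceLift_of_map_eq_zero _ fun m => hψ2 _ (arr_smul_mem_image _ m))
        · rw [hs, hψ1 _ (mem_space.2 (by rw [← mul_smul, e_mul_self]))]
          change ψ (arc K (Γ.next.symm^[k] b) k • Γ.e K (Γ.src b) • m) = _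
          rw [← mul_smul, arc_mul_e_src (iterate_iterate_symm b k)]
        · rw [hs, ← mul_smul, ← ha, arr_mul_arc_next]
          rwa [← next_symm_apply_eq.2 ha, ← Function.iterate_succ_apply' (f := Γ.next.symm)]
  · set c := (Γ.next.symm^[k] b).symm with hc
    have hcs : c.symm = Γ.next.symm^[k] b := SimpleGraph.Dart.symm_symm _
    have hs := steps_iterate_symm hk hk'.le
    have hfst := iterate_symm_fst b k
    have hne' := iterate_symm_ne hk hk'
    let J : ℕ → Submodule K M := fun t => LinearMap.range (Algebra.lsmul K K M (arc K c t))
    obtain ⟨t, ht, ht', hJ⟩ := exists_apply_ne_succ (fun t => h (preimage M b k (J t)))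
      (k := 1) (n := per c) (per_pos c) (by
        convert hU using 4
        · simp only [J, image, arc_one, hc]
        · rw [LinearMap.range_eq_bot]
          ext m
          exact hM c m)
    set d := Γ.next^[t] c with hd
    have hfd : c.fst = d.fst := (iterate_next_fst c t).symm
    have hsd : steps c d = t := steps_eq ht ht'.le rfl
    have hcd : c ≠ d := (iterate_ne_self ht ht').symm
    have hturn : Turn b.symm (Γ.next.symm^[k] b) :=
      ⟨hfst.symm, by rwa [SimpleGraph.Dart.symm_symm]⟩
    have hturn' : Turn (Γ.next.symm^[k] b) d := ⟨hfd, hcd.symm⟩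
    have hsrc : Γ.src d ≠ Γ.src b := by
      intro h0
      have h1 := (edgeBeyond_of_turn hturn').of_turn hturn
      rw [h0, ← src_symm] at h1
      exact not_edgeBeyond_src _ h1
    have hmap : ∀ x : Γ.Alg K, (LinearMap.range (Algebra.lsmul K K M x)).map
        (Algebra.lsmul K K M (arc K c t)) = LinearMap.range (Algebra.lsmul K K M (arc K c t * x)) := by
      intro x
      rw [map_mul, Module.End.mul_eq_comp, LinearMap.range_comp]
    obtain ⟨U, U', l, h1, h2, h3, h4, h5, h6, h7⟩ := ih d (.tail (.single hturn') hturn) d.symm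
      (fun W => h (preimage M b k (W.map (Algebra.lsmul K K M (arc K c t))))) (by
        convert hJ.symm using 4
        · rw [image, hmap, SimpleGraph.Dart.symm_symm, hd, ← arc_succ]
        · rw [space, hmap, src_symm, arc_mul_e_src rfl]) (SimpleGraph.Dart.symm_symm d)
    rw [SimpleGraph.Dart.symm_symm] at h5
    refine ⟨_, _, Γ.next.symm^[k] b :: d :: l, image_le_preimage hk _,
      preimage_mono (Submodule.map_mono h2), inf_le_right, h4, ?_, ?_, ?_⟩
    · exact List.isChain_cons_cons.2 ⟨hturn, List.isChain_cons_cons.2 ⟨hturn', h5⟩⟩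
    · intro m hm
      obtain ⟨⟨m', hm', hmm'⟩, hm2⟩ := mem_preimage.1 hm
      have hmm' : arc K c t • m' = arc K (Γ.next.symm^[k] b) k • m := hmm'
      obtain ⟨μ, hμ, hμ'⟩ := h6 _ (U'.neg_mem hm')
      rw [src_symm] at hμ
      refine ⟨Function.update μ (Γ.src b) m, Function.update_self .., ?_⟩
      simp only [WordRelations]
      rw [Function.update_self, Function.update_of_ne hsrc, hμ, hs, ← hc, hsd, smul_neg, neg_neg,
        smul_neg]
      refine ⟨⟨hmm'.symm, ?_⟩, hμ'.congr ?_ ?_ ?_⟩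
      · have := mem_space.1 (h3 hm')
        rw [src_symm] at this
        rw [this]
      · rwa [SimpleGraph.Dart.symm_symm]
      · rw [src_symm, Function.update_of_ne hsrc]
      · intro i hi
        rw [SimpleGraph.Dart.symm_symm] at hi
        rw [Function.update_of_ne]
        rintro rfl
        have h8 := (hi.of_turn hturn').of_turn hturn
        rw [← src_symm] at h8
        exact not_edgeBeyond_src _ h8
    · intro φ hφ N _ _ _ _ hN μ hμ
      simp only [WordRelations] at hμ
      obtain ⟨⟨hμ1, hμ2⟩, hμ3⟩ := hμ
      rw [← hc] at hμ1
      obtain ⟨ψ, hψ1, hψ2⟩ := LinearMap.exists_factor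
        (Algebra.lsmul K K M (arc K (Γ.next.symm^[k] b) k)) (space K M (Γ.src b))
        (U.map (Algebra.lsmul K K M (arc K c t))) φ fun m hm hm' => hφ m ⟨hm', hm⟩
      refine HasSourceLift.hasLift (ψ := ψ) hfst hne' (fun m => ?_) (fun a ha => ?_) ?_
      · rw [hs, hψ1 _ (mem_space.2 (by rw [← mul_smul, e_mul_self]))]
        change ψ (arc K (Γ.next.symm^[k] b) k • Γ.e K (Γ.src b) • m) = _
        rw [← mul_smul, arc_mul_e_src (iterate_iterate_symm b k)]
      · rw [hμ1, hsd, smul_neg, ← mul_smul, arr_mul_arc_of_ne _ ht, zero_smul, neg_zero]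
        rw [ha, hc]
        exact SimpleGraph.Dart.symm_ne _
      · rw [hμ1, ← hc]
        refine HasLift.hasSourceLift hfd hcd hμ2 (fun m => ?_) ?_
        · rw [hsd]
          refine hψ2 _ ⟨_, h1 ?_, rfl⟩
          have := arr_smul_mem_image (K := K) d.symm m
          rwa [SimpleGraph.Dart.symm_symm] at this
        · have := h7 (ψ.comp (Algebra.lsmul K K M (arc K c t)))
            (fun m hm => hψ2 _ ⟨m, hm, rfl⟩) N hN μ hμ3
          rwa [src_symm, ← hsd] at this

end Search

end BrauerTree

namespace BrauerTree

variable {V : Type v} [Finite V] {Γ : BrauerTree V} {K : Type u} [Field K]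

/-! ### The indecomposable projective modules -/

theorem exists_mul_arc_per (y : Γ.Alg K) (b : Γ.Arrow) :
    ∃ r : K, y * arc K b (per b) = r • arc K b (per b) := by
  induction y using arc_induction with
  | arcs a l =>
    rcases Nat.eq_zero_or_pos l with rfl | hl
    · rw [arc_zero]
      by_cases h : Γ.src a = Γ.src b
      · exact ⟨1, by rw [h, e_mul_arc, one_smul]⟩
      · exact ⟨0, by rw [e_mul_arc_of_ne h, zero_smul]⟩
    · obtain ⟨l, rfl⟩ := Nat.exists_eq_succ_of_ne_zero hl.ne'
      exact ⟨0, by rw [Nat.succ_eq_add_one, arc_succ, mul_assoc, arr_mul_arc_per, mul_zero,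
        zero_smul]⟩
  | zero => exact ⟨0, by rw [zero_mul, zero_smul]⟩
  | add x y hx hy =>
    obtain ⟨r, hr⟩ := hx
    obtain ⟨s, hs⟩ := hy
    exact ⟨r + s, by rw [add_mul, hr, hs, add_smul]⟩
  | smul c x hx =>
    obtain ⟨r, hr⟩ := hx
    exact ⟨c * r, by rw [smul_mul_assoc, hr, mul_smul]⟩

theorem arr_symm_mul_e (a : Γ.Arrow) :
    Γ.arr K (Γ.next.symm a) * Γ.e K (Γ.src a) = Γ.arr K (Γ.next.symm a) := by
  have := arr_mul_e (K := K) (Γ.next.symm a)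
  rwa [tgt, Equiv.apply_symm_apply] at this

/-- The elements of `A e_j` killed by all arrows are the multiples of the socle element. -/
theorem exists_eq_smul_arc_per {b : Γ.Arrow} {x : Γ.Alg K} (hx : x * Γ.e K (Γ.src b) = x)
    (h : ∀ a, Γ.arr K a * x = 0) : ∃ s : K, x = s • arc K b (per b) := by
  have h0 : ∀ i, i ≠ Γ.src b → Γ.e K i * x = 0 := by
    intro i hi
    by_cases hv : ∃ y : V, y ∈ (i : Sym2 V) ∧ y ∈ (Γ.src b : Sym2 V)
    · obtain ⟨y, hy, hy'⟩ := hv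
      obtain ⟨a, ha, rfl⟩ := exists_dart_of_mem hy
      obtain ⟨c, hc, hcb⟩ := exists_dart_of_mem hy'
      have hf : a.fst = c.fst := ha.trans hc.symm
      have hne : a ≠ c := by
        rintro rfl
        exact hi hcb
      obtain ⟨r, hr⟩ := exists_e_mul_mul_e hf hne x
      rw [hcb, mul_assoc, hx] at hr
      have h1 := h (Γ.next.symm a)
      rw [← arr_symm_mul_e, mul_assoc, hr, mul_smul_comm] at h1
      have h2 := arr_mul_arc_next (K := K) (Γ.next.symm a) (steps a c)
      rw [Equiv.apply_symm_apply] at h2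
      rw [h2] at h1
      have h3 : r = 0 := by
        refine (smul_eq_zero.1 h1).resolve_right (arc_ne_zero ?_)
        rw [per_eq_of_fst_eq (next_symm_fst a)]
        exact steps_lt hf hne
      rw [hr, h3, zero_smul]
    · rw [← hx, ← mul_assoc]
      exact e_mul_mul_e_eq_zero (fun y hy hy' => hv ⟨y, hy, hy'⟩) x
  obtain ⟨r, s, hrs⟩ := exists_e_mul_mul_e_self b x
  rw [mul_assoc, hx] at hrs
  have h1 := h (Γ.next.symm b)
  rw [← arr_symm_mul_e, mul_assoc, hrs, mul_add, mul_smul_comm, mul_smul_comm, arr_mul_arc_per,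
    smul_zero, add_zero, arr_symm_mul_e, ← arc_one] at h1
  have h2 : r = 0 := (smul_eq_zero.1 h1).resolve_right (arc_ne_zero (per_pos _))
  refine ⟨s, ?_⟩
  rw [h2, zero_smul, zero_add] at hrs
  rw [← hrs]
  conv_lhs => rw [← one_mul x, ← sum_e, Finset.sum_mul]
  refine Finset.sum_eq_single _ (fun i _ hi => h0 i hi) fun h => absurd (Finset.mem_univ _) h

theorem arc_per_mem_proj (b : Γ.Arrow) : arc K b (per b) ∈ Γ.proj K (Γ.src b) :=
  mem_proj_iff.2 (arc_per_mul_e b)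

theorem arc_per_mem_moduleSocle (b : Γ.Arrow) :
    (⟨arc K b (per b), arc_per_mem_proj b⟩ : Γ.proj K (Γ.src b)) ∈
      moduleSocle (Γ.Alg K) (Γ.proj K (Γ.src b)) := by
  set s : Γ.proj K (Γ.src b) := ⟨arc K b (per b), arc_per_mem_proj b⟩ with hs
  have hs0 : s ≠ 0 := fun h => arc_per_ne_zero b (congrArg Subtype.val h)
  have hsmul : ∀ y : Γ.Alg K, ∃ r : K, y • s = algebraMap K (Γ.Alg K) r • s := by
    intro y
    obtain ⟨r, hr⟩ := exists_mul_arc_per y b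
    exact ⟨r, Subtype.ext (hr.trans (Algebra.smul_def _ _))⟩
  have hmem : s ∈ Submodule.span (Γ.Alg K) {s} := Submodule.mem_span_singleton_self s
  refine Submodule.mem_sSup_of_mem (s := Submodule.span (Γ.Alg K) {s}) ?_ hmem
  change IsSimpleModule (Γ.Alg K) (Submodule.span (Γ.Alg K) {s})
  rw [isSimpleModule_iff_toSpanSingleton_surjective]
  refine ⟨⟨⟨⟨s, hmem⟩, 0, fun h => hs0 (congrArg Subtype.val h)⟩⟩, ?_⟩
  rintro ⟨m, hm⟩ hm0 ⟨z, hz⟩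
  obtain ⟨y, rfl⟩ := Submodule.mem_span_singleton.1 hm
  obtain ⟨y', rfl⟩ := Submodule.mem_span_singleton.1 hz
  obtain ⟨r, hr⟩ := hsmul y
  have hr0 : r ≠ 0 := by
    rintro rfl
    exact hm0 (Subtype.ext (hr.trans (by rw [map_zero, zero_smul]; rfl)))
  refine ⟨y' * algebraMap K (Γ.Alg K) r⁻¹, Subtype.ext ?_⟩
  change (y' * algebraMap K (Γ.Alg K) r⁻¹) • y • s = y' • s
  rw [hr, mul_smul, ← mul_smul (algebraMap K (Γ.Alg K) r⁻¹), ← map_mul, inv_mul_cancel₀ hr0,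
    map_one, one_smul]

theorem isIndecomposable_proj (b : Γ.Arrow) :
    IsIndecomposableModule (Γ.Alg K) (Γ.proj K (Γ.src b)) := by
  set s : Γ.proj K (Γ.src b) := ⟨arc K b (per b), arc_per_mem_proj b⟩ with hs
  have hs0 : s ≠ 0 := fun h => arc_per_ne_zero b (congrArg Subtype.val h)
  refine ⟨⟨⟨s, 0, hs0⟩⟩, fun N N' h => ?_⟩
  have key : ∀ N : Submodule (Γ.Alg K) (Γ.proj K (Γ.src b)), s ∉ N → N ≤ radical Γ K _ := by
    intro N hN x hx
    have h1 : arc K b (per b) * (x : Γ.Alg K) = 0 := by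
      obtain ⟨r, hr⟩ := exists_arc_per_mul b (x : Γ.Alg K)
      by_contra h0
      have hr0 : r ≠ 0 := by
        rintro rfl
        rw [zero_smul] at hr
        exact h0 hr
      apply hN
      have h2 := N.smul_mem (algebraMap K (Γ.Alg K) r⁻¹ * arc K b (per b)) hx
      convert h2 using 1
      apply Subtype.ext
      change arc K b (per b) = algebraMap K (Γ.Alg K) r⁻¹ * arc K b (per b) * (x : Γ.Alg K)
      rw [mul_assoc, hr, ← Algebra.smul_def, ← mul_smul, inv_mul_cancel₀ hr0, one_smul]
    have h2 := mem_radical_of_arc_per_mul_eq_zero (mem_proj_iff.1 x.2) h1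
    have h3 := map_mem_radical (LinearMap.toSpanSingleton (Γ.Alg K) (Γ.proj K (Γ.src b))
      ⟨Γ.e K (Γ.src b), Submodule.mem_span_singleton_self _⟩) h2
    convert h3 using 1
    exact Subtype.ext (mem_proj_iff.1 x.2).symm
  by_cases h1 : s ∈ N
  · right
    have h2 : s ∉ N' := fun h2 => hs0 (Submodule.disjoint_def.1 h.disjoint s h1 h2)
    have h3 := isSuperfluous_radical.mono (key N' h2) N h.sup_eq_top
    have h4 := h.inf_eq_bot
    rwa [h3, top_inf_eq] at h4
  · left
    have h3 := isSuperfluous_radical.mono (key N h1) N' (by rw [sup_comm, h.sup_eq_top])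
    have h4 := h.inf_eq_bot
    rwa [h3, inf_top_eq] at h4

/-! ### Splitting off direct summands -/

section Splitting

variable {M : Type*} [AddCommGroup M] [Module (Γ.Alg K) M] [Module K M]
  [IsScalarTower K (Γ.Alg K) M]
variable {N : Type*} [AddCommGroup N] [Module (Γ.Alg K) N] [Module K N]
  [IsScalarTower K (Γ.Alg K) N]

theorem IsGraded.exists_linearMap {S : Γ.Edge → Prop} {g : M →ₗ[K] N} (hg : IsGraded S g)
    (ha : ∀ a m, g (Γ.arr K a • m) = Γ.arr K a • g m) :
    ∃ f : M →ₗ[Γ.Alg K] N, ∀ m, f m = g m :=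
  ⟨{ toFun := g, map_add' := map_add g, map_smul' := map_smul_of_commutes g hg.map_e ha },
    fun _ => rfl⟩

/-- Linear maps on both sides of an edge give a homomorphism. -/
theorem HasLift.exists_linearMap {b : Γ.Arrow} {φ : M →ₗ[K] K} {n : N}
    (hn : Γ.e K (Γ.src b) • n = n) (h0 : ∀ m, φ (Γ.arr K b • m) = 0)
    (h0' : ∀ m, φ (Γ.arr K b.symm • m) = 0) (h : HasLift b φ n) (h' : HasLift b.symm φ n) :
    ∃ f : M →ₗ[Γ.Alg K] N, ∀ m, Γ.e K (Γ.src b) • m = m → f m = φ m • n := by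
  obtain ⟨g, hg, hg'⟩ := h
  obtain ⟨k, hk, hk'⟩ := h'
  have hgr : IsGraded (fun _ => True) (outer (Γ.e K (Γ.src b)) φ n + g + k) :=
    ((IsGraded.outer (e_mul_self _) φ hn trivial).add (hg.mono fun _ _ => trivial)).add
      (hk.mono fun _ _ => trivial)
  obtain ⟨f, hf⟩ := hgr.exists_linearMap (by
    intro a m
    simp only [LinearMap.add_apply, smul_add]
    rw [hg', hk', outer_apply, outer_apply, smul_comm (Γ.arr K a) (φ _), src_symm]
    have h1 : φ (Γ.e K (Γ.src b) • Γ.arr K a • m) = 0 := by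
      rw [← mul_smul]
      by_cases h : Γ.src b = Γ.src a
      · rw [h, e_mul_arr]
        rcases src_eq_src_iff.1 h with rfl | rfl
        · exact h0 m
        · have := h0' m
          rwa [SimpleGraph.Dart.symm_symm] at this
      · rw [e_mul_arr_of_ne h, zero_smul, map_zero]
    rw [h1, zero_smul]
    by_cases h2 : Γ.next a = b
    · have h3 : Γ.next a ≠ b.symm := h2 ▸ (SimpleGraph.Dart.symm_ne _).symm
      rw [if_pos h2, if_neg h3]
      abel
    · by_cases h3 : Γ.next a = b.symm
      · rw [if_neg h2, if_pos h3]
        abel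
      · have h4 : Γ.arr K a • n = 0 := by
          rw [← hn, ← mul_smul, arr_mul_e_of_ne, zero_smul]
          intro h
          rcases src_eq_src_iff.1 h with h | h
          · exact h2 h
          · exact h3 h
        rw [if_neg h2, if_neg h3, h4, smul_zero]
        abel)
  refine ⟨f, fun m hm => ?_⟩
  rw [hf, LinearMap.add_apply, LinearMap.add_apply, outer_apply, hm, ← hm,
    hg.map_e_of_not _ _ fun h => not_edgeBeyond_src b.symm (by rwa [src_symm]),
    hk.map_e_of_not _ _ fun h => not_edgeBeyond_src b (by rwa [SimpleGraph.Dart.symm_symm] at h),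
    add_zero, add_zero, hm]

/-- An element that is not killed by the socle generates a projective direct summand. -/
theorem exists_linearMap_of_arc_per_smul_ne_zero {b : Γ.Arrow} {m : M}
    (hm : Γ.e K (Γ.src b) • m = m) (h : arc K b (per b) • m ≠ 0) {n : N}
    (hn : Γ.e K (Γ.src b) • n = n) : ∃ f : M →ₗ[Γ.Alg K] N, f m = n := by
  classical
  have hspan : arc K b (per b) • m ∉ Submodule.span K {m} := by
    rw [Submodule.mem_span_singleton]
    rintro ⟨r, hr⟩
    have h1 := congrArg (arc K b (per b) • ·) hr
    simp only [smul_comm (arc K b (per b)) r, ← mul_smul, arc_per_mul_arc b b (per_pos b),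
      zero_smul] at h1
    rcases smul_eq_zero.1 h1 with h2 | h2
    · rw [h2, zero_smul] at hr
      exact h hr.symm
    · exact h h2
  obtain ⟨φ, hφ1, hker⟩ := Submodule.exists_form_eq_one hspan
  have hφ0 : φ m = 0 := hker m (Submodule.mem_span_singleton_self m)
  have hrun : ∀ c : Γ.Arrow, IsGraded (fun i => i ≠ Γ.src c) (runMap c (per c) φ n) := by
    intro c
    refine IsGraded.runMap φ n fun t ht ht' h => ?_
    exact iterate_ne_self ht ht' (eq_of_fst_eq_of_src_eq (iterate_next_fst c t) h)
  have hrun0 : ∀ c : Γ.Arrow, Γ.src c = Γ.src b → runMap c (per c) φ n m = 0 := by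
    intro c hc
    rw [← hm, ← hc]
    exact (hrun c).map_e_of_not _ _ fun h => h rfl
  have hn' : Γ.e K (Γ.src b) • arc K b (per b) • n = arc K b (per b) • n := by
    rw [← mul_smul, e_mul_arc]
  have hgr : IsGraded (fun _ => True) (outer (arc K b (per b)) φ n + runMap b (per b) φ n
      + runMap b.symm (per b.symm) φ n + outer (Γ.e K (Γ.src b)) φ (arc K b (per b) • n)) :=
    (((IsGraded.outer (arc_per_mul_e b) φ hn trivial).add ((hrun b).mono fun _ _ => trivial)).add
      ((hrun b.symm).mono fun _ _ => trivial)).add (IsGraded.outer (e_mul_self _) φ hn' trivial)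
  obtain ⟨f, hf⟩ := hgr.exists_linearMap (by
    intro a m
    simp only [LinearMap.add_apply, smul_add]
    rw [runMap_arr_smul b (per_pos b), runMap_arr_smul b.symm (per_pos b.symm), iterate_per,
      iterate_per, arc_per_symm, outer_apply, outer_apply, outer_apply, outer_apply,
      smul_comm (Γ.arr K a) (φ _), smul_comm (Γ.arr K a) (φ _), ← mul_smul (arc K b (per b)),
      arc_per_mul_arr, zero_smul, map_zero, zero_smul, ← mul_smul (Γ.arr K a) (arc K b (per b)),
      arr_mul_arc_per, zero_smul, smul_zero, ← mul_smul (Γ.e K (Γ.src b))]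
    have h1 : φ ((Γ.e K (Γ.src b) * Γ.arr K a) • m) • arc K b (per b) • n
        = (if a = b then φ (Γ.arr K a • m) • arc K b (per b) • n else 0)
          + if a = b.symm then φ (Γ.arr K a • m) • arc K b (per b) • n else 0 := by
      by_cases h : Γ.src b = Γ.src a
      · rw [h, e_mul_arr]
        rcases src_eq_src_iff.1 h.symm with rfl | rfl
        · rw [if_pos rfl, if_neg a.symm_ne.symm, add_zero]
        · rw [if_neg b.symm_ne, if_pos rfl, zero_add]
      · rw [e_mul_arr_of_ne h, zero_smul, map_zero, zero_smul, if_neg, if_neg, add_zero]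
        · rintro rfl
          exact h (src_symm b).symm
        · rintro rfl
          exact h rfl
    have h2 : φ (arc K b (per b) • m) • Γ.arr K a • n
        = (if Γ.next a = b then φ (arc K b (per b) • m) • Γ.arr K a • n else 0)
          + if Γ.next a = b.symm then φ (arc K b (per b) • m) • Γ.arr K a • n else 0 := by
      by_cases h3 : Γ.next a = b
      · have h4 : Γ.next a ≠ b.symm := h3 ▸ (SimpleGraph.Dart.symm_ne _).symm
        rw [if_pos h3, if_neg h4, add_zero]
      · by_cases h4 : Γ.next a = b.symm
        · rw [if_neg h3, if_pos h4, zero_add]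
        · have h5 : Γ.arr K a • n = 0 := by
            rw [← hn, ← mul_smul, arr_mul_e_of_ne, zero_smul]
            intro h
            rcases src_eq_src_iff.1 h with h | h
            · exact h3 h
            · exact h4 h
          rw [if_neg h3, if_neg h4, h5, smul_zero, add_zero]
    rw [h1]
    conv_rhs => rw [h2]
    abel)
  refine ⟨f, ?_⟩
  rw [hf]
  simp only [LinearMap.add_apply]
  rw [outer_apply, outer_apply, hrun0 b rfl, hrun0 b.symm (src_symm b), hm, hφ0, hφ1, zero_smul,
    one_smul, add_zero, add_zero, add_zero]

end Splitting

theorem isScalarTower_compHom (M : Type*) [AddCommGroup M] [Module (Γ.Alg K) M] :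
    letI := Module.compHom M (algebraMap K (Γ.Alg K))
    IsScalarTower K (Γ.Alg K) M :=
  let _ := Module.compHom M (algebraMap K (Γ.Alg K))
  ⟨fun r x m => algebraMap_smul_mul_smul r x m⟩

/-- The socle elements kill the non-projective indecomposable modules. -/
theorem arc_per_smul_eq_zero {M : Type*} [AddCommGroup M] [Module (Γ.Alg K) M]
    (hM : IsIndecomposableModule (Γ.Alg K) M) (hp : ¬ Module.Projective (Γ.Alg K) M)
    (b : Γ.Arrow) (m : M) : arc K b (per b) • m = 0 := by
  let _ := Module.compHom M (algebraMap K (Γ.Alg K))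
  have := isScalarTower_compHom (Γ := Γ) (K := K) M
  by_contra h
  apply hp
  have hm : Γ.e K (Γ.src b) • Γ.e K (Γ.src b) • m = Γ.e K (Γ.src b) • m := by
    rw [← mul_smul, e_mul_self]
  have hn : Γ.e K (Γ.src b) • (⟨Γ.e K (Γ.src b), Submodule.mem_span_singleton_self _⟩ :
      Γ.proj K (Γ.src b)) = ⟨Γ.e K (Γ.src b), Submodule.mem_span_singleton_self _⟩ :=
    Subtype.ext (e_mul_self _)
  obtain ⟨g, hg⟩ := exists_linearMap_of_arc_per_smul_ne_zero hm (by
    rwa [← mul_smul, arc_per_mul_e]) hn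
  have := (isIndecomposable_proj (K := K) b).1
  let f : Γ.proj K (Γ.src b) →ₗ[Γ.Alg K] M :=
    (LinearMap.toSpanSingleton (Γ.Alg K) M (Γ.e K (Γ.src b) • m)).comp (Γ.proj K _).subtype
  have hgf : ∀ x, g (f x) = x := by
    intro x
    change g ((x : Γ.Alg K) • Γ.e K (Γ.src b) • m) = x
    rw [map_smul, hg]
    exact Subtype.ext (mem_proj_iff.1 x.2)
  exact Module.Projective.of_equiv (LinearEquiv.ofBijective f (bijective_of_retract hM f g hgf))

end BrauerTree

namespace BrauerTree

variable {V : Type v} [Finite V] {Γ : BrauerTree V} {K : Type u} [Field K]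

/-! ### The classification of indecomposable modules -/

section

variable {M : Type*} [AddCommGroup M] [Module (Γ.Alg K) M] [Module K M]
  [IsScalarTower K (Γ.Alg K) M]

/-- By Nakayama's lemma some space `e_j M` is not spanned by the images of arrows. -/
theorem exists_image_sup_image_ne [Nontrivial M] :
    ∃ b : Γ.Arrow, image K M b ⊔ image K M b.symm ≠ space K M (Γ.src b) := by
  by_contra hcon
  push Not at hcon
  have h : radical Γ K M = ⊤ := by
    rw [eq_top_iff]
    intro m _
    rw [← one_smul (Γ.Alg K) m, ← sum_e, Finset.sum_smul]
    refine Submodule.sum_mem _ fun i _ => ?_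
    obtain ⟨b, rfl⟩ := exists_src_eq i
    have h1 : Γ.e K (Γ.src b) • m ∈ space K M (Γ.src b) := ⟨m, rfl⟩
    rw [← hcon b] at h1
    obtain ⟨_, ⟨x, rfl⟩, _, ⟨y, rfl⟩, h2⟩ := Submodule.mem_sup.1 h1
    rw [← h2]
    exact Submodule.add_mem _ (arr_smul_mem_radical _ x) (arr_smul_mem_radical _ y)
  exact bot_ne_top (isSuperfluous_radical (Γ := Γ) (K := K) (M := M) ⊥ (by rw [bot_sup_eq, h]))

/-- An element of two filtrations which is not in the sum of the lower steps. -/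
theorem exists_mem_inf_notMem_sup {U U' W W' : Submodule K M} (hU : U ≤ U') (hW : W ≤ W')
    (h : U ⊔ U' ⊓ W ≠ U ⊔ U' ⊓ W') : ∃ m, m ∈ U' ∧ m ∈ W' ∧ m ∉ U ⊔ W := by
  by_contra hcon
  push Not at hcon
  refine h (le_antisymm (sup_le_sup_left (inf_le_inf_left _ hW) _) (sup_le le_sup_left ?_))
  rintro m ⟨h1, h2⟩
  obtain ⟨x, hx, y, hy, rfl⟩ := Submodule.mem_sup.1 (hcon m h1 h2)
  refine Submodule.add_mem_sup hx ⟨?_, hy⟩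
  have := U'.sub_mem h1 (hU hx)
  rwa [add_sub_cancel_left] at this

end

/-- A module killed by the socle contains a solution of the relations of a zigzag, and the
submodule generated by it can be mapped to any other solution. -/
theorem exists_words {M : Type*} [AddCommGroup M] [Module (Γ.Alg K) M] [Nontrivial M]
    (hM : ∀ (a : Γ.Arrow) (m : M), arc K a (per a) • m = 0) :
    ∃ (b : Γ.Arrow) (l l' : List Γ.Arrow) (μ : Γ.Edge → M), (b.symm :: l).IsChain Turn ∧
      (b :: l').IsChain Turn ∧ Γ.e K (Γ.src b) • μ (Γ.src b) = μ (Γ.src b) ∧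
      μ (Γ.src b) ≠ 0 ∧ WordRelations K μ b l ∧ WordRelations K μ b.symm l' ∧
      ∀ (N : Type w) [AddCommGroup N] [Module (Γ.Alg K) N],
        (∀ (a : Γ.Arrow) (x : N), arc K a (per a) • x = 0) → ∀ ν : Γ.Edge → N,
        Γ.e K (Γ.src b) • ν (Γ.src b) = ν (Γ.src b) → WordRelations K ν b l →
        WordRelations K ν b.symm l' → ∃ g : M →ₗ[Γ.Alg K] N, g (μ (Γ.src b)) = ν (Γ.src b) := by
  classical
  let _ := Module.compHom M (algebraMap K (Γ.Alg K))
  have := isScalarTower_compHom (Γ := Γ) (K := K) M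
  obtain ⟨b, hb⟩ := exists_image_sup_image_ne (Γ := Γ) (K := K) (M := M)
  have hle : image K M b.symm ≤ space K M (Γ.src b) := by
    rw [← src_symm]
    exact image_le_space _
  obtain ⟨U, U', l, h1, h2, h3, h4, h5, h6, h7⟩ := exists_word.{u, v, w} hM b
    (fun U => U ⊔ image K M b.symm) (by rwa [sup_eq_left.2 hle])
  obtain ⟨W, W', l', k1, k2, k3, k4, k5, k6, k7⟩ := exists_word.{u, v, w} hM b.symm
    (fun W => U ⊔ U' ⊓ W) (by
      rw [src_symm, inf_eq_left.2 h3, sup_eq_right.2 h2]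
      intro h
      apply h4
      refine le_antisymm (sup_le_sup_right h2 _) (sup_le ?_ le_sup_right)
      rw [← h]
      exact sup_le_sup_left inf_le_right _)
  rw [SimpleGraph.Dart.symm_symm] at k5
  obtain ⟨m, hm, hm', hmn⟩ := exists_mem_inf_notMem_sup h2 k2 k4
  have hem : Γ.e K (Γ.src b) • m = m := mem_space.1 (h3 hm)
  obtain ⟨μ, hμ, hμl⟩ := h6 m hm
  obtain ⟨μ', hμ', hμl'⟩ := k6 m hm'
  rw [src_symm] at hμ'
  let ν : Γ.Edge → M := fun i => if EdgeBeyond b.symm i then μ i else μ' i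
  have hνb : ν (Γ.src b) = m :=
    (if_neg (by rw [← src_symm]; exact not_edgeBeyond_src _)).trans hμ'
  refine ⟨b, l, l', ν, h5, k5, ?_, ?_, ?_, ?_, ?_⟩
  · rw [hνb, hem]
  · rw [hνb]
    rintro rfl
    exact hmn (Submodule.zero_mem _)
  · exact hμl.congr h5 (hμ.trans hνb.symm) fun i hi => (if_pos hi).symm
  · refine hμl'.congr (by rwa [SimpleGraph.Dart.symm_symm]) ?_ fun i hi => (if_neg ?_).symm
    · rw [src_symm, hνb, hμ']
    · intro h
      rw [SimpleGraph.Dart.symm_symm] at hi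
      obtain ⟨a, rfl⟩ := exists_src_eq i
      exact (hi _ (fst_mem_src a)).not_symm (h _ (fst_mem_src a))
  · intro N _ _ hN κ hκ hκl hκl'
    let _ := Module.compHom N (algebraMap K (Γ.Alg K))
    have := isScalarTower_compHom (Γ := Γ) (K := K) N
    obtain ⟨φ, hφ, hker⟩ := Submodule.exists_form_eq_one hmn
    have hU : ∀ x ∈ U, φ x = 0 := fun x hx => hker x (Submodule.mem_sup_left hx)
    have hW : ∀ x ∈ W, φ x = 0 := fun x hx => hker x (Submodule.mem_sup_right hx)
    have hlift := h7 φ hU N hN κ hκl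
    have hlift' := k7 φ hW N hN κ hκl'
    rw [src_symm] at hlift'
    obtain ⟨g, hg⟩ := HasLift.exists_linearMap hκ (fun x => hW _ (k1 (by
      have := arr_smul_mem_image (K := K) b.symm x
      rwa [SimpleGraph.Dart.symm_symm] at this)))
      (fun x => hU _ (h1 (arr_smul_mem_image b x))) hlift hlift'
    exact ⟨g, by rw [hνb, hg m hem, hφ, one_smul]⟩

theorem AdmissiblePath.arc_per_smul_cokernel {Θ : Γ.AdmissiblePath K}
    {Λ : Set (Γ.Arrow × Γ.Arrow)} (hΛ : IsZigzag Λ) (hΘ : Θ.arrows = runArrows Λ)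
    (a : Γ.Arrow) (x : Θ.Cokernel) : arc K a (per a) • x = 0 := by
  obtain ⟨c, rfl⟩ := Θ.exists_eq_sum_cokernelGen x
  rw [Finset.smul_sum]
  refine Finset.sum_eq_zero fun j _ => ?_
  obtain ⟨r, hr⟩ := exists_arc_per_mul a (c j)
  rw [← mul_smul, ← mul_assoc, hr, smul_mul_assoc, algebraMap_smul_mul_smul]
  obtain ⟨σ, τ, h, hj⟩ := (hΛ.isSink_iff hΘ).1 j.2
  by_cases ha : Γ.src a = j.1
  · have hτ : Γ.src a = Γ.src τ := ha.trans hj.symm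
    rw [← ha, arc_per_mul_e, arc_per_of_src_eq hτ, hτ,
      (isSolution_cokernelGen hΛ hΘ).arc_per_smul hΛ h, smul_zero]
  · rw [← arc_per_mul_e, mul_assoc, e_mul_e_of_ne ha, mul_zero, zero_smul, smul_zero]

theorem arc_per_smul_proj_mod_socle (b a : Γ.Arrow)
    (x : Γ.proj K (Γ.src b) ⧸ moduleSocle (Γ.Alg K) (Γ.proj K (Γ.src b))) :
    arc K a (per a) • x = 0 := by
  obtain ⟨y, rfl⟩ := Submodule.Quotient.mk_surjective _ x
  rw [← Submodule.Quotient.mk_smul, Submodule.Quotient.mk_eq_zero]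
  by_cases ha : Γ.src a = Γ.src b
  · rw [arc_per_of_src_eq ha]
    obtain ⟨r, hr⟩ := exists_arc_per_mul b (y : Γ.Alg K)
    have := Submodule.smul_mem _ (algebraMap K (Γ.Alg K) r) (arc_per_mem_moduleSocle (K := K) b)
    convert this using 1
    exact Subtype.ext (hr.trans (Algebra.smul_def _ _))
  · obtain ⟨r, hr⟩ := exists_arc_per_mul a (y : Γ.Alg K)
    have h0 : arc K a (per a) * Γ.e K (Γ.src b) = 0 :=
      arc_mul_e_of_ne (by rwa [iterate_per])
    have h1 : arc K a (per a) • y = 0 := by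
      apply Subtype.ext
      change arc K a (per a) * (y : Γ.Alg K) = 0
      rw [← mem_proj_iff.1 y.2, ← mul_assoc, hr, smul_mul_assoc, h0, smul_zero]
    rw [h1]
    exact Submodule.zero_mem _

/-- The indecomposable modules that are neither projective nor projective modulo the socle are the
cokernels of the complexes of paths. -/
theorem exists_equiv_cokernel {M : Type*} [AddCommGroup M] [Module (Γ.Alg K) M]
    (hM : IsIndecomposableModule (Γ.Alg K) M) (hp : ¬ Module.Projective (Γ.Alg K) M)
    (hs : ∀ b : Γ.Arrow, IsEmpty (M ≃ₗ[Γ.Alg K]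
      Γ.proj K (Γ.src b) ⧸ moduleSocle (Γ.Alg K) (Γ.proj K (Γ.src b)))) :
    ∃ Θ : Γ.AdmissiblePath K, Nonempty (M ≃ₗ[Γ.Alg K] Θ.Cokernel) := by
  have := hM.1
  have hsoc := arc_per_smul_eq_zero hM hp
  obtain ⟨b, l, l', μ, hl, hl', hμb, hμ0, hμ, hμ', huniv⟩ := exists_words.{u, v, max u v} hsoc
  by_cases hlen : l = [] ∧ l' = []
  · obtain ⟨rfl, rfl⟩ := hlen
    exfalso
    set P := Γ.proj K (Γ.src b)
    let n : P ⧸ moduleSocle (Γ.Alg K) P :=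
      Submodule.Quotient.mk ⟨Γ.e K (Γ.src b), Submodule.mem_span_singleton_self _⟩
    have hn : ∀ y : P, Submodule.Quotient.mk y = (y : Γ.Alg K) • n := fun y =>
      congrArg Submodule.Quotient.mk (Subtype.ext (mem_proj_iff.1 y.2).symm :
        y = (y : Γ.Alg K) • ⟨Γ.e K (Γ.src b), Submodule.mem_span_singleton_self _⟩)
    obtain ⟨g, hg⟩ := huniv (P ⧸ moduleSocle (Γ.Alg K) P) (arc_per_smul_proj_mod_socle b)
      (fun _ => n)
      (hn ⟨Γ.e K (Γ.src b), Submodule.mem_span_singleton_self _⟩).symm trivial trivial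
    let f₀ : P →ₗ[Γ.Alg K] M :=
      (LinearMap.toSpanSingleton (Γ.Alg K) M (μ (Γ.src b))).comp P.subtype
    have hker : moduleSocle (Γ.Alg K) P ≤ LinearMap.ker f₀ := by
      intro x hx
      obtain ⟨s, hs⟩ := exists_eq_smul_arc_per (mem_proj_iff.1 x.2) fun a => by
        have := moduleSocle_le_arrowKernel hx a 1
        rw [one_smul] at this
        exact congrArg Subtype.val this
      change (x : Γ.Alg K) • μ (Γ.src b) = 0
      rw [hs, algebraMap_smul_mul_smul, hsoc, smul_zero]
    let f := (moduleSocle (Γ.Alg K) P).liftQ f₀ hker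
    have hfn : f n = μ (Γ.src b) := hμb
    have hgf : ∀ x, g (f x) = x := by
      intro x
      obtain ⟨y, rfl⟩ := Submodule.Quotient.mk_surjective _ x
      rw [hn, map_smul, map_smul, hfn, hg]
    have : Nontrivial (P ⧸ moduleSocle (Γ.Alg K) P) :=
      ⟨⟨n, 0, fun h => hμ0 (by rw [← hfn, h, map_zero])⟩⟩
    exact (hs b).false (LinearEquiv.ofBijective f (bijective_of_retract hM f g hgf)).symm
  · obtain ⟨s, L, hL, hlen', hΛ'⟩ := exists_links_eq_union l false b l' hl hl'
    have hlen2 : 2 ≤ L.length := by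
      rcases l with _ | ⟨c, l⟩
      · rcases l' with _ | ⟨c, l'⟩
        · exact absurd ⟨rfl, rfl⟩ hlen
        · rw [hlen', List.length_cons]
          omega
      · rw [hlen', List.length_cons]
        omega
    have hΛ := isZigzag_links (t := s) hL hlen2
    obtain ⟨Θ, hΘ⟩ := exists_path_of_isChain K (t := s) hL hlen2
    set Λ := links s L
    have hsub : links false (b.symm :: l) ⊆ Λ := by
      rw [hΛ']
      exact Set.subset_union_left
    have hsub' : links false (b.symm.symm :: l') ⊆ Λ := by
      rw [hΛ', SimpleGraph.Dart.symm_symm]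
      exact Set.subset_union_right
    have hB : ∀ {σ τ}, (σ, τ) ∈ Λ → Beyond b.symm σ.fst →
        (σ, τ) ∈ links false (b.symm :: l) := by
      intro σ τ h h'
      rw [hΛ'] at h
      exact h.resolve_right fun h => (beyond_of_mem_links hl' h).not_symm h'
    have hB' : ∀ {σ τ}, (σ, τ) ∈ Λ → Beyond b.symm.symm σ.fst →
        (σ, τ) ∈ links false (b.symm.symm :: l') := by
      intro σ τ h h'
      rw [hΛ'] at h
      rw [SimpleGraph.Dart.symm_symm] at h' ⊢
      exact h.resolve_left fun h => h'.not_symm (beyond_of_mem_links hl h)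
    have hl'' : (b.symm.symm :: l').IsChain Turn := by rwa [SimpleGraph.Dart.symm_symm]
    have hsink : ∃ σ τ, (σ, τ) ∈ Λ ∧ Γ.src τ = Γ.src b := by
      rcases l with _ | ⟨c, l⟩
      · rcases l' with _ | ⟨c, l'⟩
        · exact absurd ⟨rfl, rfl⟩ hlen
        · rw [links_false_cons_cons] at hsub'
          exact ⟨_, _, hsub' (Set.mem_insert _ _), by rw [src_symm, src_symm, src_symm]⟩
      · rw [links_false_cons_cons] at hsub
        exact ⟨_, _, hsub (Set.mem_insert _ _), by rw [src_symm, src_symm]⟩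
    obtain ⟨σ, τ, hστ, hτ⟩ := hsink
    have hsol := AdmissiblePath.isSolution_cokernelGen hΛ hΘ
    have hgb : Γ.e K (Γ.src b) • Θ.cokernelGen (Γ.src b) = Θ.cokernelGen (Γ.src b) := by
      rw [← hτ]
      exact hsol.e_smul hστ
    obtain ⟨g, hg⟩ := huniv Θ.Cokernel (AdmissiblePath.arc_per_smul_cokernel hΛ hΘ) Θ.cokernelGen
      hgb
      ((wordRelations_iff hΛ hl hsub hB hgb).2 fun h =>
        ⟨hsol.e_smul (hsub h), hsol.rel (hsub h)⟩)
      ((wordRelations_iff hΛ hl'' hsub' hB' (by rwa [src_symm])).2 fun h =>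
        ⟨hsol.e_smul (hsub' h), hsol.rel (hsub' h)⟩)
    have hall : ∀ {σ τ}, (σ, τ) ∈ Λ → Γ.e K (Γ.src τ) • μ (Γ.src τ) = μ (Γ.src τ) ∧
        linkValue (K := K) Λ μ σ + linkValue (K := K) Λ μ σ.symm = 0 := by
      intro σ τ h
      rw [hΛ'] at h
      rcases h with h | h
      · exact (wordRelations_iff hΛ hl hsub hB hμb).1 hμ h
      · exact (wordRelations_iff hΛ hl'' hsub' hB' (by rwa [src_symm])).1 hμ'
          (by rwa [SimpleGraph.Dart.symm_symm])
    obtain ⟨f, hf⟩ := AdmissiblePath.exists_map_cokernel hΛ hΘ (μ := μ)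
      ⟨fun h => (hall h).1, fun h => (hall h).2⟩
    obtain ⟨r, hr⟩ := AdmissiblePath.exists_endomorphism_eq hΛ hΘ (g.comp f)
    have hfb := hf hστ
    rw [hτ] at hfb
    have hr1 : r = 1 := by
      have h3 := hr (Θ.cokernelGen (Γ.src b))
      rw [LinearMap.comp_apply, hfb, hg] at h3
      have h5 : algebraMap K (Γ.Alg K) (1 - r) • Θ.cokernelGen (Γ.src b) = 0 := by
        rw [map_sub, map_one, sub_smul, one_smul, ← h3, sub_self]
      have h4 := AdmissiblePath.cokernelGen_ne_zero hΛ hΘ hστ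
      rw [hτ] at h4
      exact (sub_eq_zero.1 ((algebraMap_smul_eq_zero h5).resolve_right h4)).symm
    have hgf : ∀ x, g (f x) = x := by
      intro x
      have h3 := hr x
      rwa [hr1, map_one, one_smul] at h3
    have := AdmissiblePath.nontrivial_cokernel hΛ hΘ
    exact ⟨Θ, ⟨(LinearEquiv.ofBijective f (bijective_of_retract hM f g hgf)).symm⟩⟩

/-- Every presentation is isomorphic to the complex of a path. -/
theorem exists_complexIso (T : Presentation (Γ.Alg K)) :
    ∃ Θ : Γ.AdmissiblePath K, ComplexIso T.d Θ.differential := by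
  obtain ⟨Θ, ⟨θ⟩⟩ := exists_equiv_cokernel T.indecomposable T.not_projective fun b =>
    T.not_mod_socle _ (finite_proj _) (projective_proj _) (isIndecomposable_proj b)
  obtain ⟨Λ, hΛ, hΘ⟩ := exists_zigzag_of_path Θ
  exact ⟨Θ, complexIso_of_equiv T.minimal
    (AdmissiblePath.isMinimalProjectivePresentation hΛ hΘ) θ⟩

end BrauerTree

/-- Isomorphism classes of minimal projective presentations correspond one-to-one to admissible
paths, and every presentation is isomorphic to the complex of the corresponding path. -/
theorem presentations_correspond_to_paths {K : Type u} [Field K] [IsAlgClosed K]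
    {V : Type v} [Finite V] (Γ : BrauerTree V) :
    ∃ E : PresentationClass (Γ.Alg K) ≃ Γ.AdmissiblePath K,
      ∀ T : Presentation (Γ.Alg K),
        ComplexIso T.d (E (Quotient.mk (Presentation.setoid (Γ.Alg K)) T)).differential := by
  choose T hT using fun Θ : Γ.AdmissiblePath K => Θ.exists_presentation
  let S := Presentation.setoid (Γ.Alg K)
  have hbij : Function.Bijective fun Θ : Γ.AdmissiblePath K => Quotient.mk S (T Θ) := by
    constructor
    · intro Θ Θ' h
      exact BrauerTree.AdmissiblePath.eq_of_complexIso
        (((hT Θ).symm.trans (Quotient.exact h)).trans (hT Θ'))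
    · intro c
      obtain ⟨T', rfl⟩ := Quotient.exists_rep c
      obtain ⟨Θ, hΘ⟩ := BrauerTree.exists_complexIso T'
      exact ⟨Θ, Quotient.sound ((hT Θ).trans hΘ.symm)⟩
  refine ⟨(Equiv.ofBijective _ hbij).symm, fun T' => ?_⟩
  have h := (Equiv.ofBijective _ hbij).apply_symm_apply (Quotient.mk S T')
  have h' : ComplexIso (T ((Equiv.ofBijective _ hbij).symm (Quotient.mk S T'))).d T'.d :=
    Quotient.exact h
  exact h'.symm.trans (hT _)
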